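/- Let N ≥ 2, 0 < p < N, Ω ⊆ ℝ^N open, and let A(x,D) = Σ_{|α|≤m} a_α(x)∂^α be an elliptic linear differential operator of order m with smooth matrix coefficients on Ω (from ℂ^{n₁}- to ℂ^{n₂}-valued functions, n₂ ≥ n₁), with principal part A_ν(x,D) := Σ_{|α|=m} a_α(x)∂^α. Then for every x₀ ∈ Ω there exist an open ball B = B(x₀,ℓ) ⊂ Ω and a constant C = C(B,p,N) > 0 such that Σ_{|β|=m} ‖∂^β u‖_{h^p} ≤ C ‖A_ν(·,D)u‖_{h^p} for all u ∈ C_c^∞(B, ℂ^{n₁}). -/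

import Mathlib

open MeasureTheory Set Metric Filter
open scoped ENNReal NNReal Topology

noncomputable section

abbrev RN (N : ℕ) := EuclideanSpace ℝ (Fin N)

variable {N : ℕ}

/-- Partial derivative in the `i`-th coordinate direction. -/
def pd {E : Type*} [NormedAddCommGroup E] [NormedSpace ℝ E] (i : Fin N)
    (f : RN N → E) : RN N → E :=
  fun x => fderiv ℝ f x (EuclideanSpace.single i 1)

/-- Multi-index partial derivative `∂^α`. -/
def md {E : Type*} [NormedAddCommGroup E] [NormedSpace ℝ E] (α : Fin N → ℕ)
    (f : RN N → E) : RN N → E :=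
  ((List.ofFn fun i : Fin N => (pd i)^[α i]).foldr (· ∘ ·) id) f

/-- Order `|α|` of a multi-index. -/
def mOrder (α : Fin N → ℕ) : ℕ := ∑ i, α i

/-- Multi-indices of order at most `k`. -/
def idxLe (N k : ℕ) : Finset (Fin N → ℕ) :=
  (Fintype.piFinset fun _ : Fin N => Finset.range (k + 1)).filter fun α => mOrder α ≤ k

/-- Multi-indices of order exactly `k`. -/
def idxEq (N k : ℕ) : Finset (Fin N → ℕ) :=
  (Fintype.piFinset fun _ : Fin N => Finset.range (k + 1)).filter fun α => mOrder α = k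

/-- The dilate `φ_t(z) = t^{-N} φ(z/t)`. -/
def dil (φ : RN N → ℝ) (t : ℝ) (z : RN N) : ℝ := φ (t⁻¹ • z) / t ^ N

/-- Convolution `(u * φ_t)(x)`. -/
def convAt (φ : RN N → ℝ) (t : ℝ) (u : RN N → ℂ) (x : RN N) : ℂ :=
  ∫ y, dil φ t (x - y) • u y

/-- The small maximal function `sup_{0<t<1} |(u * φ_t)(x)|`. -/
def smallMax (φ : RN N → ℝ) (u : RN N → ℂ) (x : RN N) : ℝ≥0∞ :=
  ⨆ t ∈ Ioo (0 : ℝ) 1, ENNReal.ofReal ‖convAt φ t u x‖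

/-- The localizable Hardy space quasi-norm `‖u‖_{h^p}` (for `0 < p < ∞`). -/
def hNorm (φ : RN N → ℝ) (p : ℝ) (u : RN N → ℂ) : ℝ≥0∞ :=
  (∫⁻ x, smallMax φ u x ^ p) ^ (1 / p)

/-- A fixed radial nonnegative smooth function supported in the unit ball with integral 1. -/
structure GoodPhi (φ : RN N → ℝ) : Prop where
  smooth : ContDiff ℝ (⊤ : ℕ∞) φ
  nonneg : ∀ x, 0 ≤ φ x
  radial : ∀ x y : RN N, ‖x‖ = ‖y‖ → φ x = φ y
  supp : tsupport φ ⊆ closedBall 0 1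
  int_one : ∫ x, φ x = 1

/-- `h^p` quasi-norm of a `ℂ^n`-valued function: sum of the quasi-norms of its components. -/
def hNormVec (φ : RN N → ℝ) (p : ℝ) {n : ℕ} (u : RN N → (Fin n → ℂ)) : ℝ≥0∞ :=
  ∑ j, hNorm φ p fun x => u x j

/-- The operator `A(x,D)φ(x) = Σ_{|α| ≤ m} a_α(x) ∂^α φ(x)`. -/
def applyA {N n₁ n₂ : ℕ} (a : (Fin N → ℕ) → RN N → Matrix (Fin n₂) (Fin n₁) ℂ) (m : ℕ)
    (φ : RN N → (Fin n₁ → ℂ)) : RN N → (Fin n₂ → ℂ) :=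
  fun x => ∑ α ∈ idxLe N m, (a α x).mulVec (md α φ x)

/-- The principal part `A_ν(x,D)φ(x) = Σ_{|α| = m} a_α(x) ∂^α φ(x)`. -/
def applyAP {N n₁ n₂ : ℕ} (a : (Fin N → ℕ) → RN N → Matrix (Fin n₂) (Fin n₁) ℂ) (m : ℕ)
    (φ : RN N → (Fin n₁ → ℂ)) : RN N → (Fin n₂ → ℂ) :=
  fun x => ∑ α ∈ idxEq N m, (a α x).mulVec (md α φ x)

/-- The formal adjoint `A*(x,D)ψ = Σ_{|α| ≤ m} (-1)^{|α|} ∂^α (ā_α^T ψ)`. -/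
def applyAdj {N n₁ n₂ : ℕ} (a : (Fin N → ℕ) → RN N → Matrix (Fin n₂) (Fin n₁) ℂ) (m : ℕ)
    (ψ : RN N → (Fin n₂ → ℂ)) : RN N → (Fin n₁ → ℂ) :=
  fun x => ∑ α ∈ idxLe N m,
    ((-1 : ℂ) ^ mOrder α) • md α (fun y => (a α y).conjTranspose.mulVec (ψ y)) x

/-- Ellipticity: the principal symbol is injective at every point of `Ω`
for every nonzero real frequency `ξ`. -/
def Elliptic {N n₁ n₂ : ℕ} (a : (Fin N → ℕ) → RN N → Matrix (Fin n₂) (Fin n₁) ℂ) (m : ℕ)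
    (Ω : Set (RN N)) : Prop :=
  ∀ x ∈ Ω, ∀ ξ : RN N, ξ ≠ 0 →
    Function.Injective fun w : Fin n₁ → ℂ =>
      (∑ α ∈ idxEq N m, (∏ i, ((ξ i : ℝ) : ℂ) ^ α i) • a α x).mulVec w

/-- The Sobolev norm `‖v‖_{W^{k,q}} = Σ_{|γ| ≤ k} ‖∂^γ v‖_{L^q}`. -/
def sobNorm {N : ℕ} (q : ℝ≥0∞) (k : ℕ) {n : ℕ} (v : RN N → (Fin n → ℂ)) : ℝ≥0∞ :=
  ∑ γ ∈ idxLe N k, eLpNorm (md γ v) q volume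

/-! ### Layer-cake interpolation -/

theorem lintegral_rpow_layercake {α : Type*} [MeasurableSpace α] (μ : Measure α) {F : α → ℝ≥0∞}
    (hF : Measurable F) (hfin : ∀ x, F x ≠ ⊤) {p : ℝ} (hp : 0 < p) :
    ∫⁻ x, F x ^ p ∂μ = ENNReal.ofReal p *
      ∫⁻ t in Ioi (0 : ℝ), μ {x | ENNReal.ofReal t < F x} * ENNReal.ofReal (t ^ (p - 1)) := by
  have h := lintegral_rpow_eq_lintegral_meas_lt_mul μ (f := fun x => (F x).toReal)
    (Eventually.of_forall fun x => ENNReal.toReal_nonneg) hF.ennreal_toReal.aemeasurable hp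
  have h1 : ∀ x, ENNReal.ofReal ((F x).toReal ^ p) = F x ^ p := fun x => by
    rw [← ENNReal.ofReal_rpow_of_nonneg ENNReal.toReal_nonneg hp.le,
      ENNReal.ofReal_toReal (hfin x)]
  simp only [h1] at h
  rw [h]
  congr 1
  refine setLIntegral_congr_fun measurableSet_Ioi fun t ht => ?_
  have : {x | t < (F x).toReal} = {x | ENNReal.ofReal t < F x} := by
    ext x
    simp only [mem_ofPred_eq]
    rw [ENNReal.ofReal_lt_iff_lt_toReal (le_of_lt ht) (hfin x)]
  simp only [this]

theorem lintegral_indicator_lt_rpow {a : ℝ≥0∞} (ha : a ≠ ⊤) {p : ℝ} (hp : 0 < p) :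
    ∫⁻ t in Ioi (0 : ℝ), (if ENNReal.ofReal t < a then ENNReal.ofReal (t ^ (p - 1)) else 0)
      = ENNReal.ofReal p⁻¹ * a ^ p := by
  have h := lintegral_rpow_layercake (Measure.dirac ()) (F := fun _ => a) measurable_const
    (fun _ => ha) hp
  rw [lintegral_dirac] at h
  rw [h, ← mul_assoc, ← ENNReal.ofReal_mul (by positivity), inv_mul_cancel₀ hp.ne',
    ENNReal.ofReal_one, one_mul]
  refine lintegral_congr fun t => ?_
  by_cases ht : ENNReal.ofReal t < a <;> simp [ht]

theorem lintegral_indicator_ge_rpow {a : ℝ≥0∞} (ha : a ≠ ⊤) {p : ℝ} (hp : p < 2) :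
    ∫⁻ t in Ioi (0 : ℝ), (if a ≤ ENNReal.ofReal t then a ^ (2 : ℝ) *
      ENNReal.ofReal (t ^ (p - 3)) else 0) ≤ ENNReal.ofReal (2 - p)⁻¹ * a ^ p := by
  rcases eq_or_ne a 0 with rfl | h0
  · simp
  have hapos : 0 < a.toReal := ENNReal.toReal_pos h0 ha
  have e : ∀ t ∈ Ioi (0 : ℝ), (if a ≤ ENNReal.ofReal t then a ^ (2 : ℝ) *
      ENNReal.ofReal (t ^ (p - 3)) else 0) = (Ici a.toReal).indicator
        (fun t => a ^ (2 : ℝ) * ENNReal.ofReal (t ^ (p - 3))) t := by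
    intro t ht
    have : a ≤ ENNReal.ofReal t ↔ a.toReal ≤ t := by
      rw [← ENNReal.ofReal_toReal ha, ENNReal.ofReal_le_ofReal_iff (le_of_lt ht),
        ENNReal.toReal_ofReal ENNReal.toReal_nonneg]
    by_cases h : a.toReal ≤ t <;> simp [this, h]
  rw [setLIntegral_congr_fun measurableSet_Ioi e, lintegral_indicator measurableSet_Ici,
    Measure.restrict_restrict measurableSet_Ici,
    show Ici a.toReal ∩ Ioi 0 = Ici a.toReal from
      inter_eq_left.2 fun t ht => lt_of_lt_of_le hapos ht,
    ← restrict_Ioi_eq_restrict_Ici, lintegral_const_mul' _ _ (by simp [ha]),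
    ← ofReal_integral_eq_lintegral_ofReal (integrableOn_Ioi_rpow_of_lt (by linarith) hapos),
    integral_Ioi_rpow_of_lt (by linarith) hapos]
  · have : -a.toReal ^ (p - 3 + 1) / (p - 3 + 1) = (2 - p)⁻¹ * a.toReal ^ (p - 2) := by
      rw [show p - 3 + 1 = -(2 - p) by ring, show p - 2 = -(2 - p) by ring]
      field_simp
    rw [this, ENNReal.ofReal_mul (inv_nonneg.2 (by linarith)),
      ← ENNReal.ofReal_rpow_of_pos hapos, ENNReal.ofReal_toReal ha, mul_left_comm,
      ← ENNReal.rpow_add _ _ h0 ha]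
    simp
  · refine (ae_restrict_iff' measurableSet_Ioi).2 (Eventually.of_forall fun t ht => ?_)
    have : 0 < t := lt_trans hapos ht
    positivity

theorem lintegral_rpow_le_of_weak_type {α : Type*} [MeasurableSpace α] (μ : Measure α) [SFinite μ]
    {F h : α → ℝ≥0∞} (hF : Measurable F) (hFfin : ∀ x, F x ≠ ⊤) (hh : Measurable h)
    (hhfin : ∀ x, h x ≠ ⊤) {q : ℝ} (hq : 1 < q) (C : ℝ≥0∞)
    (H : ∀ t : ℝ, 0 < t → μ {x | ENNReal.ofReal t < F x} ≤
      C * ENNReal.ofReal t⁻¹ * ∫⁻ x, (if ENNReal.ofReal t < h x then h x else 0) ∂μ) :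
    ∫⁻ x, F x ^ q ∂μ ≤ ENNReal.ofReal q * C * ENNReal.ofReal (q - 1)⁻¹ * ∫⁻ x, h x ^ q ∂μ := by
  rw [lintegral_rpow_layercake μ hF hFfin (by linarith), mul_assoc, mul_assoc]
  gcongr
  have hm : Measurable fun z : ℝ × α => if ENNReal.ofReal z.1 < h z.2 then h z.2 *
      ENNReal.ofReal (z.1 ^ (q - 1 - 1)) else 0 := by
    refine Measurable.ite (measurableSet_lt (by fun_prop) (by fun_prop)) ?_ measurable_const
    fun_prop
  calc ∫⁻ t in Ioi (0 : ℝ), μ {x | ENNReal.ofReal t < F x} * ENNReal.ofReal (t ^ (q - 1))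
      ≤ ∫⁻ t in Ioi (0 : ℝ), C * ∫⁻ x, (if ENNReal.ofReal t < h x then h x *
          ENNReal.ofReal (t ^ (q - 1 - 1)) else 0) ∂μ := by
        refine setLIntegral_mono' measurableSet_Ioi fun t ht => ?_
        have ht' : (0 : ℝ) < t := ht
        calc _ ≤ (C * ENNReal.ofReal t⁻¹ * ∫⁻ x, (if ENNReal.ofReal t < h x then h x else 0) ∂μ)
              * ENNReal.ofReal (t ^ (q - 1)) := by gcongr; exact H t ht
          _ = C * ((∫⁻ x, (if ENNReal.ofReal t < h x then h x else 0) ∂μ) *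
              ENNReal.ofReal (t ^ (q - 1 - 1))) := by
            rw [show t ^ (q - 1 - 1) = t⁻¹ * t ^ (q - 1) by
              rw [Real.rpow_sub_one ht'.ne']; field_simp, ENNReal.ofReal_mul (by positivity)]
            ring
          _ ≤ _ := by
            gcongr
            rw [← lintegral_mul_const' _ _ ENNReal.ofReal_ne_top]
            refine lintegral_mono fun x => ?_
            by_cases h : ENNReal.ofReal t < h x <;> simp [h]
    _ = C * ∫⁻ x, (∫⁻ t in Ioi (0 : ℝ), (if ENNReal.ofReal t < h x then h x *
          ENNReal.ofReal (t ^ (q - 1 - 1)) else 0)) ∂μ := by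
        rw [lintegral_const_mul _ (hm.lintegral_prod_right'), lintegral_lintegral_swap]
        exact hm.aemeasurable
    _ ≤ C * ∫⁻ x, ENNReal.ofReal (q - 1)⁻¹ * h x ^ q ∂μ := by
        gcongr with x
        rcases eq_or_ne (h x) 0 with h0 | h0
        · simp [h0]
        have := lintegral_indicator_lt_rpow (hhfin x) (show 0 < q - 1 by linarith)
        calc _ = ∫⁻ t in Ioi (0 : ℝ), h x * (if ENNReal.ofReal t < h x then
                ENNReal.ofReal (t ^ (q - 1 - 1)) else 0) := by
              refine lintegral_congr fun t => ?_
              by_cases h : ENNReal.ofReal t < h x <;> simp [h]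
          _ = ENNReal.ofReal (q - 1)⁻¹ * (h x ^ (1 : ℝ) * h x ^ (q - 1)) := by
              rw [lintegral_const_mul' _ _ (hhfin x), this, ENNReal.rpow_one]; ring
          _ ≤ _ := by rw [← ENNReal.rpow_add _ _ h0 (hhfin x)]; simp
    _ = _ := by rw [lintegral_const_mul _ (by fun_prop)]

theorem lintegral_rpow_le_of_good_level {α : Type*} [MeasurableSpace α] (μ : Measure α) [SFinite μ]
    {F G : α → ℝ≥0∞} (hF : Measurable F) (hFfin : ∀ x, F x ≠ ⊤) (hG : Measurable G)
    (hGfin : ∀ x, G x ≠ ⊤) {p : ℝ} (hp0 : 0 < p) (hp : p < 2) (A B : ℝ≥0∞)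
    (H : ∀ t : ℝ, 0 < t → μ {x | ENNReal.ofReal t < F x} ≤
      A * μ {x | ENNReal.ofReal t < G x} + B * ENNReal.ofReal (t⁻¹ ^ 2) *
        ∫⁻ x, (if G x ≤ ENNReal.ofReal t then G x ^ (2 : ℝ) else 0) ∂μ) :
    ∫⁻ x, F x ^ p ∂μ ≤ (A + ENNReal.ofReal p * B * ENNReal.ofReal (2 - p)⁻¹) *
      ∫⁻ x, G x ^ p ∂μ := by
  have hm : Measurable fun z : ℝ × α => if G z.2 ≤ ENNReal.ofReal z.1 then G z.2 ^ (2 : ℝ) *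
      ENNReal.ofReal (z.1 ^ (p - 3)) else 0 := by
    refine Measurable.ite (measurableSet_le (by fun_prop) (by fun_prop)) ?_ measurable_const
    fun_prop
  have hmG : Measurable fun t : ℝ => μ {x | ENNReal.ofReal t < G x} :=
    measurable_measure_prodMk_left (s := {z : ℝ × α | ENNReal.ofReal z.1 < G z.2})
      (measurableSet_lt (by fun_prop) (by fun_prop))
  have hmGp : Measurable fun t : ℝ => μ {x | ENNReal.ofReal t < G x} *
      ENNReal.ofReal (t ^ (p - 1)) := hmG.mul (by fun_prop)
  rw [lintegral_rpow_layercake μ hF hFfin hp0, add_mul]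
  calc _ ≤ ENNReal.ofReal p * (∫⁻ t in Ioi (0 : ℝ), (A * (μ {x | ENNReal.ofReal t < G x} *
        ENNReal.ofReal (t ^ (p - 1))) + B * ∫⁻ x, (if G x ≤ ENNReal.ofReal t then G x ^ (2 : ℝ) *
          ENNReal.ofReal (t ^ (p - 3)) else 0) ∂μ)) := by
        gcongr 1
        refine setLIntegral_mono' measurableSet_Ioi fun t ht => ?_
        have ht' : (0 : ℝ) < t := ht
        refine (mul_le_mul_left (H t ht) _).trans ?_
        rw [add_mul]
        refine add_le_add (by rw [mul_assoc]) ?_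
        calc _ = B * ((∫⁻ x, (if G x ≤ ENNReal.ofReal t then G x ^ (2 : ℝ) else 0) ∂μ) *
              ENNReal.ofReal (t ^ (p - 3))) := by
              rw [show p - 3 = p - 1 - 1 - 1 by ring, show t ^ (p - 1 - 1 - 1) =
                t⁻¹ ^ 2 * t ^ (p - 1) by
                rw [Real.rpow_sub_one ht'.ne', Real.rpow_sub_one ht'.ne']; field_simp,
                ENNReal.ofReal_mul (by positivity)]
              ring
          _ ≤ _ := by
            gcongr
            rw [← lintegral_mul_const' _ _ ENNReal.ofReal_ne_top]
            refine lintegral_mono fun x => ?_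
            by_cases h : G x ≤ ENNReal.ofReal t <;> simp [h]
    _ = A * (ENNReal.ofReal p * ∫⁻ t in Ioi (0 : ℝ), (μ {x | ENNReal.ofReal t < G x} *
        ENNReal.ofReal (t ^ (p - 1)))) + ENNReal.ofReal p * B *
        ∫⁻ x, (∫⁻ t in Ioi (0 : ℝ), (if G x ≤ ENNReal.ofReal t then G x ^ (2 : ℝ) *
          ENNReal.ofReal (t ^ (p - 3)) else 0)) ∂μ := by
        rw [lintegral_add_right _ (by exact hm.lintegral_prod_right'.const_mul B),
          lintegral_const_mul _ hmGp, lintegral_const_mul _ (hm.lintegral_prod_right'),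
          lintegral_lintegral_swap (by exact hm.aemeasurable)]
        ring
    _ ≤ _ := by
        rw [← lintegral_rpow_layercake μ hG hGfin hp0]
        refine add_le_add le_rfl ?_
        rw [mul_assoc (ENNReal.ofReal p * B), ← lintegral_const_mul' _ _ ENNReal.ofReal_ne_top]
        exact mul_le_mul_right (lintegral_mono fun x =>
          lintegral_indicator_ge_rpow (hGfin x) hp) _

/-! ### The Hardy–Littlewood maximal function -/

/-- The centered Hardy–Littlewood maximal function of a nonnegative function. -/
def hlMax (h : RN N → ℝ≥0∞) (x : RN N) : ℝ≥0∞ :=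
  ⨆ s ∈ Ioi (0 : ℝ), (∫⁻ y in ball x s, h y) / volume (ball (0 : RN N) s)

theorem lowerSemicontinuous_lintegral_ball (h : RN N → ℝ≥0∞) (s : ℝ) :
    LowerSemicontinuous fun x => ∫⁻ y in ball x s, h y := by
  intro x a ha
  have hν : ∀ z r, ∫⁻ y in ball z r, h y = (volume.withDensity h) (ball z r) := fun z r =>
    (withDensity_apply h measurableSet_ball).symm
  simp only [hν] at ha ⊢
  have hU : ball x s = ⋃ n : ℕ, ball x (s - 1 / ((n : ℝ) + 1)) := by
    ext y
    simp only [mem_ball, mem_iUnion]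
    constructor
    · intro hy
      obtain ⟨n, hn⟩ := exists_nat_one_div_lt (sub_pos.2 hy)
      exact ⟨n, by linarith⟩
    · rintro ⟨n, hn⟩
      have : (0 : ℝ) < 1 / ((n : ℝ) + 1) := by positivity
      linarith
  have hmono : Monotone fun n : ℕ => ball x (s - 1 / ((n : ℝ) + 1)) := by
    intro m n hmn
    refine ball_subset_ball ?_
    have : (1 : ℝ) / ((n : ℝ) + 1) ≤ 1 / ((m : ℝ) + 1) := by gcongr
    linarith
  rw [hU, hmono.measure_iUnion] at ha
  obtain ⟨n, hn⟩ := lt_iSup_iff.1 ha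
  filter_upwards [ball_mem_nhds x (show (0 : ℝ) < 1 / ((n : ℝ) + 1) by positivity)] with z hz
  refine hn.trans_le (measure_mono (ball_subset_ball' ?_))
  have := mem_ball'.1 hz
  linarith

theorem lowerSemicontinuous_hlMax (h : RN N → ℝ≥0∞) : LowerSemicontinuous (hlMax h) := by
  refine lowerSemicontinuous_iSup fun s => lowerSemicontinuous_iSup fun hs => ?_
  intro x a ha
  have hs' : (0 : ℝ) < s := hs
  have h0 : volume (ball (0 : RN N) s) ≠ 0 := (measure_ball_pos _ _ hs').ne'
  have h1 : volume (ball (0 : RN N) s) ≠ ⊤ := measure_ball_lt_top.ne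
  filter_upwards [lowerSemicontinuous_lintegral_ball h s x (a * volume (ball (0 : RN N) s))
    ((ENNReal.lt_div_iff_mul_lt (Or.inl h0) (Or.inl h1)).1 ha)] with z hz
  exact (ENNReal.lt_div_iff_mul_lt (Or.inl h0) (Or.inl h1)).2 hz

theorem measurable_hlMax (h : RN N → ℝ≥0∞) : Measurable (hlMax h) :=
  (lowerSemicontinuous_hlMax h).measurable

theorem lintegral_ball_le_hlMax (h : RN N → ℝ≥0∞) (x : RN N) {s : ℝ} (hs : 0 < s) :
    ∫⁻ y in ball x s, h y ≤ volume (ball (0 : RN N) s) * hlMax h x := by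
  have h0 : volume (ball (0 : RN N) s) ≠ 0 := (measure_ball_pos _ _ hs).ne'
  have h1 : volume (ball (0 : RN N) s) ≠ ⊤ := measure_ball_lt_top.ne
  rw [mul_comm, ← ENNReal.div_le_iff h0 h1]
  exact le_iSup₂ (f := fun s (_ : s ∈ Ioi (0 : ℝ)) =>
    (∫⁻ y in ball x s, h y) / volume (ball (0 : RN N) s)) s hs

theorem hlMax_le_const {h : RN N → ℝ≥0∞} {c : ℝ≥0∞} (hc : ∀ x, h x ≤ c) (x : RN N) :
    hlMax h x ≤ c := by
  refine iSup₂_le fun s hs => ?_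
  have hs' : (0 : ℝ) < s := hs
  refine ENNReal.div_le_of_le_mul ?_
  calc _ ≤ ∫⁻ y in ball x s, c := lintegral_mono fun y => hc y
    _ = _ := by rw [setLIntegral_const, Measure.addHaar_ball_center]

theorem hlMax_add_le_const {g h : RN N → ℝ≥0∞} (hg : Measurable g) {c : ℝ≥0∞}
    (hc : ∀ x, h x ≤ g x + c) (x : RN N) : hlMax h x ≤ hlMax g x + c := by
  refine iSup₂_le fun s hs => ?_
  have hs' : (0 : ℝ) < s := hs
  refine ENNReal.div_le_of_le_mul ?_
  calc _ ≤ ∫⁻ y in ball x s, (g y + c) := lintegral_mono fun y => hc y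
    _ = (∫⁻ y in ball x s, g y) + c * volume (ball (0 : RN N) s) := by
      rw [lintegral_add_left hg, setLIntegral_const, Measure.addHaar_ball_center]
    _ ≤ _ := by
      rw [add_mul]
      gcongr
      rw [mul_comm]
      exact lintegral_ball_le_hlMax g x hs'

theorem hlMax_weak_type (hN0 : N ≠ 0) (h : RN N → ℝ≥0∞) {t : ℝ} (ht : 0 < t) :
    volume {x | ENNReal.ofReal t < hlMax h x} ≤
      ENNReal.ofReal (5 ^ N) * ENNReal.ofReal t⁻¹ * ∫⁻ x, h x := by
  rcases eq_or_ne (∫⁻ x, h x) ⊤ with htop | htop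
  · rw [htop, ENNReal.mul_top]
    · exact le_top
    · simp [ht]
  set E := {x | ENNReal.ofReal t < hlMax h x} with hE
  have hsel : ∀ x : E, ∃ s : ℝ, 0 < s ∧
      ENNReal.ofReal t * volume (ball (0 : RN N) s) < ∫⁻ y in ball (x : RN N) s, h y := by
    rintro ⟨x, hx⟩
    simp only [hE, mem_ofPred_eq, hlMax, lt_iSup_iff] at hx
    obtain ⟨s, hs, hx⟩ := hx
    have hs' : (0 : ℝ) < s := hs
    have h0 : volume (ball (0 : RN N) s) ≠ 0 := (measure_ball_pos _ _ hs').ne'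
    have h1 : volume (ball (0 : RN N) s) ≠ ⊤ := measure_ball_lt_top.ne
    rw [ENNReal.lt_div_iff_mul_lt (Or.inl h0) (Or.inl h1)] at hx
    exact ⟨s, hs', hx⟩
  choose r hr0 hr using hsel
  have hvol : ∀ (x : RN N) (s : ℝ), 0 < s → volume (closedBall x s) =
      ENNReal.ofReal (s ^ N) * volume (ball (0 : RN N) 1) := fun x s hs => by
    rw [Measure.addHaar_closedBall _ _ hs.le, finrank_euclideanSpace_fin]
  have hvolb : ∀ (x : RN N) (s : ℝ), 0 < s → volume (ball x s) =
      ENNReal.ofReal (s ^ N) * volume (ball (0 : RN N) 1) := fun x s hs => by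
    rw [Measure.addHaar_ball_of_pos _ _ hs, finrank_euclideanSpace_fin]
  set V := volume (ball (0 : RN N) 1) with hV
  have hV0 : V ≠ 0 := (measure_ball_pos _ _ one_pos).ne'
  have hV1 : V ≠ ⊤ := measure_ball_lt_top.ne
  obtain ⟨R, hR⟩ : ∃ R : ℝ, ∀ x, r x ≤ R := by
    refine ⟨max 1 ((∫⁻ x, h x).toReal / (t * V.toReal)), fun x => ?_⟩
    rcases le_total (r x) 1 with h1 | h1
    · exact h1.trans (le_max_left _ _)
    refine le_trans ?_ (le_max_right _ _)
    have h2 : ENNReal.ofReal t * (ENNReal.ofReal (r x ^ N) * V) ≤ ∫⁻ x, h x := by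
      rw [← hvolb 0 _ (hr0 x)]
      exact (hr x).le.trans (setLIntegral_le_lintegral _ _)
    have h3 := ENNReal.toReal_mono htop h2
    rw [ENNReal.toReal_mul, ENNReal.toReal_mul, ENNReal.toReal_ofReal ht.le,
      ENNReal.toReal_ofReal (by have := hr0 x; positivity)] at h3
    have hVp : 0 < V.toReal := ENNReal.toReal_pos hV0 hV1
    rw [le_div_iff₀ (by positivity)]
    calc r x * (t * V.toReal) ≤ r x ^ N * (t * V.toReal) := by
          gcongr
          exact le_self_pow₀ h1 hN0
      _ ≤ _ := by linarith
  obtain ⟨u, -, hdisj, hcov⟩ := Vitali.exists_disjoint_subfamily_covering_enlargement_closedBall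
    (univ : Set E) (fun x => (x : RN N)) r R (fun a _ => hR a) 5 (by norm_num)
  have hcount : u.Countable := by
    refine hdisj.countable_of_nonempty_interior fun a _ => ?_
    exact ⟨a, ball_subset_interior_closedBall (mem_ball_self (hr0 a))⟩
  calc volume E ≤ volume (⋃ b ∈ u, closedBall (b : RN N) (5 * r b)) := by
        refine measure_mono fun x hx => ?_
        obtain ⟨b, hb, hsub⟩ := hcov ⟨x, hx⟩ (mem_univ _)
        exact mem_biUnion hb (hsub (mem_closedBall_self (hr0 _).le))
    _ ≤ ∑' b : u, volume (closedBall ((b : E) : RN N) (5 * r b)) := measure_biUnion_le _ hcount _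
    _ ≤ ∑' b : u, ENNReal.ofReal (5 ^ N) * ENNReal.ofReal t⁻¹ *
          ∫⁻ y in ball ((b : E) : RN N) (r b), h y := by
        refine ENNReal.tsum_le_tsum fun b => ?_
        rw [hvol _ _ (by have := hr0 b; positivity), mul_pow, ENNReal.ofReal_mul (by positivity),
          mul_assoc, mul_assoc, ← hvolb 0 _ (hr0 _)]
        gcongr
        calc volume (ball (0 : RN N) (r b)) = ENNReal.ofReal t⁻¹ *
              (ENNReal.ofReal t * volume (ball (0 : RN N) (r b))) := by
              rw [← mul_assoc, ← ENNReal.ofReal_mul (by positivity), inv_mul_cancel₀ ht.ne']; simp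
          _ ≤ _ := by gcongr; exact (hr b).le
    _ = ENNReal.ofReal (5 ^ N) * ENNReal.ofReal t⁻¹ *
          ∫⁻ y in ⋃ b ∈ u, ball ((b : E) : RN N) (r b), h y := by
        rw [ENNReal.tsum_mul_left, lintegral_biUnion hcount (fun _ _ => measurableSet_ball)]
        exact fun a ha b hb hab => (hdisj ha hb hab).mono ball_subset_closedBall
          ball_subset_closedBall
    _ ≤ _ := by gcongr; exact Measure.restrict_le_self

theorem hlMax_strong_type (hN0 : N ≠ 0) (q : ℝ) (hq : 1 < q) : ∃ C : ℝ≥0∞, C ≠ ⊤ ∧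
    ∀ h : RN N → ℝ≥0∞, Measurable h → (∃ c : ℝ≥0∞, c ≠ ⊤ ∧ ∀ x, h x ≤ c) →
      ∫⁻ x, hlMax h x ^ q ≤ C * ∫⁻ x, h x ^ q := by
  refine ⟨2 ^ q * (ENNReal.ofReal q * ENNReal.ofReal (5 ^ N) * ENNReal.ofReal (q - 1)⁻¹), ?_, ?_⟩
  · have : (2 : ℝ≥0∞) ^ q ≠ ⊤ := ENNReal.rpow_ne_top_of_nonneg (by linarith) (by simp)
    finiteness
  rintro h hh ⟨c, hc, hhc⟩
  have hfin : ∀ x, h x ≠ ⊤ := fun x => ne_top_of_le_ne_top hc (hhc x)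
  have hMfin : ∀ x, hlMax h x ≠ ⊤ := fun x => ne_top_of_le_ne_top hc (hlMax_le_const hhc x)
  have key := lintegral_rpow_le_of_weak_type volume (F := fun x => hlMax h x / 2) (h := h)
    ((measurable_hlMax h).div_const 2) (fun x => ENNReal.div_ne_top (hMfin x) (by simp)) hh hfin hq
    (ENNReal.ofReal (5 ^ N)) ?_
  · calc ∫⁻ x, hlMax h x ^ q = ∫⁻ x, 2 ^ q * (hlMax h x / 2) ^ q := by
          refine lintegral_congr fun x => ?_
          rw [← ENNReal.mul_rpow_of_nonneg _ _ (by linarith : 0 ≤ q),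
            ENNReal.mul_div_cancel (by simp) (by simp)]
      _ = 2 ^ q * ∫⁻ x, (hlMax h x / 2) ^ q := by
          rw [lintegral_const_mul]
          have := measurable_hlMax h
          fun_prop
      _ ≤ _ := by rw [mul_assoc]; gcongr
  intro t ht
  refine le_trans (measure_mono ?_) (hlMax_weak_type hN0 _ ht)
  intro x hx
  simp only [mem_ofPred_eq] at hx ⊢
  have h2 : hlMax h x ≤ hlMax (fun y => if ENNReal.ofReal t < h y then h y else 0) x +
      ENNReal.ofReal t := by
    refine hlMax_add_le_const ?_ (fun y => ?_) x
    · exact Measurable.ite (measurableSet_lt measurable_const hh) hh measurable_const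
    · split_ifs with hy
      · exact le_self_add
      · simpa using hy
  rw [ENNReal.lt_div_iff_mul_lt (by simp) (by simp), mul_two] at hx
  exact lt_of_add_lt_add_right (hx.trans_le h2)
/-! ### Derivative bounds at a given scale -/

/-- All derivatives of `f` at `x` up to order `n` are bounded by `H` at scale `s`. -/
def JB {E : Type*} [NormedAddCommGroup E] [NormedSpace ℝ E] (n : ℕ) (s H : ℝ) (f : RN N → E)
    (x : RN N) : Prop :=
  ∀ i ≤ n, ‖iteratedFDeriv ℝ i f x‖ * s ^ i ≤ H

namespace JB

section
variable {E : Type*} [NormedAddCommGroup E] [NormedSpace ℝ E] {n : ℕ} {s H K : ℝ}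
  {f g : RN N → E} {x : RN N}

theorem nonneg (hf : JB n s H f x) : 0 ≤ H :=
  le_trans (by positivity) (hf 0 (Nat.zero_le _))

theorem norm_le (hf : JB n s H f x) : ‖f x‖ ≤ H := by
  simpa using hf 0 (Nat.zero_le _)

theorem mono (hf : JB n s H f x) (h : H ≤ K) : JB n s K f x := fun i hi => (hf i hi).trans h

theorem mono_scale {r : ℝ} (hr : 0 ≤ r) (hrs : r ≤ s) (hf : JB n s H f x) : JB n r H f x :=
  fun i hi => le_trans (by gcongr) (hf i hi)

theorem of_eventually_zero (hH : 0 ≤ H) (h : f =ᶠ[𝓝 x] fun _ => 0) : JB n s H f x := fun i _ => by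
  rw [(h.iteratedFDeriv ℝ i).eq_of_nhds, iteratedFDeriv_fun_zero]
  simpa using hH

theorem of_notMem_tsupport (hH : 0 ≤ H) (h : x ∉ tsupport f) : JB n s H f x :=
  of_eventually_zero hH (notMem_tsupport_iff_eventuallyEq.1 h)

theorem add (hs : 0 ≤ s) (hcf : ContDiffAt ℝ n f x) (hcg : ContDiffAt ℝ n g x)
    (hf : JB n s H f x) (hg : JB n s K g x) : JB n s (H + K) (fun y => f y + g y) x := fun i hi => by
  have hi' : (i : WithTop ℕ∞) ≤ n := by exact_mod_cast hi
  have : iteratedFDeriv ℝ i (fun y => f y + g y) x = iteratedFDeriv ℝ i f x +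
    iteratedFDeriv ℝ i g x := iteratedFDeriv_add_apply (hcf.of_le hi') (hcg.of_le hi')
  rw [this]
  calc _ ≤ (‖iteratedFDeriv ℝ i f x‖ + ‖iteratedFDeriv ℝ i g x‖) * s ^ i := by
        gcongr; exact norm_add_le _ _
    _ ≤ _ := by rw [add_mul]; exact add_le_add (hf i hi) (hg i hi)

theorem neg (hf : JB n s H f x) : JB n s H (fun y => -f y) x := fun i hi => by
  have : iteratedFDeriv ℝ i (fun y => -f y) x = -iteratedFDeriv ℝ i f x :=
    iteratedFDeriv_neg_apply
  rw [this, norm_neg]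
  exact hf i hi

theorem sub (hs : 0 ≤ s) (hcf : ContDiffAt ℝ n f x) (hcg : ContDiffAt ℝ n g x)
    (hf : JB n s H f x) (hg : JB n s K g x) : JB n s (H + K) (fun y => f y - g y) x := by
  simpa only [sub_eq_add_neg] using add hs hcf hcg.neg hf hg.neg

theorem sub_const {c : E} (hcf : ContDiffAt ℝ n f x) (h0 : ‖f x - c‖ ≤ H)
    (hf : ∀ i ≤ n, i ≠ 0 → ‖iteratedFDeriv ℝ i f x‖ * s ^ i ≤ H) :
    JB n s H (fun y => f y - c) x := fun i hi => by
  rcases eq_or_ne i 0 with rfl | h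
  · simpa using h0
  have hi' : (i : WithTop ℕ∞) ≤ n := by exact_mod_cast hi
  have : iteratedFDeriv ℝ i (fun y => f y - c) x = iteratedFDeriv ℝ i f x -
      iteratedFDeriv ℝ i (fun _ => c) x :=
    iteratedFDeriv_sub_apply (hcf.of_le hi') contDiffAt_const
  rw [this, iteratedFDeriv_const_of_ne h]
  simpa using hf i hi h

theorem comp_add (a : RN N) (hf : JB n s H f (x + a)) : JB n s H (fun y => f (y + a)) x :=
  fun i hi => by
    rw [iteratedFDeriv_comp_add_right]
    exact hf i hi

theorem comp_sub (a : RN N) (hf : JB n s H f (x - a)) : JB n s H (fun y => f (y - a)) x := by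
  simpa only [sub_eq_add_neg] using comp_add (-a) (by simpa only [sub_eq_add_neg] using hf)

theorem comp_neg (hf : JB n s H f (-x)) : JB n s H (fun y => f (-y)) x := fun i hi => by
  have := LinearIsometryEquiv.norm_iteratedFDeriv_comp_right (𝕜 := ℝ)
    (LinearIsometryEquiv.neg ℝ (E := RN N)) f x i
  have e : (f ∘ (LinearIsometryEquiv.neg ℝ (E := RN N))) = fun y => f (-y) := by
    ext y; simp
  rw [e] at this
  rw [this]
  simpa using hf i hi

theorem comp_const_sub (a : RN N) (hf : JB n s H f (a - x)) : JB n s H (fun y => f (a - y)) x := by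
  have : JB n s H (fun y => f (y + a)) (-x) := comp_add a (by rwa [neg_add_eq_sub])
  simpa only [neg_add_eq_sub] using this.comp_neg

theorem comp_smul {r : ℝ} (hr : 0 < r) (hcf : ContDiff ℝ n f) (hf : JB n s H f (r⁻¹ • x)) :
    JB n (s * r) H (fun y => f (r⁻¹ • y)) x := fun i hi => by
  have hi' : (i : WithTop ℕ∞) ≤ n := by exact_mod_cast hi
  rw [iteratedFDeriv_comp_const_smul r⁻¹ (hcf.of_le hi')]
  simp only [norm_smul, norm_pow, norm_inv, Real.norm_of_nonneg hr.le]
  calc _ = ‖iteratedFDeriv ℝ i f (r⁻¹ • x)‖ * s ^ i * (r⁻¹ * r) ^ i := by ring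
    _ = ‖iteratedFDeriv ℝ i f (r⁻¹ • x)‖ * s ^ i := by rw [inv_mul_cancel₀ hr.ne']; simp
    _ ≤ _ := hf i hi

end

variable {n : ℕ} {s H K : ℝ} {f g : RN N → ℂ} {x : RN N}

theorem mul (hs : 0 ≤ s) (hcf : ContDiffAt ℝ n f x) (hcg : ContDiffAt ℝ n g x)
    (hf : JB n s H f x) (hg : JB n s K g x) :
    JB n s (2 ^ n * (H * K)) (fun y => f y * g y) x := fun i hi => by
  have hi' : (i : WithTop ℕ∞) ≤ n := by exact_mod_cast hi
  obtain ⟨u, hu, hfu⟩ := (hcf.of_le hi').contDiffOn le_rfl (by simp)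
  obtain ⟨v, hv, hgv⟩ := (hcg.of_le hi').contDiffOn le_rfl (by simp)
  obtain ⟨w, hwuv, hwo, hxw⟩ := _root_.mem_nhds_iff.1 (inter_mem hu hv)
  have hfw := hfu.mono (hwuv.trans inter_subset_left)
  have hgw := hgv.mono (hwuv.trans inter_subset_right)
  have key := norm_iteratedFDerivWithin_mul_le hfw hgw hwo.uniqueDiffOn hxw le_rfl
  simp only [iteratedFDerivWithin_of_isOpen _ hwo hxw] at key
  have hH := hf.nonneg
  have hK := hg.nonneg
  calc _ ≤ (∑ k ∈ Finset.range (i + 1), (i.choose k : ℝ) * ‖iteratedFDeriv ℝ k f x‖ *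
        ‖iteratedFDeriv ℝ (i - k) g x‖) * s ^ i := by gcongr
    _ = ∑ k ∈ Finset.range (i + 1), (i.choose k : ℝ) * ((‖iteratedFDeriv ℝ k f x‖ * s ^ k) *
        (‖iteratedFDeriv ℝ (i - k) g x‖ * s ^ (i - k))) := by
      rw [Finset.sum_mul]
      refine Finset.sum_congr rfl fun k hk => ?_
      have : k ≤ i := Nat.lt_succ_iff.1 (Finset.mem_range.1 hk)
      rw [show s ^ i = s ^ k * s ^ (i - k) by rw [← pow_add, Nat.add_sub_cancel' this]]
      ring
    _ ≤ ∑ k ∈ Finset.range (i + 1), (i.choose k : ℝ) * (H * K) := by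
      gcongr with k hk
      · exact hf k ((Nat.lt_succ_iff.1 (Finset.mem_range.1 hk)).trans hi)
      · exact hg (i - k) ((Nat.sub_le _ _).trans hi)
    _ = 2 ^ i * (H * K) := by
      rw [← Finset.sum_mul, ← Nat.cast_sum, Nat.sum_range_choose]; simp
    _ ≤ _ := by gcongr; norm_num

end JB

theorem exists_JB_of_hasCompactSupport {E : Type*} [NormedAddCommGroup E] [NormedSpace ℝ E]
    {η : RN N → E} (hη : ContDiff ℝ (⊤ : ℕ∞) η) (hc : HasCompactSupport η) (n : ℕ) :
    ∃ c, 0 < c ∧ ∀ x, JB n 1 c η x := by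
  have hb : ∀ i : ℕ, ∃ c, ∀ x, ‖iteratedFDeriv ℝ i η x‖ ≤ c := fun i => by
    have h1 : Continuous (iteratedFDeriv ℝ i η) := hη.continuous_iteratedFDeriv (by exact_mod_cast le_top)
    exact h1.bounded_above_of_compact_support (hc.iteratedFDeriv i)
  choose c hc using hb
  refine ⟨1 + ∑ i ∈ Finset.range (n + 1), |c i|, by positivity, fun x i hi => ?_⟩
  have := Finset.single_le_sum (f := fun i => |c i|) (fun i _ => abs_nonneg _)
    (Finset.mem_range.2 (Nat.lt_succ_of_le hi))
  have h2 := hc i x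
  have h3 := le_abs_self (c i)
  simp only [one_pow, mul_one]
  linarith

/-! ### Dilates of the fixed bump -/

/-- The dilate `φ_t` as a complex-valued function. -/
def dilC (φ : RN N → ℝ) (t : ℝ) (z : RN N) : ℂ := (dil φ t z : ℂ)

theorem GoodPhi.contDiff_dil {φ : RN N → ℝ} (hφ : GoodPhi φ) (t : ℝ) :
    ContDiff ℝ (⊤ : ℕ∞) (dil φ t) :=
  (hφ.smooth.comp (contDiff_const_smul _)).div_const _

theorem GoodPhi.contDiff_dilC {φ : RN N → ℝ} (hφ : GoodPhi φ) (t : ℝ) :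
    ContDiff ℝ (⊤ : ℕ∞) (dilC φ t) :=
  Complex.ofRealCLM.contDiff.comp (hφ.contDiff_dil t)

theorem GoodPhi.dil_neg {φ : RN N → ℝ} (hφ : GoodPhi φ) (t : ℝ) (z : RN N) :
    dil φ t (-z) = dil φ t z := by
  unfold dil
  rw [hφ.radial (t⁻¹ • -z) (t⁻¹ • z) (by simp)]

theorem GoodPhi.dil_sub_comm {φ : RN N → ℝ} (hφ : GoodPhi φ) (t : ℝ) (y z : RN N) :
    dil φ t (y - z) = dil φ t (z - y) := by
  rw [← hφ.dil_neg, neg_sub]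

theorem GoodPhi.dil_nonneg {φ : RN N → ℝ} (hφ : GoodPhi φ) {t : ℝ} (ht : 0 < t) (z : RN N) :
    0 ≤ dil φ t z := div_nonneg (hφ.nonneg _) (by positivity)

theorem GoodPhi.tsupport_dil {φ : RN N → ℝ} (hφ : GoodPhi φ) {t : ℝ} (ht : 0 < t) :
    tsupport (dil φ t) ⊆ closedBall 0 t := by
  refine closure_minimal (fun z hz => ?_) isClosed_closedBall
  have : t⁻¹ • z ∈ closedBall (0 : RN N) 1 := by
    refine hφ.supp (subset_tsupport _ fun h => hz ?_)
    simp [dil, h]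
  rw [mem_closedBall_zero_iff, norm_smul, norm_inv, Real.norm_of_nonneg ht.le] at this
  rw [mem_closedBall_zero_iff]
  rwa [inv_mul_le_iff₀ ht, mul_one] at this

theorem GoodPhi.dil_eq_zero {φ : RN N → ℝ} (hφ : GoodPhi φ) {t : ℝ} (ht : 0 < t) {z : RN N}
    (hz : t < ‖z‖) : dil φ t z = 0 := by
  by_contra h
  have := hφ.tsupport_dil ht (subset_tsupport _ h)
  rw [mem_closedBall_zero_iff] at this
  linarith

theorem GoodPhi.hasCompactSupport_dil {φ : RN N → ℝ} (hφ : GoodPhi φ) {t : ℝ} (ht : 0 < t) :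
    HasCompactSupport (dil φ t) :=
  (isCompact_closedBall 0 t).of_isClosed_subset (isClosed_tsupport _) (hφ.tsupport_dil ht)

theorem GoodPhi.tsupport_dilC {φ : RN N → ℝ} (hφ : GoodPhi φ) {t : ℝ} (ht : 0 < t) :
    tsupport (dilC φ t) ⊆ closedBall 0 t := by
  refine closure_minimal (fun z hz => ?_) isClosed_closedBall
  refine hφ.tsupport_dil ht (subset_tsupport _ fun h => hz ?_)
  simp [dilC, h]

theorem GoodPhi.hasCompactSupport_dilC {φ : RN N → ℝ} (hφ : GoodPhi φ) {t : ℝ} (ht : 0 < t) :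
    HasCompactSupport (dilC φ t) :=
  (isCompact_closedBall 0 t).of_isClosed_subset (isClosed_tsupport _) (hφ.tsupport_dilC ht)

theorem GoodPhi.integral_dil {φ : RN N → ℝ} (hφ : GoodPhi φ) {t : ℝ} (ht : 0 < t) :
    ∫ z, dil φ t z = 1 := by
  unfold dil
  rw [integral_div, Measure.integral_comp_inv_smul, hφ.int_one, finrank_euclideanSpace_fin,
    abs_of_pos (by positivity)]
  simp [ht.ne']

theorem GoodPhi.exists_JB_dil {φ : RN N → ℝ} (hφ : GoodPhi φ) (n : ℕ) :
    ∃ c, 0 < c ∧ ∀ t, 0 < t → ∀ x, JB n t (c * (t ^ N)⁻¹) (dilC φ t) x := by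
  obtain ⟨c, hc0, hc⟩ := exists_JB_of_hasCompactSupport (hφ.contDiff_dilC 1)
    (hφ.hasCompactSupport_dilC one_pos) n
  refine ⟨c, hc0, fun t ht x i hi => ?_⟩
  have h1 := (hc (t⁻¹ • x)).comp_smul ht ((hφ.contDiff_dilC 1).of_le (by exact_mod_cast le_top)) i hi
  have h2 : dilC φ t = fun y => ((t ^ N)⁻¹ : ℝ) • dilC φ 1 (t⁻¹ • y) := by
    ext y
    simp only [dilC, dil]
    push_cast
    simp [div_eq_inv_mul]
  have hcd : ContDiff ℝ i fun y => dilC φ 1 (t⁻¹ • y) :=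
    ((hφ.contDiff_dilC 1).comp (contDiff_const_smul _)).of_le (by exact_mod_cast le_top)
  rw [h2, show (fun y => ((t ^ N)⁻¹ : ℝ) • dilC φ 1 (t⁻¹ • y)) =
    ((t ^ N)⁻¹ : ℝ) • fun y => dilC φ 1 (t⁻¹ • y) from rfl,
    iteratedFDeriv_const_smul_apply hcd.contDiffAt, norm_smul, Real.norm_of_nonneg (by positivity)]
  rw [one_mul] at h1
  calc _ = (t ^ N)⁻¹ * (‖iteratedFDeriv ℝ i (fun y => dilC φ 1 (t⁻¹ • y)) x‖ * t ^ i) := by ring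
    _ ≤ (t ^ N)⁻¹ * c := by gcongr
    _ = _ := mul_comm _ _

/-! ### Derivatives of mollified indicators -/

theorem hasFDerivAt_setIntegral_comp_sub {E : Type} [NormedAddCommGroup E] [NormedSpace ℝ E]
    [CompleteSpace E] {η : RN N → E} (hη : ContDiff ℝ (⊤ : ℕ∞) η) (hc : HasCompactSupport η)
    {U : Set (RN N)} (hU : MeasurableSet U) (x : RN N) :
    HasFDerivAt (fun x => ∫ z in U, η (x - z)) (∫ z in U, fderiv ℝ η (x - z)) x := by
  have h := HasCompactSupport.hasFDerivAt_convolution_right (μ := volume)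
    (ContinuousLinearMap.lsmul ℝ ℝ (E := E)) hc
    (f := U.indicator fun _ => (1 : ℝ)) (locallyIntegrable_const (1 : ℝ) |>.indicator hU)
    (hη.of_le (by exact_mod_cast le_top)) x
  have e1 : (MeasureTheory.convolution (U.indicator fun _ => (1 : ℝ)) η
      (ContinuousLinearMap.lsmul ℝ ℝ (E := E)) volume) = fun x => ∫ z in U, η (x - z) := by
    ext y
    simp only [MeasureTheory.convolution, ContinuousLinearMap.lsmul_apply]
    rw [← integral_indicator hU]
    congr 1 with z
    by_cases hz : z ∈ U <;> simp [hz]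
  have e2 : (MeasureTheory.convolution (U.indicator fun _ => (1 : ℝ)) (fderiv ℝ η)
      ((ContinuousLinearMap.lsmul ℝ ℝ (E := E)).precompR (RN N)) volume) x =
      ∫ z in U, fderiv ℝ η (x - z) := by
    simp only [MeasureTheory.convolution]
    rw [← integral_indicator hU]
    congr 1 with z
    by_cases hz : z ∈ U
    · simp [hz, ContinuousLinearMap.precompR_apply]
    · simp [hz]
  rw [e1, e2] at h
  exact h

theorem norm_iteratedFDeriv_setIntegral_comp_sub_le {U : Set (RN N)} (hU : MeasurableSet U) (j : ℕ) :
    ∀ {E : Type} [NormedAddCommGroup E] [NormedSpace ℝ E] [CompleteSpace E] {η : RN N → E}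
      (_ : ContDiff ℝ (⊤ : ℕ∞) η) (_ : HasCompactSupport η) (x : RN N),
      ‖iteratedFDeriv ℝ j (fun x => ∫ z in U, η (x - z)) x‖ ≤ ∫ z, ‖iteratedFDeriv ℝ j η z‖ := by
  induction j with
  | zero =>
    intro E _ _ _ η hη hc x
    simp only [norm_iteratedFDeriv_zero]
    have hi : Integrable fun z => ‖η z‖ := (hη.continuous.integrable_of_hasCompactSupport hc).norm
    calc _ ≤ ∫ z in U, ‖η (x - z)‖ := norm_integral_le_integral_norm _
      _ ≤ ∫ z, ‖η (x - z)‖ := setIntegral_le_integral (hi.comp_sub_left x)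
          (Eventually.of_forall fun z => norm_nonneg _)
      _ = _ := integral_sub_left_eq_self (fun z => ‖η z‖) volume x
  | succ j ih =>
    intro E _ _ _ η hη hc x
    have hd : fderiv ℝ (fun x => ∫ z in U, η (x - z)) = fun x => ∫ z in U, fderiv ℝ η (x - z) := by
      ext1 x
      exact (hasFDerivAt_setIntegral_comp_sub hη hc hU x).fderiv
    rw [← norm_iteratedFDeriv_fderiv, hd]
    refine (ih (hη.fderiv_right (by simp)) (hc.fderiv ℝ) x).trans (le_of_eq ?_)
    simp only [norm_iteratedFDeriv_fderiv]

theorem contDiff_setIntegral_comp_sub {E : Type} [NormedAddCommGroup E] [NormedSpace ℝ E]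
    [CompleteSpace E] {η : RN N → E} (hη : ContDiff ℝ (⊤ : ℕ∞) η) (hc : HasCompactSupport η)
    {U : Set (RN N)} (hU : MeasurableSet U) :
    ContDiff ℝ (⊤ : ℕ∞) (fun x => ∫ z in U, η (x - z)) := by
  have h := HasCompactSupport.contDiff_convolution_right (μ := volume) (n := ⊤)
    (ContinuousLinearMap.lsmul ℝ ℝ (E := E)) hc
    (f := U.indicator fun _ => (1 : ℝ)) (locallyIntegrable_const (1 : ℝ) |>.indicator hU) hη
  have e1 : (MeasureTheory.convolution (U.indicator fun _ => (1 : ℝ)) η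
      (ContinuousLinearMap.lsmul ℝ ℝ (E := E)) volume) = fun x => ∫ z in U, η (x - z) := by
    ext y
    simp only [MeasureTheory.convolution, ContinuousLinearMap.lsmul_apply]
    rw [← integral_indicator hU]
    congr 1 with z
    by_cases hz : z ∈ U <;> simp [hz]
  rwa [e1] at h

/-- The mollification of an indicator function has derivatives of order one at scale `t`. -/
theorem GoodPhi.exists_JB_setIntegral {φ : RN N → ℝ} (hφ : GoodPhi φ) (n : ℕ) :
    ∃ c, 0 < c ∧ ∀ t, 0 < t → ∀ U : Set (RN N), MeasurableSet U → ∀ x,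
      JB n t c (fun x => ∫ z in U, dilC φ t (x - z)) x := by
  obtain ⟨c, hc0, hc⟩ := hφ.exists_JB_dil n
  refine ⟨c * (volume (ball (0 : RN N) 1)).toReal + 1, by positivity, fun t ht U hU x i hi => ?_⟩
  have h1 := norm_iteratedFDeriv_setIntegral_comp_sub_le hU i (hφ.contDiff_dilC t)
    (hφ.hasCompactSupport_dilC ht) x
  have h2 : ∫ z, ‖iteratedFDeriv ℝ i (dilC φ t) z‖ ≤
      ∫ z, (closedBall (0 : RN N) t).indicator (fun _ => c * (t ^ N)⁻¹ / t ^ i) z := by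
    refine integral_mono_of_nonneg (Eventually.of_forall fun z => norm_nonneg _) ?_
      (Eventually.of_forall fun z => ?_)
    · exact (integrable_indicator_iff measurableSet_closedBall).2
        (integrableOn_const (measure_closedBall_lt_top.ne))
    · by_cases hz : z ∈ closedBall (0 : RN N) t
      · simp only [hz, indicator_of_mem]
        rw [le_div_iff₀ (by positivity)]
        exact hc t ht z i hi
      · simp only [hz, not_false_eq_true, indicator_of_notMem]
        have : z ∉ tsupport (dilC φ t) := fun h => hz (hφ.tsupport_dilC ht h)
        have := (JB.of_notMem_tsupport (n := i) (s := 1) le_rfl this) i le_rfl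
        simpa using this
  rw [integral_indicator measurableSet_closedBall, setIntegral_const, smul_eq_mul, Measure.real,
    Measure.addHaar_closedBall _ _ ht.le, finrank_euclideanSpace_fin, ENNReal.toReal_mul,
    ENNReal.toReal_ofReal (by positivity)] at h2
  calc _ ≤ (t ^ N * (volume (ball (0 : RN N) 1)).toReal * (c * (t ^ N)⁻¹ / t ^ i)) * t ^ i := by
        gcongr; exact h1.trans h2
    _ = c * (volume (ball (0 : RN N) 1)).toReal := by field_simp
    _ ≤ _ := by linarith
/-! ### Iterated difference bounds -/

/-- `v` has `j`-th order differences with increments `h₁, …, h_j` bounded by `β ∏ ‖hᵢ‖`. -/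
def diffBound : ℕ → (RN N → ℂ) → ℝ → Prop
  | 0, v, β => ∀ x, ‖v x‖ ≤ β
  | j + 1, v, β => ∀ h, diffBound j (fun x => v (x + h) - v x) (‖h‖ * β)

namespace diffBound

theorem mono {j : ℕ} {v : RN N → ℂ} {β γ : ℝ} (hv : diffBound j v β) (h : β ≤ γ) :
    diffBound j v γ := by
  induction j generalizing v β γ with
  | zero => exact fun x => (hv x).trans h
  | succ j ih => exact fun k => ih (hv k) (by gcongr)

theorem neg {j : ℕ} {v : RN N → ℂ} {β : ℝ} (hv : diffBound j v β) :
    diffBound j (fun x => -v x) β := by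
  induction j generalizing v β with
  | zero => exact fun x => by simpa using hv x
  | succ j ih => exact fun k => by simpa [neg_add_eq_sub, sub_eq_add_neg] using ih (hv k)

theorem comp_sub {j : ℕ} {v : RN N → ℂ} {β : ℝ} (hv : diffBound j v β) (y : RN N) :
    diffBound j (fun x => v (x - y)) β := by
  induction j generalizing v β with
  | zero => exact fun x => hv (x - y)
  | succ j ih =>
    intro k
    have := ih (hv k)
    simpa only [sub_add_eq_add_sub] using this

theorem sub {j : ℕ} {v w : RN N → ℂ} {β γ : ℝ} (hv : diffBound j v β) (hw : diffBound j w γ) :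
    diffBound j (fun x => v x - w x) (β + γ) := by
  induction j generalizing v w β γ with
  | zero => exact fun x => (norm_sub_le _ _).trans (add_le_add (hv x) (hw x))
  | succ j ih =>
    intro k
    have := ih (hv k) (hw k)
    rw [mul_add]
    simpa only [sub_sub_sub_comm] using this

theorem sub_comp_sub {j : ℕ} {v : RN N → ℂ} {β : ℝ} (hv : diffBound (j + 1) v β) (y : RN N) :
    diffBound j (fun x => v x - v (x - y)) (‖y‖ * β) := by
  have := (hv (-y)).neg
  simpa only [neg_sub, norm_neg, ← sub_eq_add_neg] using this

theorem of_iteratedFDeriv {j : ℕ} {v : RN N → ℂ} {β : ℝ} (hv : ContDiff ℝ (⊤ : ℕ∞) v)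
    (hb : ∀ x, ‖iteratedFDeriv ℝ j v x‖ ≤ β) : diffBound j v β := by
  induction j generalizing v β with
  | zero => exact fun x => by simpa using hb x
  | succ j ih =>
    intro h
    have hvh : ContDiff ℝ (⊤ : ℕ∞) fun x => v (x + h) := hv.comp (contDiff_id.add contDiff_const)
    refine ih (hvh.sub hv) fun x => ?_
    have hj : ((j : ℕ) : WithTop ℕ∞) ≤ ((⊤ : ℕ∞) : WithTop ℕ∞) := by exact_mod_cast le_top
    have e : iteratedFDeriv ℝ j (fun x => v (x + h) - v x) x =
        iteratedFDeriv ℝ j v (x + h) - iteratedFDeriv ℝ j v x := by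
      rw [← iteratedFDeriv_comp_add_right]
      exact iteratedFDeriv_sub_apply (hvh.of_le hj).contDiffAt (hv.of_le hj).contDiffAt
    rw [e]
    have hd : Differentiable ℝ (iteratedFDeriv ℝ j v) :=
      hv.differentiable_iteratedFDeriv (by exact_mod_cast WithTop.coe_lt_top j)
    have := Convex.norm_image_sub_le_of_norm_fderiv_le (𝕜 := ℝ) (f := iteratedFDeriv ℝ j v)
      (C := β) (fun z _ => hd z) (fun z _ => by rw [norm_fderiv_iteratedFDeriv]; exact hb z)
      convex_univ (mem_univ x) (mem_univ (x + h))
    rw [mul_comm]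
    simpa using this

theorem integral {φ : RN N → ℝ} (hφ : GoodPhi φ) {s : ℝ} (hs : 0 < s) {j : ℕ}
    {V : RN N → RN N → ℂ} {β : ℝ} (hV : ∀ x, Continuous fun y => V y x)
    (hb : ∀ y ∈ closedBall (0 : RN N) s, diffBound j (V y) β) :
    diffBound j (fun x => ∫ y, dil φ s y • V y x) β := by
  have hint : ∀ W : RN N → ℂ, Continuous W → Integrable fun y => dil φ s y • W y := fun W hW =>
    ((hφ.contDiff_dil s).continuous.smul hW).integrable_of_hasCompactSupport
      (hφ.hasCompactSupport_dil hs).smul_right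
  induction j generalizing V β with
  | zero =>
    intro x
    calc _ ≤ ∫ y, dil φ s y * β := by
          refine norm_integral_le_of_norm_le
            (((hφ.contDiff_dil s).continuous.integrable_of_hasCompactSupport
              (hφ.hasCompactSupport_dil hs)).mul_const β) (Eventually.of_forall fun y => ?_)
          rw [norm_smul, Real.norm_of_nonneg (hφ.dil_nonneg hs y)]
          rcases le_or_gt ‖y‖ s with h | h
          · exact mul_le_mul_of_nonneg_left (hb y (by simpa using h) x) (hφ.dil_nonneg hs y)
          · simp [hφ.dil_eq_zero hs h]
      _ = β := by rw [integral_mul_const, hφ.integral_dil hs, one_mul]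
  | succ j ih =>
    intro h
    have := ih (V := fun y x => V y (x + h) - V y x) (β := ‖h‖ * β)
      (fun x => (hV (x + h)).sub (hV x)) (fun y hy => hb y hy h)
    simp only [smul_sub] at this
    simpa only [integral_sub (hint _ (hV (_ + h))) (hint _ (hV _))] using this

end diffBound

/-! ### Iterated remainders of the mollification -/

/-- The remainder `r - φ_s * r`. -/
def remStep (φ : RN N → ℝ) (s : ℝ) (r : RN N → ℂ) (x : RN N) : ℂ :=
  ∫ y, dil φ s y • (r x - r (x - y))

/-- Iterated remainders at the scales `t 2^{-k}`. -/
def remSeq (φ : RN N → ℝ) (t : ℝ) (ψ : RN N → ℂ) : ℕ → RN N → ℂ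
  | 0 => ψ
  | k + 1 => remStep φ (t / 2 ^ k) (remSeq φ t ψ k)

section remainder

variable {φ : RN N → ℝ}

theorem GoodPhi.integrable_dil_smul (hφ : GoodPhi φ) {s : ℝ} (hs : 0 < s) {W : RN N → ℂ}
    (hW : Continuous W) : Integrable fun y => dil φ s y • W y :=
  ((hφ.contDiff_dil s).continuous.smul hW).integrable_of_hasCompactSupport
    (hφ.hasCompactSupport_dil hs).smul_right

theorem remStep_eq (hφ : GoodPhi φ) {s : ℝ} (hs : 0 < s) {r : RN N → ℂ} (hr : Continuous r)
    (x : RN N) : remStep φ s r x = r x - ∫ y, dil φ s y • r (x - y) := by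
  unfold remStep
  simp only [smul_sub]
  rw [integral_sub (hφ.integrable_dil_smul hs continuous_const)
    (hφ.integrable_dil_smul hs (W := fun y => r (x - y)) (by fun_prop)),
    integral_smul_const, hφ.integral_dil hs, one_smul]

theorem convAt_eq (φ : RN N → ℝ) (s : ℝ) (r : RN N → ℂ) (x : RN N) :
    convAt φ s r x = ∫ y, dil φ s y • r (x - y) := by
  unfold convAt
  rw [← integral_sub_left_eq_self (fun y => dil φ s y • r (x - y)) volume x]
  simp

theorem continuous_convAt (hφ : GoodPhi φ) {s : ℝ} (hs : 0 < s) {r : RN N → ℂ}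
    (hr : Continuous r) : Continuous (convAt φ s r) := by
  have h := HasCompactSupport.continuous_convolution_left (μ := volume)
    (ContinuousLinearMap.lsmul ℝ ℝ (E := ℂ)) (hφ.hasCompactSupport_dil hs)
    (hφ.contDiff_dil s).continuous hr.locallyIntegrable
  have e : convAt φ s r = MeasureTheory.convolution (dil φ s) r
      (ContinuousLinearMap.lsmul ℝ ℝ (E := ℂ)) volume := by
    ext x
    rw [convAt_eq φ]
    rfl
  rwa [e]

theorem continuous_remStep (hφ : GoodPhi φ) {s : ℝ} (hs : 0 < s) {r : RN N → ℂ}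
    (hr : Continuous r) : Continuous (remStep φ s r) := by
  have : remStep φ s r = fun x => r x - convAt φ s r x := by
    ext x; rw [remStep_eq hφ hs hr, convAt_eq φ]
  rw [this]
  exact hr.sub (continuous_convAt hφ hs hr)

theorem continuous_remSeq (hφ : GoodPhi φ) {t : ℝ} (ht : 0 < t) {ψ : RN N → ℂ}
    (hψ : Continuous ψ) (k : ℕ) : Continuous (remSeq φ t ψ k) := by
  induction k with
  | zero => exact hψ
  | succ k ih => exact continuous_remStep hφ (by positivity) ih

theorem remSeq_eq_zero (hφ : GoodPhi φ) {t : ℝ} (ht : 0 < t) {ψ : RN N → ℂ} {w : RN N} {ρ : ℝ}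
    (hψ : ∀ x, ρ < dist x w → ψ x = 0) (k : ℕ) {x : RN N} (hx : ρ + 2 * t < dist x w) :
    remSeq φ t ψ k x = 0 := by
  have key : ∀ k x, ρ + (2 * t - 2 * t / 2 ^ k) < dist x w → remSeq φ t ψ k x = 0 := by
    intro k
    induction k with
    | zero => intro x hx; exact hψ x (by simpa using hx)
    | succ k ih =>
      intro x hx
      have e : 2 * t / 2 ^ (k + 1) = t / 2 ^ k := by rw [pow_succ]; field_simp
      have e2 : 2 * t / 2 ^ k = t / 2 ^ k + t / 2 ^ k := by ring
      rw [e] at hx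
      have hpos : 0 < t / 2 ^ k := by positivity
      show remStep φ (t / 2 ^ k) (remSeq φ t ψ k) x = 0
      unfold remStep
      rw [integral_eq_zero_of_ae]
      refine Eventually.of_forall fun y => ?_
      rcases le_or_gt ‖y‖ (t / 2 ^ k) with h | h
      · have h1 : dist x w ≤ dist (x - y) w + ‖y‖ := by
          calc dist x w ≤ dist x (x - y) + dist (x - y) w := dist_triangle _ _ _
            _ = _ := by rw [dist_self_sub_right, add_comm]
        simp only [Pi.zero_apply]
        rw [ih x (by linarith), ih (x - y) (by linarith)]
        simp
      · simp [hφ.dil_eq_zero hpos h]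
  refine key k x (lt_of_le_of_lt ?_ hx)
  have : 0 < 2 * t / 2 ^ k := by positivity
  linarith

theorem diffBound.remStep (hφ : GoodPhi φ) {s : ℝ} (hs : 0 < s) {r : RN N → ℂ}
    (hr : Continuous r) {j : ℕ} {β : ℝ} (h : diffBound j r β) :
    diffBound j (remStep φ s r) (2 * β) := by
  refine diffBound.integral hφ hs (fun x => by fun_prop) fun y _ => ?_
  rw [two_mul]
  exact h.sub (h.comp_sub y)

theorem diffBound.remStep_succ (hφ : GoodPhi φ) {s : ℝ} (hs : 0 < s) {r : RN N → ℂ}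
    (hr : Continuous r) {j : ℕ} {β : ℝ} (hβ : 0 ≤ β) (h : diffBound (j + 1) r β) :
    diffBound j (_root_.remStep φ s r) (s * β) := by
  refine diffBound.integral hφ hs (fun x => by fun_prop) fun y hy => ?_
  exact (h.sub_comp_sub y).mono (by gcongr; simpa using hy)

theorem diffBound.remSeq (hφ : GoodPhi φ) {t : ℝ} (ht : 0 < t) {ψ : RN N → ℂ}
    (hψ : Continuous ψ) {j : ℕ} {β : ℝ} (h : diffBound j ψ β) (k : ℕ) :
    diffBound j (remSeq φ t ψ k) (2 ^ k * β) := by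
  induction k with
  | zero => simpa [_root_.remSeq] using h
  | succ k ih =>
    have := ih.remStep hφ (show 0 < t / 2 ^ k by positivity) (continuous_remSeq hφ ht hψ k)
    rw [pow_succ, mul_comm (2 ^ k : ℝ) 2, mul_assoc]
    exact this

theorem diffBound.remSeq_add (hφ : GoodPhi φ) {t : ℝ} (ht : 0 < t) {ψ : RN N → ℂ}
    (hψ : Continuous ψ) {k j i : ℕ} {β : ℝ} (hβ : 0 ≤ β)
    (h : diffBound (j + i) (_root_.remSeq φ t ψ k) β) :
    diffBound j (_root_.remSeq φ t ψ (k + i)) ((t / 2 ^ k) ^ i * β) := by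
  induction i generalizing j with
  | zero => simpa using h
  | succ i ih =>
    have h1 := ih (j := j + 1) (by rwa [add_right_comm])
    have h2 := h1.remStep_succ hφ (show 0 < t / 2 ^ (k + i) by positivity)
      (continuous_remSeq hφ ht hψ _) (by positivity)
    refine h2.mono ?_
    rw [pow_succ', mul_assoc]
    gcongr
    · norm_num
    · omega

theorem norm_remSeq_le (hφ : GoodPhi φ) {t : ℝ} (ht : 0 < t) {ψ : RN N → ℂ} (hψ : Continuous ψ)
    {L : ℕ} (hLpos : 1 ≤ L) {β : ℝ} (hβ : 0 ≤ β) (h0 : diffBound 0 ψ β) (hL : diffBound L ψ (β / t ^ L))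
    (k : ℕ) (x : RN N) :
    ‖remSeq φ t ψ k x‖ ≤ 2 ^ (L * L) * β * ((2 : ℝ)⁻¹ ^ (L - 1)) ^ k := by
  obtain ⟨L, rfl⟩ : ∃ L', L = L' + 1 := ⟨L - 1, by omega⟩
  simp only [Nat.add_sub_cancel]
  rcases le_or_gt (L + 1) k with hk | hk
  · obtain ⟨n, rfl⟩ := Nat.exists_eq_add_of_le' hk
    have h1 := hL.remSeq hφ ht hψ n
    have h2 := diffBound.remSeq_add (j := 0) (i := L + 1) (k := n)
      (β := 2 ^ n * (β / t ^ (L + 1))) hφ ht hψ (by positivity) (by rwa [zero_add]) x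
    have e1 : (t / 2 ^ n) ^ (L + 1) * (2 ^ n * (β / t ^ (L + 1))) = β * 2⁻¹ ^ (n * L) := by
      rw [div_pow, ← pow_mul, inv_pow, mul_add, pow_add, mul_one, pow_add]
      field_simp
    have e2 : (2 : ℝ) ^ ((L + 1) * (L + 1)) * β * (2⁻¹ ^ L) ^ (n + (L + 1)) =
        2 ^ (L + 1) * (β * 2⁻¹ ^ (n * L)) := by
      rw [← pow_mul, show L * (n + (L + 1)) = n * L + L * (L + 1) by ring,
        show (L + 1) * (L + 1) = L * (L + 1) + (L + 1) by ring, pow_add, pow_add _ (n * L),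
        inv_pow, inv_pow]
      field_simp
    rw [e1] at h2
    rw [e2]
    exact h2.trans (le_mul_of_one_le_left (by positivity) (one_le_pow₀ (by norm_num)))
  · have := h0.remSeq hφ ht hψ k x
    refine this.trans ?_
    rw [← pow_mul, inv_pow, ← div_eq_mul_inv, le_div_iff₀ (by positivity)]
    rw [mul_right_comm, ← pow_add]
    gcongr
    · norm_num
    · nlinarith

end remainder
/-! ### Expansion of a test function in mollifications -/

section expansion

variable {φ : RN N → ℝ}

theorem integral_mul_convAt (hφ : GoodPhi φ) {s : ℝ} (hs : 0 < s) {f r : RN N → ℂ}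
    (hf : Integrable f) (hr : Integrable r) :
    ∫ x, f x * convAt φ s r x = ∫ z, convAt φ s f z * r z := by
  have hint : Integrable (Function.uncurry fun x z => f x * (dil φ s (x - z) • r z))
      (volume.prod volume) := by
    obtain ⟨c, hc⟩ := (hφ.contDiff_dil s).continuous.bounded_above_of_compact_support
      (hφ.hasCompactSupport_dil hs)
    have h1 : Integrable (fun q : RN N × RN N => f q.1 * r q.2) (volume.prod volume) :=
      hf.mul_prod hr
    have h2 := h1.bdd_mul (c := c) (f := fun q : RN N × RN N => (dil φ s (q.1 - q.2) : ℂ))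
      (by
        have := (hφ.contDiff_dil s).continuous
        exact Continuous.aestronglyMeasurable (by fun_prop))
      (Eventually.of_forall fun q => by
        have := hc (q.1 - q.2)
        simpa using this)
    refine h2.congr (Eventually.of_forall fun q => ?_)
    simp only [Function.uncurry, Complex.real_smul]
    ring
  calc ∫ x, f x * convAt φ s r x = ∫ x, ∫ z, f x * (dil φ s (x - z) • r z) := by
        simp only [convAt, integral_const_mul]
    _ = ∫ z, ∫ x, f x * (dil φ s (x - z) • r z) := integral_integral_swap hint
    _ = _ := by
      refine integral_congr_ae (Eventually.of_forall fun z => ?_)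
      simp only [convAt]
      rw [← integral_mul_const]
      refine integral_congr_ae (Eventually.of_forall fun x => ?_)
      simp only [hφ.dil_sub_comm s x z, Complex.real_smul]
      ring

theorem hasCompactSupport_of_eq_zero {E : Type*} [Zero E] {ψ : RN N → E} {w : RN N} {ρ : ℝ}
    (h : ∀ x, ρ < dist x w → ψ x = 0) : HasCompactSupport ψ :=
  HasCompactSupport.of_support_subset_isCompact (isCompact_closedBall w ρ) fun x hx => by
    by_contra hx'
    exact hx (h x (by simpa using hx'))

theorem enorm_integral_mul_le (hφ : GoodPhi φ) {f ψ : RN N → ℂ} (hf : Continuous f)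
    (hfc : HasCompactSupport f) (hψ : Continuous ψ) {t : ℝ} (ht : 0 < t) {w : RN N} {ρ : ℝ}
    (hψ0 : ∀ x, ρ < dist x w → ψ x = 0) {L : ℕ} (hL : 2 ≤ L) {β : ℝ} (hβ : 0 ≤ β)
    (h0 : diffBound 0 ψ β) (hLb : diffBound L ψ (β / t ^ L)) :
    ‖∫ x, f x * ψ x‖ₑ ≤ ∑' k : ℕ, ENNReal.ofReal (2 ^ (L * L) * β * ((2 : ℝ)⁻¹ ^ (L - 1)) ^ k) *
      ∫⁻ x in closedBall w (ρ + 2 * t), ‖convAt φ (t / 2 ^ k) f x‖ₑ := by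
  set r := remSeq φ t ψ with hr
  have hrc : ∀ k, Continuous (r k) := continuous_remSeq hφ ht hψ
  have hr0 : ∀ k x, ρ + 2 * t < dist x w → r k x = 0 := fun k x hx =>
    remSeq_eq_zero hφ ht hψ0 k hx
  have hri : ∀ k, Integrable (r k) := fun k =>
    (hrc k).integrable_of_hasCompactSupport (hasCompactSupport_of_eq_zero (hr0 k))
  have hfi : Integrable f := hf.integrable_of_hasCompactSupport hfc
  have hb : ∀ k x, ‖r k x‖ ≤ 2 ^ (L * L) * β * ((2 : ℝ)⁻¹ ^ (L - 1)) ^ k :=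
    norm_remSeq_le hφ ht hψ (by omega) hβ h0 hLb
  have hstep : ∀ k, ∫ x, f x * r k x = (∫ x, convAt φ (t / 2 ^ k) f x * r k x) +
      ∫ x, f x * r (k + 1) x := fun k => by
    have hk : 0 < t / 2 ^ k := by positivity
    rw [← integral_mul_convAt hφ hk hfi (hri k), ← integral_add]
    · refine integral_congr_ae (Eventually.of_forall fun x => ?_)
      show _ = f x * convAt φ (t / 2 ^ k) (r k) x + f x * remStep φ (t / 2 ^ k) (r k) x
      rw [remStep_eq hφ hk (hrc k), convAt_eq φ]
      ring
    · exact (hf.mul (continuous_convAt hφ hk (hrc k))).integrable_of_hasCompactSupport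
        hfc.mul_right
    · exact (hf.mul (hrc (k + 1))).integrable_of_hasCompactSupport hfc.mul_right
  have hsum : ∀ n, ∫ x, f x * ψ x = (∑ k ∈ Finset.range n, ∫ x, convAt φ (t / 2 ^ k) f x * r k x) +
      ∫ x, f x * r n x := fun n => by
    induction n with
    | zero => simp [hr, remSeq]
    | succ n ih => rw [ih, hstep n, Finset.sum_range_succ, add_assoc]
  have hterm : ∀ k, ‖∫ x, convAt φ (t / 2 ^ k) f x * r k x‖ₑ ≤
      ENNReal.ofReal (2 ^ (L * L) * β * ((2 : ℝ)⁻¹ ^ (L - 1)) ^ k) *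
        ∫⁻ x in closedBall w (ρ + 2 * t), ‖convAt φ (t / 2 ^ k) f x‖ₑ := fun k => by
    calc _ ≤ ∫⁻ x, ‖convAt φ (t / 2 ^ k) f x * r k x‖ₑ := enorm_integral_le_lintegral_enorm _
      _ ≤ ∫⁻ x, (closedBall w (ρ + 2 * t)).indicator (fun x =>
          ENNReal.ofReal (2 ^ (L * L) * β * ((2 : ℝ)⁻¹ ^ (L - 1)) ^ k) *
            ‖convAt φ (t / 2 ^ k) f x‖ₑ) x := by
        refine lintegral_mono fun x => ?_
        by_cases hx : x ∈ closedBall w (ρ + 2 * t)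
        · simp only [hx, indicator_of_mem, enorm_mul]
          rw [mul_comm]
          gcongr
          rw [← ofReal_norm]
          exact ENNReal.ofReal_le_ofReal (hb k x)
        · simp [hr0 k x (by simpa using hx)]
      _ = _ := by
        rw [lintegral_indicator measurableSet_closedBall, lintegral_const_mul']
        exact ENNReal.ofReal_ne_top
  have hlim : Tendsto (fun n => ∫ x, f x * r n x) atTop (𝓝 0) := by
    refine squeeze_zero_norm (a := fun n => 2 ^ (L * L) * β * ((2 : ℝ)⁻¹ ^ (L - 1)) ^ n *
      ∫ x, ‖f x‖) (fun n => ?_) ?_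
    · rw [← integral_const_mul]
      refine norm_integral_le_of_norm_le (hfi.norm.const_mul _) (Eventually.of_forall fun x => ?_)
      rw [norm_mul, mul_comm]
      gcongr
      exact hb n x
    · have := tendsto_pow_atTop_nhds_zero_of_lt_one (r := (2 : ℝ)⁻¹ ^ (L - 1)) (by positivity)
        (pow_lt_one₀ (by norm_num) (by norm_num) (by omega))
      simpa using (this.const_mul (2 ^ (L * L) * β)).mul_const (∫ x, ‖f x‖)
  have hle : ∀ n, ‖∫ x, f x * ψ x‖ₑ ≤ (∑' k : ℕ, ENNReal.ofReal (2 ^ (L * L) * β *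
      ((2 : ℝ)⁻¹ ^ (L - 1)) ^ k) * ∫⁻ x in closedBall w (ρ + 2 * t), ‖convAt φ (t / 2 ^ k) f x‖ₑ) +
      ‖∫ x, f x * r n x‖ₑ := fun n => by
    rw [hsum n]
    refine (enorm_add_le _ _).trans ?_
    gcongr
    refine (enorm_sum_le _ _).trans ((Finset.sum_le_sum fun k _ => hterm k).trans ?_)
    exact ENNReal.sum_le_tsum _
  have := (hlim.enorm).const_add (∑' k : ℕ, ENNReal.ofReal (2 ^ (L * L) * β *
      ((2 : ℝ)⁻¹ ^ (L - 1)) ^ k) * ∫⁻ x in closedBall w (ρ + 2 * t), ‖convAt φ (t / 2 ^ k) f x‖ₑ)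
  rw [enorm_zero, add_zero] at this
  exact ge_of_tendsto' this hle

end expansion

/-! ### The local maximal functions -/

/-- The maximal function at scales below `ℓ`. -/
def locMax (φ : RN N → ℝ) (ℓ : ℝ) (f : RN N → ℂ) (x : RN N) : ℝ≥0∞ :=
  ⨆ t ∈ Ioo (0 : ℝ) ℓ, ‖convAt φ t f x‖ₑ

/-- The tangential (Peetre) maximal function. -/
def peetreMax (φ : RN N → ℝ) (ℓ A : ℝ) (f : RN N → ℂ) (x : RN N) : ℝ≥0∞ :=
  ⨆ t ∈ Ioo (0 : ℝ) ℓ, ⨆ y, ‖convAt φ t f y‖ₑ * ENNReal.ofReal ((1 + ‖x - y‖ / t) ^ (-A))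

/-- The majorant controlling all smooth averages. -/
def gMax (φ : RN N → ℝ) (r ℓ : ℝ) (f : RN N → ℂ) (x : RN N) : ℝ≥0∞ :=
  (hlMax (fun y => locMax φ ℓ f y ^ r) x) ^ (1 / r)

section maximal

variable {φ : RN N → ℝ}

theorem enorm_convAt_le_locMax {ℓ t : ℝ} (ht : t ∈ Ioo (0 : ℝ) ℓ) (f : RN N → ℂ) (x : RN N) :
    ‖convAt φ t f x‖ₑ ≤ locMax φ ℓ f x :=
  le_iSup₂ (f := fun t (_ : t ∈ Ioo (0 : ℝ) ℓ) => ‖convAt φ t f x‖ₑ) t ht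

theorem lowerSemicontinuous_locMax (hφ : GoodPhi φ) (ℓ : ℝ) {f : RN N → ℂ} (hf : Continuous f) :
    LowerSemicontinuous (locMax φ ℓ f) :=
  lowerSemicontinuous_iSup fun _ => lowerSemicontinuous_iSup fun ht =>
    (continuous_convAt hφ ht.1 hf).enorm.lowerSemicontinuous

theorem measurable_locMax (hφ : GoodPhi φ) (ℓ : ℝ) {f : RN N → ℂ} (hf : Continuous f) :
    Measurable (locMax φ ℓ f) := (lowerSemicontinuous_locMax hφ ℓ hf).measurable

theorem norm_convAt_le (hφ : GoodPhi φ) {t : ℝ} (ht : 0 < t) {f : RN N → ℂ} {x : RN N} {c : ℝ}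
    (hc : ∀ y, dist y x ≤ t → ‖f y‖ ≤ c) : ‖convAt φ t f x‖ ≤ c := by
  rw [convAt_eq φ]
  calc _ ≤ ∫ y, dil φ t y * c := by
        refine norm_integral_le_of_norm_le
          (((hφ.contDiff_dil t).continuous.integrable_of_hasCompactSupport
            (hφ.hasCompactSupport_dil ht)).mul_const c) (Eventually.of_forall fun y => ?_)
        rw [norm_smul, Real.norm_of_nonneg (hφ.dil_nonneg ht y)]
        rcases le_or_gt ‖y‖ t with h | h
        · exact mul_le_mul_of_nonneg_left (hc _ (by simpa [dist_eq_norm] using h))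
            (hφ.dil_nonneg ht y)
        · simp [hφ.dil_eq_zero ht h]
    _ = c := by rw [integral_mul_const, hφ.integral_dil ht, one_mul]

theorem locMax_le (hφ : GoodPhi φ) (ℓ : ℝ) {f : RN N → ℂ} {c : ℝ} (hc : ∀ x, ‖f x‖ ≤ c)
    (x : RN N) : locMax φ ℓ f x ≤ ENNReal.ofReal c := by
  refine iSup₂_le fun t ht => ?_
  rw [← ofReal_norm]
  exact ENNReal.ofReal_le_ofReal (norm_convAt_le hφ ht.1 fun y _ => hc y)

theorem tendsto_convAt (hφ : GoodPhi φ) {f : RN N → ℂ} (hf : Continuous f) (x : RN N) :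
    Tendsto (fun t => convAt φ t f x) (𝓝[>] 0) (𝓝 (f x)) := by
  rw [Metric.tendsto_nhds]
  intro ε hε
  obtain ⟨δ, hδ, h⟩ := Metric.continuous_iff.1 hf x (ε / 2) (by positivity)
  filter_upwards [Ioo_mem_nhdsGT hδ] with t ht
  have e : convAt φ t f x - f x = convAt φ t (fun y => f y - f x) x := by
    rw [convAt_eq φ, convAt_eq φ]
    simp only [smul_sub]
    rw [integral_sub (hφ.integrable_dil_smul ht.1 (W := fun y => f (x - y)) (by fun_prop))
      (hφ.integrable_dil_smul ht.1 continuous_const), integral_smul_const, hφ.integral_dil ht.1,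
      one_smul]
  rw [dist_eq_norm, e]
  refine (norm_convAt_le hφ ht.1 (c := ε / 2) fun y hy => ?_).trans_lt (by linarith)
  rw [← dist_eq_norm]
  exact (h y (hy.trans_lt ht.2)).le

theorem enorm_le_locMax (hφ : GoodPhi φ) {ℓ : ℝ} (hℓ : 0 < ℓ) {f : RN N → ℂ} (hf : Continuous f)
    (x : RN N) : ‖f x‖ₑ ≤ locMax φ ℓ f x := by
  refine le_of_tendsto (tendsto_convAt hφ hf x).enorm ?_
  filter_upwards [Ioo_mem_nhdsGT hℓ] with t ht
  exact enorm_convAt_le_locMax ht f x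

theorem enorm_convAt_le_peetreMax {ℓ A t : ℝ} (ht : t ∈ Ioo (0 : ℝ) ℓ) (f : RN N → ℂ)
    (x y : RN N) :
    ‖convAt φ t f y‖ₑ ≤ peetreMax φ ℓ A f x * ENNReal.ofReal ((1 + ‖x - y‖ / t) ^ A) := by
  have hp : 0 < 1 + ‖x - y‖ / t := by have := ht.1; positivity
  have h1 : ‖convAt φ t f y‖ₑ * ENNReal.ofReal ((1 + ‖x - y‖ / t) ^ (-A)) ≤ peetreMax φ ℓ A f x :=
    le_iSup₂_of_le t ht (le_iSup (fun y => ‖convAt φ t f y‖ₑ *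
      ENNReal.ofReal ((1 + ‖x - y‖ / t) ^ (-A))) y)
  calc ‖convAt φ t f y‖ₑ = ‖convAt φ t f y‖ₑ * ENNReal.ofReal ((1 + ‖x - y‖ / t) ^ (-A)) *
        ENNReal.ofReal ((1 + ‖x - y‖ / t) ^ A) := by
        rw [mul_assoc, ← ENNReal.ofReal_mul (by positivity), ← Real.rpow_add hp]
        simp
    _ ≤ _ := by gcongr

theorem peetreMax_le (hφ : GoodPhi φ) (ℓ : ℝ) {A : ℝ} (hA : 0 ≤ A) {f : RN N → ℂ} {c : ℝ}
    (hc : ∀ x, ‖f x‖ ≤ c) (x : RN N) : peetreMax φ ℓ A f x ≤ ENNReal.ofReal c := by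
  refine iSup₂_le fun t ht => iSup_le fun y => ?_
  have ht0 := ht.1
  calc _ ≤ ENNReal.ofReal c * 1 := by
        gcongr
        · rw [← ofReal_norm]
          exact ENNReal.ofReal_le_ofReal (norm_convAt_le hφ ht.1 fun y _ => hc y)
        · rw [ENNReal.ofReal_le_one]
          exact Real.rpow_le_one_of_one_le_of_nonpos (le_add_of_nonneg_right (by positivity))
            (by linarith)
    _ = _ := mul_one _

end maximal

/-! ### Control of smooth averages by the majorant -/

theorem volume_ball_zero_eq {s : ℝ} (hs : 0 < s) :
    volume (ball (0 : RN N) s) = ENNReal.ofReal (s ^ N) * volume (ball (0 : RN N) 1) := by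
  rw [Measure.addHaar_ball_of_pos _ _ hs, finrank_euclideanSpace_fin]

theorem diffBound.of_JB {L i : ℕ} {t H : ℝ} (ht : 0 < t) {v : RN N → ℂ}
    (hv : ContDiff ℝ (⊤ : ℕ∞) v) (h : ∀ x, JB L t H v x) (hi : i ≤ L) :
    diffBound i v (H / t ^ i) :=
  diffBound.of_iteratedFDeriv hv fun x => (le_div_iff₀ (by positivity)).2 (h x i hi)

section grand

variable {φ : RN N → ℝ}

theorem enorm_integral_mul_le_peetreMax (hφ : GoodPhi φ) {r : ℝ} (hr0 : 0 < r) (hr1 : r ≤ 1)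
    {L : ℕ} (hL : N / r - N + 2 ≤ L) {R : ℝ} (hR : 1 ≤ R) {ℓ t : ℝ} (ht : t ∈ Ioo (0 : ℝ) ℓ)
    {f ψ : RN N → ℂ} (hf : Continuous f) (hfc : HasCompactSupport f) (hψ : Continuous ψ)
    (x y : RN N) (hψ0 : ∀ z, R * t < dist z y → ψ z = 0) {H : ℝ} (hH : 0 ≤ H)
    (h0 : diffBound 0 ψ (H / t ^ N)) (hLb : diffBound L ψ (H / t ^ N / t ^ L)) :
    ‖∫ z, f z * ψ z‖ₑ ≤ ENNReal.ofReal (2 ^ (L * L) * 2 * (R + 3) ^ ((N : ℝ) / r) * H *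
      (1 + ‖x - y‖ / t) ^ ((N : ℝ) / r)) * (volume (ball (0 : RN N) 1) *
      (hlMax (fun w => locMax φ ℓ f w ^ r) x * peetreMax φ ℓ (N / r) f x ^ (1 - r))) := by
  have ht0 := ht.1
  set A : ℝ := (N : ℝ) / r with hA
  have hAN : A * (1 - r) = A - N := by rw [hA]; field_simp
  have hA0 : (N : ℝ) ≤ A := by
    rw [hA, le_div_iff₀ hr0]
    exact mul_le_of_le_one_right (by positivity) hr1
  have hL2 : 2 ≤ L := by
    have : (2 : ℝ) ≤ L := by linarith
    exact_mod_cast this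
  set P := peetreMax φ ℓ A f x
  set hl := hlMax (fun w => locMax φ ℓ f w ^ r) x
  set V := volume (ball (0 : RN N) 1)
  set D : ℝ := 1 + ‖x - y‖ / t with hD
  have hxy : 0 ≤ ‖x - y‖ / t := by positivity
  have hD1 : 1 ≤ D := by linarith
  have hRD : 0 < (R + 3) * D := by positivity
  have hDt : D * t = t + ‖x - y‖ := by rw [hD]; field_simp
  have hpt : ∀ k : ℕ, ∀ w ∈ closedBall y (R * t + 2 * t), ‖convAt φ (t / 2 ^ k) f w‖ₑ ≤
      (P * ENNReal.ofReal ((2 ^ k * ((R + 3) * D)) ^ A)) ^ (1 - r) * locMax φ ℓ f w ^ r := by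
    intro k w hw
    have htk : t / 2 ^ k ∈ Ioo (0 : ℝ) ℓ :=
      ⟨by positivity, (div_le_self ht0.le (one_le_pow₀ one_le_two)).trans_lt ht.2⟩
    have h1 : ‖x - w‖ ≤ ‖x - y‖ + (R * t + 2 * t) := by
      rw [mem_closedBall, dist_comm, dist_eq_norm] at hw
      calc ‖x - w‖ = ‖(x - y) + (y - w)‖ := by congr 1; abel
        _ ≤ _ := (norm_add_le _ _).trans (by gcongr)
    have h2 : 1 + ‖x - w‖ / (t / 2 ^ k) ≤ 2 ^ k * ((R + 3) * D) := by
      have hk : (1 : ℝ) ≤ 2 ^ k := one_le_pow₀ one_le_two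
      have h3 : ‖x - w‖ / t ≤ (R + 2) * D := by
        rw [div_le_iff₀ ht0, mul_assoc, hDt]
        nlinarith [norm_nonneg (x - y)]
      have h4 : ‖x - w‖ / (t / 2 ^ k) = 2 ^ k * (‖x - w‖ / t) := by field_simp
      rw [h4]
      nlinarith
    have h5 := enorm_convAt_le_peetreMax (φ := φ) (A := A) htk f x w
    have h6 : ‖convAt φ (t / 2 ^ k) f w‖ₑ ≤
        P * ENNReal.ofReal ((2 ^ k * ((R + 3) * D)) ^ A) := by
      refine h5.trans ?_
      have htk0 := htk.1
      gcongr
    calc ‖convAt φ (t / 2 ^ k) f w‖ₑ =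
          ‖convAt φ (t / 2 ^ k) f w‖ₑ ^ (1 - r) * ‖convAt φ (t / 2 ^ k) f w‖ₑ ^ r := by
          rw [← ENNReal.rpow_add_of_nonneg _ _ (by linarith) hr0.le]
          simp
      _ ≤ _ := by
          exact mul_le_mul' (ENNReal.rpow_le_rpow h6 (by linarith))
            (ENNReal.rpow_le_rpow (enorm_convAt_le_locMax htk f w) hr0.le)
  have hint : ∀ k : ℕ, ∫⁻ w in closedBall y (R * t + 2 * t), ‖convAt φ (t / 2 ^ k) f w‖ₑ ≤
      (P * ENNReal.ofReal ((2 ^ k * ((R + 3) * D)) ^ A)) ^ (1 - r) *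
        (ENNReal.ofReal (((R + 3) * D * t) ^ N) * V * hl) := by
    intro k
    have hm : Measurable fun w => locMax φ ℓ f w ^ r :=
      (measurable_locMax hφ ℓ hf).pow_const r
    calc _ ≤ ∫⁻ w in closedBall y (R * t + 2 * t),
          (P * ENNReal.ofReal ((2 ^ k * ((R + 3) * D)) ^ A)) ^ (1 - r) * locMax φ ℓ f w ^ r :=
          setLIntegral_mono' measurableSet_closedBall (hpt k)
      _ = (P * ENNReal.ofReal ((2 ^ k * ((R + 3) * D)) ^ A)) ^ (1 - r) *
          ∫⁻ w in closedBall y (R * t + 2 * t), locMax φ ℓ f w ^ r := lintegral_const_mul _ hm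
      _ ≤ _ := by
          gcongr
          rw [← volume_ball_zero_eq (by positivity)]
          refine (lintegral_mono_set ?_).trans
            (lintegral_ball_le_hlMax _ x (s := (R + 3) * D * t) (by positivity))
          intro w hw
          rw [mem_closedBall, dist_eq_norm] at hw
          rw [mem_ball, dist_eq_norm, mul_assoc, hDt]
          have : ‖w - x‖ ≤ ‖w - y‖ + ‖x - y‖ := by
            calc ‖w - x‖ = ‖(w - y) - (x - y)‖ := by congr 1; abel
              _ ≤ _ := norm_sub_le _ _
          nlinarith [norm_nonneg (x - y)]
  have hterm : ∀ k : ℕ, ENNReal.ofReal (2 ^ (L * L) * (H / t ^ N) * ((2 : ℝ)⁻¹ ^ (L - 1)) ^ k) *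
      ∫⁻ w in closedBall y (R * t + 2 * t), ‖convAt φ (t / 2 ^ k) f w‖ₑ ≤
      ENNReal.ofReal ((2 ^ (L * L) * (R + 3) ^ A * H * D ^ A) * (2⁻¹ : ℝ) ^ k) *
        (V * (hl * P ^ (1 - r))) := by
    intro k
    refine (mul_le_mul_right (hint k) _).trans ?_
    rw [ENNReal.mul_rpow_of_nonneg _ _ (by linarith), ENNReal.ofReal_rpow_of_nonneg (by positivity)
      (by linarith), ← Real.rpow_mul (by positivity), hAN]
    have key : 2 ^ (L * L) * (H / t ^ N) * ((2 : ℝ)⁻¹ ^ (L - 1)) ^ k *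
        (2 ^ k * ((R + 3) * D)) ^ (A - N) * ((R + 3) * D * t) ^ N ≤
        (2 ^ (L * L) * (R + 3) ^ A * H * D ^ A) * (2⁻¹ : ℝ) ^ k := by
      have e1 : (2 ^ k * ((R + 3) * D)) ^ (A - N) * ((R + 3) * D) ^ N =
          ((2 : ℝ) ^ k) ^ (A - N) * ((R + 3) ^ A * D ^ A) := by
        rw [Real.mul_rpow (by positivity) (by positivity), mul_assoc,
          ← Real.mul_rpow (by positivity) (by positivity), ← Real.rpow_natCast _ N,
          ← Real.rpow_add hRD, sub_add_cancel]
      have e2 : ((2 : ℝ)⁻¹ ^ (L - 1)) ^ k * ((2 : ℝ) ^ k) ^ (A - N) ≤ (2⁻¹ : ℝ) ^ k := by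
        have : ((2 : ℝ) ^ k) ^ (A - N) ≤ ((2 : ℝ) ^ k) ^ ((L - 2 : ℕ) : ℝ) := by
          refine Real.rpow_le_rpow_of_exponent_le (one_le_pow₀ one_le_two) ?_
          rw [Nat.cast_sub hL2]
          push_cast
          linarith
        calc _ ≤ ((2 : ℝ)⁻¹ ^ (L - 1)) ^ k * ((2 : ℝ) ^ k) ^ ((L - 2 : ℕ) : ℝ) := by gcongr
          _ = _ := by
            rw [Real.rpow_natCast, ← pow_mul, ← pow_mul, inv_pow, inv_pow]
            have : (L - 1) * k = k * (L - 2) + k := by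
              obtain ⟨n, rfl⟩ : ∃ n, L = n + 2 := ⟨L - 2, by omega⟩
              simp; ring
            rw [this, pow_add]
            field_simp
      calc _ = (2 ^ (L * L) * H) * (((2 ^ k * ((R + 3) * D)) ^ (A - N) * ((R + 3) * D) ^ N)) *
            ((2 : ℝ)⁻¹ ^ (L - 1)) ^ k := by
            rw [mul_pow ((R + 3) * D) t]; field_simp
        _ = (2 ^ (L * L) * (R + 3) ^ A * H * D ^ A) *
            (((2 : ℝ)⁻¹ ^ (L - 1)) ^ k * ((2 : ℝ) ^ k) ^ (A - N)) := by rw [e1]; ring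
        _ ≤ _ := by gcongr
    calc _ = ENNReal.ofReal (2 ^ (L * L) * (H / t ^ N) * ((2 : ℝ)⁻¹ ^ (L - 1)) ^ k *
        (2 ^ k * ((R + 3) * D)) ^ (A - N) * ((R + 3) * D * t) ^ N) * (V * (hl * P ^ (1 - r))) := by
          rw [ENNReal.ofReal_mul' (q := ((R + 3) * D * t) ^ N) (by positivity),
            ENNReal.ofReal_mul' (q := (2 ^ k * ((R + 3) * D)) ^ (A - N)) (by positivity)]
          ring
      _ ≤ _ := by gcongr
  refine (enorm_integral_mul_le hφ hf hfc hψ ht0 hψ0 hL2 (by positivity) h0 hLb).trans ?_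
  refine (ENNReal.tsum_le_tsum hterm).trans ?_
  rw [ENNReal.tsum_mul_right, ← ENNReal.ofReal_tsum_of_nonneg (fun k => by positivity)
    ((summable_geometric_of_lt_one (by norm_num) (by norm_num)).mul_left _), tsum_mul_left,
    tsum_geometric_inv_two]
  refine mul_le_mul_left (ENNReal.ofReal_le_ofReal (le_of_eq ?_)) _
  ring

theorem integral_mul_dilC (φ : RN N → ℝ) (t : ℝ) (f : RN N → ℂ) (y : RN N) :
    ∫ z, f z * dilC φ t (y - z) = convAt φ t f y := by
  simp only [convAt, dilC, Complex.real_smul, mul_comm]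

/-- The majorant dominates all averages against bumps adapted to a ball around the point. -/
theorem GoodPhi.exists_enorm_integral_le_gMax (hφ : GoodPhi φ) {r : ℝ} (hr0 : 0 < r)
    (hr1 : r ≤ 1) : ∃ L : ℕ, ∀ R : ℝ, 1 ≤ R → ∃ C : ℝ, 0 < C ∧
      ∀ (ℓ : ℝ) (f : RN N → ℂ), Continuous f → HasCompactSupport f → ∀ t ∈ Ioo (0 : ℝ) ℓ,
        ∀ (x : RN N) (ψ : RN N → ℂ), ContDiff ℝ (⊤ : ℕ∞) ψ →
          (∀ z, R * t < dist z x → ψ z = 0) → ∀ H : ℝ, 0 ≤ H →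
            (∀ y, JB L t (H / t ^ N) ψ y) →
              ‖∫ z, f z * ψ z‖ₑ ≤ ENNReal.ofReal (C * H) * gMax φ r ℓ f x := by
  obtain ⟨L, hL⟩ := exists_nat_ge ((N : ℝ) / r - N + 2)
  obtain ⟨c, hc0, hc⟩ := hφ.exists_JB_dil L
  set V := volume (ball (0 : RN N) 1)
  have hV : V ≠ ⊤ := measure_ball_lt_top.ne
  set K : ℝ≥0∞ := ENNReal.ofReal (2 ^ (L * L) * 2 * (1 + 3) ^ ((N : ℝ) / r) * c) * V
  have hK : K ≠ ⊤ := ENNReal.mul_ne_top ENNReal.ofReal_ne_top hV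
  refine ⟨L, fun R hR => ⟨2 ^ (L * L) * 2 * (R + 3) ^ ((N : ℝ) / r) *
    (V * K ^ ((1 - r) / r)).toReal + 1, by positivity, ?_⟩⟩
  intro ℓ f hf hfc t ht x ψ hψ hψ0 H hH hJ
  have ht0 := ht.1
  set P := peetreMax φ ℓ (N / r) f x
  set hl := hlMax (fun w => locMax φ ℓ f w ^ r) x with hhl
  have hPtop : P ≠ ⊤ := by
    obtain ⟨b, hb⟩ := hf.bounded_above_of_compact_support hfc
    exact ne_top_of_le_ne_top ENNReal.ofReal_ne_top (peetreMax_le hφ ℓ (by positivity) hb x)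
  have hP : P ≤ K * hl * P ^ (1 - r) := by
    refine iSup₂_le fun s hs => iSup_le fun y => ?_
    have hs0 := hs.1
    have hsm : ContDiff ℝ (⊤ : ℕ∞) fun z => dilC φ s (y - z) :=
      (hφ.contDiff_dilC s).comp (contDiff_const.sub contDiff_id)
    have hJs : ∀ z, JB L s (c / s ^ N) (fun z => dilC φ s (y - z)) z := fun z =>
      JB.comp_const_sub _ (by rw [div_eq_mul_inv]; exact hc s hs0 _)
    have h1 := enorm_integral_mul_le_peetreMax hφ hr0 hr1 hL le_rfl hs hf hfc hsm.continuous x y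
      (H := c) (fun z hz => by
        have : s < ‖y - z‖ := by rw [← dist_eq_norm, dist_comm]; linarith
        simp [dilC, hφ.dil_eq_zero hs0 this]) hc0.le
      (by simpa using diffBound.of_JB hs0 hsm hJs (Nat.zero_le L))
      (diffBound.of_JB hs0 hsm hJs le_rfl)
    rw [integral_mul_dilC φ, ENNReal.ofReal_mul (by positivity)] at h1
    have hD : 0 < 1 + ‖x - y‖ / s := by positivity
    calc _ ≤ _ := mul_le_mul_left h1 _
      _ = K * hl * P ^ (1 - r) * (ENNReal.ofReal ((1 + ‖x - y‖ / s) ^ ((N : ℝ) / r)) *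
          ENNReal.ofReal ((1 + ‖x - y‖ / s) ^ (-((N : ℝ) / r)))) := by ring
      _ = _ := by
          rw [← ENNReal.ofReal_mul (by positivity), ← Real.rpow_add hD]
          simp
  have hPr : P ^ r ≤ K * hl := by
    rcases eq_or_ne P 0 with h | h
    · rw [h, ENNReal.zero_rpow_of_pos hr0]; exact zero_le
    · have h1 : P ^ r * P ^ (1 - r) ≤ K * hl * P ^ (1 - r) := by
        rw [← ENNReal.rpow_add_of_nonneg _ _ hr0.le (by linarith)]
        simpa using hP
      exact (ENNReal.mul_le_mul_iff_left (by simp [h, hPtop])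
        (ENNReal.rpow_ne_top_of_nonneg (by linarith) hPtop)).1 h1
  have hP2 : hl * P ^ (1 - r) ≤ K ^ ((1 - r) / r) * gMax φ r ℓ f x := by
    have h1 : P ^ (1 - r) ≤ K ^ ((1 - r) / r) * hl ^ ((1 - r) / r) := by
      rw [← ENNReal.mul_rpow_of_nonneg _ _ (div_nonneg (by linarith) hr0.le)]
      calc P ^ (1 - r) = (P ^ r) ^ ((1 - r) / r) := by
            rw [← ENNReal.rpow_mul]; congr 1; field_simp
        _ ≤ _ := ENNReal.rpow_le_rpow hPr (div_nonneg (by linarith) hr0.le)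
    have h2 : gMax φ r ℓ f x = hl * hl ^ ((1 - r) / r) := by
      have : 1 / r = 1 + (1 - r) / r := by field_simp; ring
      rw [gMax, this, ENNReal.rpow_add_of_nonneg _ _ zero_le_one
        (div_nonneg (by linarith) hr0.le), ENNReal.rpow_one]
    rw [h2]
    calc _ ≤ hl * (K ^ ((1 - r) / r) * hl ^ ((1 - r) / r)) := by gcongr
      _ = _ := by ring
  have h3 := enorm_integral_mul_le_peetreMax hφ hr0 hr1 hL hR ht hf hfc hψ.continuous x x
    hψ0 hH (by simpa using diffBound.of_JB ht0 hψ hJ (Nat.zero_le L))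
    (diffBound.of_JB ht0 hψ hJ le_rfl)
  have hVK : V * K ^ ((1 - r) / r) ≠ ⊤ := ENNReal.mul_ne_top hV
    (ENNReal.rpow_ne_top_of_nonneg (div_nonneg (by linarith) hr0.le) hK)
  calc _ ≤ _ := h3
    _ ≤ ENNReal.ofReal (2 ^ (L * L) * 2 * (R + 3) ^ ((N : ℝ) / r) * H) *
        (V * (K ^ ((1 - r) / r) * gMax φ r ℓ f x)) := by
        gcongr ?_ * (V * ?_)
        simp
    _ = ENNReal.ofReal (2 ^ (L * L) * 2 * (R + 3) ^ ((N : ℝ) / r) *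
          (V * K ^ ((1 - r) / r)).toReal * H) * gMax φ r ℓ f x := by
        rw [mul_right_comm _ (V * K ^ ((1 - r) / r)).toReal H, ENNReal.ofReal_mul' (q := (V * K ^ ((1 - r) / r)).toReal)
          (by positivity), ENNReal.ofReal_toReal hVK]
        ring
    _ ≤ _ := by gcongr; linarith

theorem lowerSemicontinuous_gMax {r : ℝ} (hr0 : 0 < r) (ℓ : ℝ) (f : RN N → ℂ) :
    LowerSemicontinuous (gMax φ r ℓ f) :=
  (ENNReal.continuous_rpow_const).comp_lowerSemicontinuous (lowerSemicontinuous_hlMax _)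
    (ENNReal.monotone_rpow_of_nonneg (by positivity))

theorem measurable_gMax {r : ℝ} (hr0 : 0 < r) (ℓ : ℝ) (f : RN N → ℂ) :
    Measurable (gMax φ r ℓ f) := (lowerSemicontinuous_gMax hr0 ℓ f).measurable

theorem gMax_le (hφ : GoodPhi φ) {r : ℝ} (hr0 : 0 < r) (ℓ : ℝ) {f : RN N → ℂ} {c : ℝ}
    (hc : ∀ x, ‖f x‖ ≤ c) (x : RN N) : gMax φ r ℓ f x ≤ ENNReal.ofReal c := by
  have h : hlMax (fun w => locMax φ ℓ f w ^ r) x ≤ ENNReal.ofReal c ^ r :=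
    hlMax_le_const (fun w => ENNReal.rpow_le_rpow (locMax_le hφ ℓ hc w) hr0.le) x
  calc gMax φ r ℓ f x ≤ (ENNReal.ofReal c ^ r) ^ (1 / r) :=
        ENNReal.rpow_le_rpow h (by positivity)
    _ = _ := by rw [← ENNReal.rpow_mul, mul_one_div_cancel hr0.ne', ENNReal.rpow_one]

theorem lintegral_gMax_rpow_le (hN0 : N ≠ 0) (hφ : GoodPhi φ) {r p : ℝ} (hr0 : 0 < r)
    (hrp : 2 * r ≤ p) : ∃ C : ℝ≥0∞, C ≠ ⊤ ∧ ∀ (ℓ : ℝ) (f : RN N → ℂ), Continuous f →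
      HasCompactSupport f → ∫⁻ x, gMax φ r ℓ f x ^ p ≤ C * ∫⁻ x, locMax φ ℓ f x ^ p := by
  have hq : 1 < p / r := by rw [lt_div_iff₀ hr0]; linarith
  obtain ⟨C, hC, h⟩ := hlMax_strong_type hN0 (p / r) hq
  refine ⟨C, hC, fun ℓ f hf hfc => ?_⟩
  obtain ⟨b, hb⟩ := hf.bounded_above_of_compact_support hfc
  have := h (fun w => locMax φ ℓ f w ^ r) ((measurable_locMax hφ ℓ hf).pow_const r)
    ⟨ENNReal.ofReal b ^ r, ENNReal.rpow_ne_top_of_nonneg hr0.le ENNReal.ofReal_ne_top,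
      fun x => ENNReal.rpow_le_rpow (locMax_le hφ ℓ hb x) hr0.le⟩
  simp only [← ENNReal.rpow_mul, mul_div_cancel₀ p hr0.ne'] at this
  refine le_trans (le_of_eq ?_) this
  refine lintegral_congr fun x => ?_
  rw [gMax, ← ENNReal.rpow_mul]
  congr 1
  ring

theorem GoodPhi.exists_locMax_le_gMax (hφ : GoodPhi φ) {r : ℝ} (hr0 : 0 < r)
    (hr1 : r ≤ 1) : ∃ C : ℝ, 0 < C ∧ ∀ (ℓ : ℝ) (f : RN N → ℂ), Continuous f →
      HasCompactSupport f → ∀ x, locMax φ ℓ f x ≤ ENNReal.ofReal C * gMax φ r ℓ f x := by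
  obtain ⟨L, h⟩ := hφ.exists_enorm_integral_le_gMax hr0 hr1
  obtain ⟨C, hC0, hC⟩ := h 1 le_rfl
  obtain ⟨c, hc0, hc⟩ := hφ.exists_JB_dil L
  refine ⟨C * c, by positivity, fun ℓ f hf hfc x => iSup₂_le fun s hs => ?_⟩
  have hs0 := hs.1
  rw [← integral_mul_dilC φ]
  refine hC ℓ f hf hfc s hs x (fun z => dilC φ s (x - z))
    ((hφ.contDiff_dilC s).comp (contDiff_const.sub contDiff_id)) (fun z hz => ?_) c hc0.le fun z =>
      JB.comp_const_sub _ (by rw [div_eq_mul_inv]; exact hc s hs0 _)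
  have : s < ‖x - z‖ := by rw [← dist_eq_norm, dist_comm]; linarith
  simp [dilC, hφ.dil_eq_zero hs0 this]

end grand

/-! ### Convolution kernels of homogeneous multipliers -/

open scoped FourierTransform

/-- A function on frequency space which is smooth off the origin and homogeneous of degree `0`. -/
structure HomSymbol (m : RN N → ℂ) : Prop where
  smooth : ∀ ξ, ξ ≠ 0 → ContDiffAt ℝ (⊤ : ℕ∞) m ξ
  hom : ∀ c : ℝ, 0 < c → ∀ ξ, m (c • ξ) = m ξ

namespace HomSymbol

variable {m : RN N → ℂ}

theorem comp_neg (hm : HomSymbol m) : HomSymbol fun ξ => m (-ξ) where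
  smooth ξ hξ := (hm.smooth (-ξ) (neg_ne_zero.2 hξ)).comp ξ contDiff_neg.contDiffAt
  hom c hc ξ := by rw [← smul_neg, hm.hom c hc]

theorem exists_bound (hm : HomSymbol m) : ∃ b : ℝ, 0 < b ∧ ∀ ξ, ‖m ξ‖ ≤ b := by
  have hc : ContinuousOn m (sphere 0 1) := fun ξ hξ =>
    (hm.smooth ξ (ne_zero_of_mem_unit_sphere ⟨ξ, hξ⟩)).continuousAt.continuousWithinAt
  obtain ⟨b, hb⟩ := (isCompact_sphere (0 : RN N) 1).exists_bound_of_continuousOn hc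
  refine ⟨|b| + ‖m 0‖ + 1, by positivity, fun ξ => ?_⟩
  rcases eq_or_ne ξ 0 with rfl | h
  · have := abs_nonneg b; linarith
  · have h1 := hb (‖ξ‖⁻¹ • ξ) (by simp [norm_smul, h])
    rw [hm.hom _ (by positivity)] at h1
    have := le_abs_self b
    have := norm_nonneg (m 0)
    linarith

theorem aestronglyMeasurable (hN0 : N ≠ 0) (hm : HomSymbol m) :
    AEStronglyMeasurable m (volume : Measure (RN N)) := by
  have : Nonempty (Fin N) := ⟨⟨0, Nat.pos_of_ne_zero hN0⟩⟩
  have h1 : ContinuousOn m {0}ᶜ := fun ξ hξ => (hm.smooth ξ hξ).continuousAt.continuousWithinAt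
  have h2 := h1.aestronglyMeasurable (μ := volume) (measurableSet_singleton (0 : RN N)).compl
  have h3 : (volume : Measure (RN N)).restrict {0}ᶜ = volume :=
    Measure.restrict_eq_self_of_ae_mem (by simp [ae_iff])
  rwa [h3] at h2

end HomSymbol

/-- The kernel of the multiplier `m` mollified at scale `t`. -/
def mulKer (m : RN N → ℂ) (φ : RN N → ℝ) (t : ℝ) : RN N → ℂ :=
  𝓕 fun ξ => m ξ * 𝓕 (dilC φ 1) (t • ξ)

section fourier_basic

theorem fourier_comp_smul (f : RN N → ℂ) {c : ℝ} (hc : 0 < c) (z : RN N) :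
    𝓕 (fun ξ => f (c • ξ)) z = ((c ^ N)⁻¹ : ℝ) • 𝓕 f (c⁻¹ • z) := by
  rw [Real.fourier_eq, Real.fourier_eq]
  have h := Measure.integral_comp_smul (volume : Measure (RN N))
    (fun ξ => 𝐞 (-inner ℝ ξ (c⁻¹ • z)) • f ξ) c
  rw [finrank_euclideanSpace_fin, abs_of_pos (by positivity)] at h
  rw [← h]
  refine integral_congr_ae (Eventually.of_forall fun ξ => ?_)
  simp only [inner_smul_left, inner_smul_right]
  congr 3
  simp
  field_simp

theorem norm_iteratedFDeriv_fourier_le {f : RN N → ℂ}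
    (hf : ∀ n : ℕ, Integrable fun v => ‖v‖ ^ n * ‖f v‖) (hfm : AEStronglyMeasurable f)
    (n : ℕ) (z : RN N) :
    ‖iteratedFDeriv ℝ n (𝓕 f) z‖ ≤ (2 * Real.pi) ^ n * ∫ v, ‖v‖ ^ n * ‖f v‖ := by
  rw [Real.iteratedFDeriv_fourier (N := ⊤) (fun n _ => hf n) hfm (by exact_mod_cast le_top)]
  refine (VectorFourier.norm_fourierIntegral_le_integral_norm _ _ _ _ _).trans ?_
  rw [← integral_const_mul]
  refine integral_mono_of_nonneg (Eventually.of_forall fun v => norm_nonneg _)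
    ((hf n).const_mul _) (Eventually.of_forall fun v => ?_)
  refine (VectorFourier.norm_fourierPowSMulRight_le _ _ _ _).trans ?_
  rw [mul_assoc]
  have : ‖(innerSL ℝ : RN N →L[ℝ] RN N →L[ℝ] ℝ)‖ ≤ 1 := norm_innerSL_le ℝ
  have hp := Real.pi_pos
  show (2 * Real.pi * _) ^ n * (‖v‖ ^ n * ‖f v‖) ≤ (2 * Real.pi) ^ n * (‖v‖ ^ n * ‖f v‖)
  exact mul_le_mul_of_nonneg_right (pow_le_pow_left₀ (by positivity)
    (mul_le_of_le_one_right (by positivity) this) n) (by positivity)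

variable {φ : RN N → ℝ}

/-- The bump as a Schwartz function. -/
def GoodPhi.schwartz (hφ : GoodPhi φ) : SchwartzMap (RN N) ℂ :=
  (hφ.hasCompactSupport_dilC one_pos).toSchwartzMap (hφ.contDiff_dilC 1)

theorem GoodPhi.fourier_eq_schwartz (hφ : GoodPhi φ) :
    𝓕 (dilC φ 1) = ((𝓕 hφ.schwartz : SchwartzMap (RN N) ℂ) : RN N → ℂ) := rfl

theorem fourier_dilC (φ : RN N → ℝ) {t : ℝ} (ht : 0 < t) (ξ : RN N) :
    𝓕 (dilC φ t) ξ = 𝓕 (dilC φ 1) (t • ξ) := by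
  have h : dilC φ t = fun z => ((t ^ N)⁻¹ : ℝ) • dilC φ 1 (t⁻¹ • z) := by
    ext y
    simp only [dilC, dil]
    push_cast
    simp [div_eq_inv_mul]
  have h2 : 𝓕 (dilC φ t) ξ = ((t ^ N)⁻¹ : ℝ) • 𝓕 (fun z => dilC φ 1 (t⁻¹ • z)) ξ := by
    rw [h, Real.fourier_eq, Real.fourier_eq, ← integral_smul]
    refine integral_congr_ae (Eventually.of_forall fun y => ?_)
    simp only
    rw [smul_comm]
  rw [h2, fourier_comp_smul _ (by positivity), smul_smul, inv_inv]
  have : (t ^ N)⁻¹ * ((t⁻¹ ^ N)⁻¹) = 1 := by rw [inv_pow, inv_inv]; field_simp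
  rw [this, one_smul]

theorem GoodPhi.integrable_pow_mul_fourier (hφ : GoodPhi φ) {t : ℝ} (ht : 0 < t) (n : ℕ) :
    Integrable fun ξ : RN N => ‖ξ‖ ^ n * ‖𝓕 (dilC φ 1) (t • ξ)‖ := by
  have h := ((𝓕 hφ.schwartz : SchwartzMap (RN N) ℂ).integrable_pow_mul volume n).comp_smul ht.ne'
  refine (h.const_mul ((t ^ n)⁻¹)).congr (Eventually.of_forall fun ξ => ?_)
  simp only [norm_smul, Real.norm_of_nonneg ht.le, mul_pow]
  rw [← mul_assoc, ← mul_assoc, inv_mul_cancel₀ (by positivity), one_mul, hφ.fourier_eq_schwartz]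

theorem integrable_pow_mul_symbol (hφ : GoodPhi φ) {m : RN N → ℂ} {b : ℝ}
    (hmm : AEStronglyMeasurable m) (hb : ∀ ξ, ‖m ξ‖ ≤ b) {t : ℝ} (ht : 0 < t) (n : ℕ) :
    Integrable fun ξ : RN N => ‖ξ‖ ^ n * ‖m ξ * 𝓕 (dilC φ 1) (t • ξ)‖ := by
  have h := (hφ.integrable_pow_mul_fourier ht n).bdd_mul (c := b) hmm.norm
    (Eventually.of_forall fun ξ => by simpa using hb ξ)
  refine h.congr (Eventually.of_forall fun ξ => ?_)
  simp only [norm_mul]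
  ring

theorem continuous_fourier_dilC (hφ : GoodPhi φ) : Continuous (𝓕 (dilC φ 1)) := by
  rw [hφ.fourier_eq_schwartz]
  exact (𝓕 hφ.schwartz : SchwartzMap (RN N) ℂ).continuous

theorem contDiff_mulKer (hN0 : N ≠ 0) (hφ : GoodPhi φ) {m : RN N → ℂ} (hm : HomSymbol m) {t : ℝ}
    (ht : 0 < t) : ContDiff ℝ (⊤ : ℕ∞) (mulKer m φ t) := by
  obtain ⟨b, -, hb⟩ := hm.exists_bound
  exact Real.contDiff_fourier fun n _ =>
    integrable_pow_mul_symbol hφ (hm.aestronglyMeasurable hN0) hb ht n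

end fourier_basic

/-! ### Dyadic decomposition of the kernels -/

theorem sum_min_pow_le (n : ℕ) : ∀ ρ : ℝ, 2⁻¹ ≤ ρ →
    ∑ k ∈ Finset.range n, min (ρ / 2 ^ k) (2 ^ k / ρ) ≤ 5 - 1 / ρ := by
  have hsmall : ∀ (n : ℕ) (ρ : ℝ), 0 < ρ →
      ∑ k ∈ Finset.range n, min (ρ / 2 ^ k) (2 ^ k / ρ) ≤ 2 * ρ := by
    intro n ρ hρ
    calc _ ≤ ∑ k ∈ Finset.range n, ρ * (2⁻¹ : ℝ) ^ k := by
          refine Finset.sum_le_sum fun k _ => (min_le_left _ _).trans (le_of_eq ?_)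
          rw [inv_pow, div_eq_mul_inv]
      _ = ρ * ∑ k ∈ Finset.range n, (2⁻¹ : ℝ) ^ k := by rw [Finset.mul_sum]
      _ ≤ ρ * 2 := by
          gcongr
          exact ((summable_geometric_of_lt_one (r := (2 : ℝ)⁻¹) (by norm_num)
            (by norm_num)).sum_le_tsum _ fun _ _ => by positivity).trans_eq
            tsum_geometric_inv_two
      _ = _ := mul_comm _ _
  induction n with
  | zero =>
    intro ρ hρ
    have : 0 < ρ := by linarith
    have : 1 / ρ ≤ 2 := by rw [div_le_iff₀ this]; linarith
    rw [Finset.range_zero, Finset.sum_empty]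
    linarith
  | succ n ih =>
    intro ρ hρ
    have h0 : 0 < ρ := by linarith
    rcases lt_or_ge ρ 1 with h | h
    · refine (hsmall _ ρ h0).trans ?_
      have : 1 / ρ ≤ 2 := by rw [div_le_iff₀ h0]; linarith
      linarith
    · rw [Finset.sum_range_succ']
      have h1 := ih (ρ / 2) (by linarith)
      have h2 : ∀ k : ℕ, min (ρ / 2 ^ (k + 1)) (2 ^ (k + 1) / ρ) =
          min (ρ / 2 / 2 ^ k) (2 ^ k / (ρ / 2)) := fun k => by
        congr 1 <;> rw [pow_succ] <;> field_simp
      simp only [h2]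
      have h3 : min (ρ / 2 ^ 0) (2 ^ 0 / ρ) ≤ 1 / ρ := by simp
      have h4 : 1 / (ρ / 2) = 2 * (1 / ρ) := by field_simp
      rw [h4] at h1
      linarith

theorem sum_min_pow_le_five (n : ℕ) {ρ : ℝ} (hρ : 0 < ρ) :
    ∑ k ∈ Finset.range n, min (ρ / 2 ^ k) (2 ^ k / ρ) ≤ 5 := by
  rcases le_or_gt 2⁻¹ ρ with h | h
  · have := sum_min_pow_le n ρ h
    have : 0 < 1 / ρ := by positivity
    linarith
  · calc _ ≤ ∑ k ∈ Finset.range n, (2⁻¹ : ℝ) ^ k := by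
          refine Finset.sum_le_sum fun k _ => (min_le_left _ _).trans ?_
          rw [inv_pow, div_eq_mul_inv]
          exact mul_le_of_le_one_left (by positivity) (by linarith)
      _ ≤ ∑' k : ℕ, (2⁻¹ : ℝ) ^ k :=
          (summable_geometric_of_lt_one (by norm_num) (by norm_num)).sum_le_tsum _
            fun _ _ => by positivity
      _ ≤ 5 := by rw [tsum_geometric_inv_two]; norm_num

/-- A smooth cutoff equal to one near the origin. -/
def lowCut : ContDiffBump (0 : RN N) := ⟨1, 2, one_pos, one_lt_two⟩

/-- The annular part of a symbol, mollified. -/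
def annSymbol (m : RN N → ℂ) (φ : RN N → ℝ) (τ : ℝ) (ξ : RN N) : ℂ :=
  m ξ * ((lowCut ξ - lowCut ((2 : ℝ) • ξ) : ℝ) : ℂ) * 𝓕 (dilC φ 1) (τ • ξ)

theorem lowCut_sub_eq_zero {ξ : RN N} (h : ‖ξ‖ ≤ 2⁻¹ ∨ 2 ≤ ‖ξ‖) :
    (lowCut ξ - lowCut ((2 : ℝ) • ξ) : ℝ) = 0 := by
  rcases h with h | h
  · rw [ContDiffBump.one_of_mem_closedBall, ContDiffBump.one_of_mem_closedBall, sub_self]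
    · simp [lowCut, norm_smul]; linarith
    · simp [lowCut]; linarith
  · rw [ContDiffBump.zero_of_le_dist, ContDiffBump.zero_of_le_dist, sub_self]
    · simp [lowCut, norm_smul]; linarith
    · simpa [lowCut] using h

theorem contDiff_annular {m : RN N → ℂ} (hm : HomSymbol m) : ContDiff ℝ (⊤ : ℕ∞)
    fun ξ : RN N => m ξ * ((lowCut ξ - lowCut ((2 : ℝ) • ξ) : ℝ) : ℂ) := by
  rw [contDiff_iff_contDiffAt]
  intro ξ
  have hc : ContDiff ℝ (⊤ : ℕ∞) fun ξ : RN N => ((lowCut ξ - lowCut ((2 : ℝ) • ξ) : ℝ) : ℂ) :=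
    Complex.ofRealCLM.contDiff.comp
      (lowCut.contDiff.sub (lowCut.contDiff.comp (contDiff_const_smul (2 : ℝ))))
  rcases eq_or_ne ξ 0 with rfl | h
  · refine (contDiffAt_const (c := (0 : ℂ))).congr_of_eventuallyEq ?_
    filter_upwards [ball_mem_nhds (0 : RN N) (show (0 : ℝ) < 2⁻¹ by norm_num)] with ξ hξ
    rw [lowCut_sub_eq_zero (Or.inl (mem_ball_zero_iff.1 hξ).le)]
    simp
  · exact (hm.smooth ξ h).mul hc.contDiffAt

theorem hasCompactSupport_annular (m : RN N → ℂ) : HasCompactSupport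
    fun ξ : RN N => m ξ * ((lowCut ξ - lowCut ((2 : ℝ) • ξ) : ℝ) : ℂ) :=
  hasCompactSupport_of_eq_zero (w := 0) (ρ := 2) fun ξ hξ => by
    rw [lowCut_sub_eq_zero (Or.inr (by simpa using hξ.le))]
    simp

section annular

variable {φ : RN N → ℝ} {m : RN N → ℂ}

theorem contDiff_fourier_smul (hφ : GoodPhi φ) (τ : ℝ) :
    ContDiff ℝ (⊤ : ℕ∞) fun ξ : RN N => 𝓕 (dilC φ 1) (τ • ξ) := by
  rw [hφ.fourier_eq_schwartz]
  exact ((𝓕 hφ.schwartz : SchwartzMap (RN N) ℂ).smooth _).comp (contDiff_const_smul τ)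

theorem contDiff_annSymbol (hφ : GoodPhi φ) (hm : HomSymbol m) (τ : ℝ) :
    ContDiff ℝ (⊤ : ℕ∞) (annSymbol m φ τ) :=
  (contDiff_annular hm).mul (contDiff_fourier_smul hφ τ)

theorem hasCompactSupport_annSymbol (m : RN N → ℂ) (φ : RN N → ℝ) (τ : ℝ) :
    HasCompactSupport (annSymbol m φ τ) :=
  (hasCompactSupport_annular m).mul_right

theorem annSymbol_eq_zero {τ : ℝ} {ξ : RN N} (h : ‖ξ‖ ≤ 2⁻¹ ∨ 2 ≤ ‖ξ‖) :
    annSymbol m φ τ ξ = 0 := by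
  rw [annSymbol, lowCut_sub_eq_zero h]
  simp

theorem exists_norm_iteratedFDeriv_annSymbol_le (hφ : GoodPhi φ) (hm : HomSymbol m) (n : ℕ) :
    ∃ c, 0 < c ∧ ∀ τ, 0 < τ → ∀ ξ, ∀ i ≤ n, ‖iteratedFDeriv ℝ i (annSymbol m φ τ) ξ‖ ≤
      (closedBall (0 : RN N) 2).indicator (fun _ => c) ξ := by
  obtain ⟨a, ha0, ha⟩ := exists_JB_of_hasCompactSupport (contDiff_annular hm)
    (hasCompactSupport_annular m) n
  choose d hd0 hd using fun i => (𝓕 hφ.schwartz : SchwartzMap (RN N) ℂ).decay i i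
  set D : ℝ := ∑ i ∈ Finset.range (n + 1), d i * 2 ^ i with hD
  have hDnn : 0 ≤ D := Finset.sum_nonneg fun i _ => by have := hd0 i; positivity
  refine ⟨2 ^ n * (a * D) + 1, by positivity, fun τ hτ ξ i hi => ?_⟩
  by_cases hout : 2 < ‖ξ‖
  · have : annSymbol m φ τ =ᶠ[𝓝 ξ] fun _ => 0 := by
      filter_upwards [(isOpen_lt continuous_const continuous_norm).mem_nhds hout] with η hη
      exact annSymbol_eq_zero (Or.inr (le_of_lt hη))
    rw [this.iteratedFDeriv ℝ i |>.eq_of_nhds]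
    simp [hout]
  have hin : ξ ∈ closedBall (0 : RN N) 2 := by simpa using not_lt.1 hout
  rw [indicator_of_mem hin]
  by_cases hsm : ‖ξ‖ < 2⁻¹
  · have : annSymbol m φ τ =ᶠ[𝓝 ξ] fun _ => 0 := by
      filter_upwards [(isOpen_lt continuous_norm continuous_const).mem_nhds hsm] with η hη
      exact annSymbol_eq_zero (Or.inl (le_of_lt hη))
    rw [this.iteratedFDeriv ℝ i |>.eq_of_nhds]
    simp
    positivity
  have hξ : 2⁻¹ ≤ ‖ξ‖ := not_lt.1 hsm
  have h2 : JB n 1 D (fun ξ : RN N => 𝓕 (dilC φ 1) (τ • ξ)) ξ := by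
    intro i hi
    rw [hφ.fourier_eq_schwartz,
      iteratedFDeriv_comp_const_smul τ ((𝓕 hφ.schwartz : SchwartzMap (RN N) ℂ).smooth i)]
    rw [norm_smul, norm_pow, Real.norm_of_nonneg hτ.le, one_pow, mul_one]
    have h3 := hd i (τ • ξ)
    rw [norm_smul, Real.norm_of_nonneg hτ.le, mul_pow] at h3
    have h4 : τ ^ i * ‖iteratedFDeriv ℝ i (𝓕 hφ.schwartz : SchwartzMap (RN N) ℂ) (τ • ξ)‖ ≤
        d i * 2 ^ i := by
      have : (1 : ℝ) ≤ ‖ξ‖ ^ i * 2 ^ i := by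
        rw [← mul_pow]
        exact one_le_pow₀ (by linarith)
      calc _ ≤ τ ^ i * ‖iteratedFDeriv ℝ i (𝓕 hφ.schwartz : SchwartzMap (RN N) ℂ) (τ • ξ)‖ *
            (‖ξ‖ ^ i * 2 ^ i) := le_mul_of_one_le_right (by positivity) this
        _ = τ ^ i * ‖ξ‖ ^ i *
            ‖iteratedFDeriv ℝ i (𝓕 hφ.schwartz : SchwartzMap (RN N) ℂ) (τ • ξ)‖ * 2 ^ i := by ring
        _ ≤ _ := by gcongr
    refine h4.trans ?_
    exact Finset.single_le_sum (f := fun i => d i * 2 ^ i)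
      (fun i _ => by have := hd0 i; positivity) (Finset.mem_range.2 (Nat.lt_succ_of_le hi))
  have h3 := JB.mul zero_le_one ((contDiff_annular hm).contDiffAt.of_le (by exact_mod_cast le_top))
    ((contDiff_fourier_smul hφ τ).contDiffAt.of_le (by exact_mod_cast le_top)) (ha ξ) h2 i hi
  rw [one_pow, mul_one] at h3
  have h4 : (fun y : RN N => m y * ((lowCut y - lowCut ((2 : ℝ) • y) : ℝ) : ℂ) *
    𝓕 (dilC φ 1) (τ • y)) = annSymbol m φ τ := rfl
  rw [h4] at h3
  linarith

theorem exists_pow_mul_norm_iteratedFDeriv_fourier_annSymbol_le (hφ : GoodPhi φ)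
    (hm : HomSymbol m) (n j : ℕ) : ∃ c, 0 < c ∧ ∀ τ, 0 < τ → ∀ y,
      ‖y‖ ^ n * ‖iteratedFDeriv ℝ j (𝓕 (annSymbol m φ τ)) y‖ ≤ c := by
  obtain ⟨c, hc0, hc⟩ := exists_norm_iteratedFDeriv_annSymbol_le hφ hm n
  set b : ℝ := ∑ p ∈ Finset.range (j + 1) ×ˢ Finset.range (n + 1),
    ∫ v, (closedBall (0 : RN N) 2).indicator (fun _ => 2 ^ p.1 * c) v
  have hb0 : 0 ≤ b := Finset.sum_nonneg fun p _ => integral_nonneg fun v =>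
    indicator_nonneg (fun _ _ => by positivity) _
  refine ⟨(2 * Real.pi) ^ j * (2 * j + 2) ^ n * b + 1, by positivity, fun τ hτ y => ?_⟩
  set g : SchwartzMap (RN N) ℂ :=
    (hasCompactSupport_annSymbol m φ τ).toSchwartzMap (contDiff_annSymbol hφ hm τ)
  have h := Real.pow_mul_norm_iteratedFDeriv_fourier_le (K := ⊤) (N := ⊤) (f := annSymbol m φ τ)
    (contDiff_annSymbol hφ hm τ) (fun k i _ _ => g.integrable_pow_mul_iteratedFDeriv volume k i)
    (k := j) (n := n) (by exact_mod_cast le_top) (by exact_mod_cast le_top) y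
  refine h.trans ?_
  have : ∑ p ∈ Finset.range (j + 1) ×ˢ Finset.range (n + 1),
      ∫ v, ‖v‖ ^ p.1 * ‖iteratedFDeriv ℝ p.2 (annSymbol m φ τ) v‖ ≤ b := by
    refine Finset.sum_le_sum fun p hp => ?_
    refine integral_mono_of_nonneg (Eventually.of_forall fun v => by positivity) ?_
      (Eventually.of_forall fun v => ?_)
    · exact (integrable_indicator_iff measurableSet_closedBall).2
        (integrableOn_const (measure_closedBall_lt_top.ne))
    · have h1 := hc τ hτ v p.2
        (Nat.lt_succ_iff.1 (Finset.mem_range.1 (Finset.mem_product.1 hp).2))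
      by_cases hv : v ∈ closedBall (0 : RN N) 2
      · simp only [hv, indicator_of_mem] at h1 ⊢
        have : ‖v‖ ≤ 2 := by simpa using hv
        gcongr
      · simp only [hv, not_false_eq_true, indicator_of_notMem] at h1 ⊢
        have := norm_nonneg (iteratedFDeriv ℝ p.2 (annSymbol m φ τ) v)
        rw [le_antisymm h1 this]
        simp
  have hp := Real.pi_pos
  calc _ ≤ (2 * Real.pi) ^ j * (2 * j + 2) ^ n * b := by gcongr
    _ ≤ _ := by linarith

theorem annSymbol_smul (hm : HomSymbol m) {t q : ℝ} (hq : 0 < q) (ξ : RN N) :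
    annSymbol m φ (t / q) (q • ξ) = m ξ * 𝓕 (dilC φ 1) (t • ξ) *
      ((lowCut (q • ξ) - lowCut ((2 * q) • ξ) : ℝ) : ℂ) := by
  rw [annSymbol, hm.hom q hq, smul_smul, smul_smul, div_mul_cancel₀ _ hq.ne']
  ring

theorem exists_JB_fourier_annSymbol_smul (hN0 : N ≠ 0) (hφ : GoodPhi φ) (hm : HomSymbol m)
    (J : ℕ) : ∃ c, 0 < c ∧ ∀ t, 0 < t → ∀ q, 0 < q → ∀ z : RN N, z ≠ 0 →
      JB J ‖z‖ (c * (‖z‖ ^ N)⁻¹ * min (‖z‖ / q) (q / ‖z‖))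
        (𝓕 fun ξ => annSymbol m φ (t / q) (q • ξ)) z := by
  choose c hc0 hc using
    fun n j => exists_pow_mul_norm_iteratedFDeriv_fourier_annSymbol_le hφ hm n j
  set C : ℝ := ∑ j ∈ Finset.range (J + 1), (c (N + j - 1) j + c (N + j + 1) j) with hC
  have hCpos : 0 < C := Finset.sum_pos (fun j _ => add_pos (hc0 _ _) (hc0 _ _)) (by simp)
  refine ⟨C, hCpos, fun t ht q hq z hz i hi => ?_⟩
  have hz0 : 0 < ‖z‖ := norm_pos_iff.2 hz
  have hCi : c (N + i - 1) i + c (N + i + 1) i ≤ C :=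
    Finset.single_le_sum (f := fun j => c (N + j - 1) j + c (N + j + 1) j)
      (fun j _ => (add_pos (hc0 _ _) (hc0 _ _)).le) (Finset.mem_range.2 (Nat.lt_succ_of_le hi))
  have h1 := hc0 (N + i - 1) i
  have h2 := hc0 (N + i + 1) i
  set G := 𝓕 (annSymbol m φ (t / q)) with hG
  have hGs : ContDiff ℝ (⊤ : ℕ∞) G := by
    set g : SchwartzMap (RN N) ℂ :=
      (hasCompactSupport_annSymbol m φ (t / q)).toSchwartzMap (contDiff_annSymbol hφ hm (t / q))
    exact (𝓕 g : SchwartzMap (RN N) ℂ).smooth _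
  have hF : (𝓕 fun ξ => annSymbol m φ (t / q) (q • ξ)) =
      fun z => ((q ^ N)⁻¹ : ℝ) • G (q⁻¹ • z) := by
    ext z
    exact fourier_comp_smul _ hq z
  have hsm : ContDiff ℝ i fun z => G (q⁻¹ • z) :=
    (hGs.comp (contDiff_const_smul q⁻¹)).of_le (by exact_mod_cast le_top)
  rw [hF, show (fun z => ((q ^ N)⁻¹ : ℝ) • G (q⁻¹ • z)) =
    ((q ^ N)⁻¹ : ℝ) • fun z => G (q⁻¹ • z) from rfl,
    iteratedFDeriv_const_smul_apply hsm.contDiffAt,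
    iteratedFDeriv_comp_const_smul q⁻¹ (hGs.of_le (by exact_mod_cast le_top)), norm_smul,
    norm_smul, norm_pow, Real.norm_of_nonneg (by positivity : 0 ≤ (q ^ N)⁻¹),
    Real.norm_of_nonneg (by positivity : 0 ≤ q⁻¹)]
  set p := ‖z‖ / q with hp
  have hp0 : 0 < p := by positivity
  have hy : ‖q⁻¹ • z‖ = p := by
    rw [norm_smul, Real.norm_of_nonneg (by positivity), hp, inv_mul_eq_div]
  set D := ‖iteratedFDeriv ℝ i G (q⁻¹ • z)‖ with hD
  have hD0 : 0 ≤ D := norm_nonneg _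
  have e1 := hc (N + i - 1) i (t / q) (by positivity) (q⁻¹ • z)
  have e2 := hc (N + i + 1) i (t / q) (by positivity) (q⁻¹ • z)
  rw [hy] at e1 e2
  have hkey : p ^ (N + i) * D ≤ C * min p (1 / p) := by
    rw [mul_min_of_nonneg _ _ hCpos.le]
    refine le_min ?_ ?_
    · obtain ⟨k, hk⟩ : ∃ k, N + i = k + 1 := ⟨N + i - 1, by omega⟩
      have : N + i - 1 = k := by omega
      rw [this] at e1 hCi h1
      rw [hk, pow_succ]
      calc p ^ k * p * D = (p ^ k * D) * p := by ring
        _ ≤ C * p := by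
          gcongr
          exact e1.trans (by linarith)
    · rw [mul_one_div, le_div_iff₀ hp0]
      calc p ^ (N + i) * D * p = p ^ (N + i + 1) * D := by ring
        _ ≤ C := e2.trans (by linarith)
  have hqp : q / ‖z‖ = 1 / p := by rw [hp, one_div_div]
  rw [hqp]
  have e3 : (q ^ N)⁻¹ * (q⁻¹ ^ i * D) * ‖z‖ ^ i = (‖z‖ ^ N)⁻¹ * (p ^ (N + i) * D) := by
    rw [hp, div_pow, pow_add, pow_add, inv_pow]
    field_simp
  calc _ = (‖z‖ ^ N)⁻¹ * (p ^ (N + i) * D) := e3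
    _ ≤ (‖z‖ ^ N)⁻¹ * (C * min p (1 / p)) := by gcongr
    _ = _ := by ring

theorem sum_lowCut_sub (K : ℕ) (ξ : RN N) :
    ∑ k ∈ Finset.range (2 * K), ((lowCut (((2 : ℝ) ^ k / 2 ^ K) • ξ) : ℝ) -
      lowCut ((2 * ((2 : ℝ) ^ k / 2 ^ K)) • ξ)) =
      lowCut (((2 : ℝ) ^ K)⁻¹ • ξ) - lowCut ((2 : ℝ) ^ K • ξ) := by
  have h := Finset.sum_range_sub' (fun k => (lowCut (((2 : ℝ) ^ k / 2 ^ K) • ξ) : ℝ)) (2 * K)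
  have e1 : (2 : ℝ) ^ 0 / 2 ^ K = (2 ^ K)⁻¹ := by rw [pow_zero, one_div]
  have e2 : (2 : ℝ) ^ (2 * K) / 2 ^ K = 2 ^ K := by rw [two_mul, pow_add]; field_simp
  simp only [e1, e2] at h
  rw [← h]
  refine Finset.sum_congr rfl fun k _ => ?_
  rw [pow_succ]
  congr 3
  ring

/-- The part of frequency space not covered by the first dyadic annuli. -/
def cutRem (K : ℕ) (ξ : RN N) : ℝ :=
  1 - (lowCut (((2 : ℝ) ^ K)⁻¹ • ξ) - lowCut ((2 : ℝ) ^ K • ξ))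

theorem continuous_cutRem (K : ℕ) : Continuous (cutRem (N := N) K) :=
  continuous_const.sub ((lowCut.continuous.comp (continuous_const_smul _)).sub
    (lowCut.continuous.comp (continuous_const_smul _)))

theorem abs_cutRem_le (K : ℕ) (ξ : RN N) : |cutRem K ξ| ≤ 2 := by
  have h1 := lowCut.nonneg (x := ((2 : ℝ) ^ K)⁻¹ • ξ)
  have h2 := lowCut.le_one (x := ((2 : ℝ) ^ K)⁻¹ • ξ)
  have h3 := lowCut.nonneg (x := (2 : ℝ) ^ K • ξ)
  have h4 := lowCut.le_one (x := (2 : ℝ) ^ K • ξ)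
  rw [cutRem, abs_le]
  constructor <;> linarith

theorem eventually_cutRem_eq_zero {ξ : RN N} (hξ : ξ ≠ 0) : ∀ᶠ K in atTop, cutRem K ξ = 0 := by
  have h0 : 0 < ‖ξ‖ := norm_pos_iff.2 hξ
  have h2 : Tendsto (fun K : ℕ => (2 : ℝ) ^ K) atTop atTop :=
    tendsto_pow_atTop_atTop_of_one_lt one_lt_two
  filter_upwards [h2.eventually_ge_atTop ‖ξ‖, h2.eventually_ge_atTop (2 / ‖ξ‖)] with K h3 h4
  have hK : (0 : ℝ) < 2 ^ K := by positivity
  rw [cutRem, ContDiffBump.one_of_mem_closedBall, ContDiffBump.zero_of_le_dist]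
  · norm_num
  · rw [dist_zero_right, norm_smul, Real.norm_of_nonneg hK.le]
    rwa [div_le_iff₀ h0] at h4
  · rw [mem_closedBall_zero_iff, norm_smul, Real.norm_of_nonneg (by positivity)]
    show (2 ^ K)⁻¹ * ‖ξ‖ ≤ 1
    rwa [inv_mul_le_iff₀ hK, mul_one]

theorem mulKer_eq_sum_add (hN0 : N ≠ 0) (hφ : GoodPhi φ) (hm : HomSymbol m) {t : ℝ} (ht : 0 < t)
    (K : ℕ) : mulKer m φ t = fun z =>
      (∑ k ∈ Finset.range (2 * K), 𝓕 (fun ξ =>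
        annSymbol m φ (t / ((2 : ℝ) ^ k / 2 ^ K)) (((2 : ℝ) ^ k / 2 ^ K) • ξ)) z) +
      𝓕 (fun ξ => m ξ * 𝓕 (dilC φ 1) (t • ξ) * (cutRem K ξ : ℂ)) z := by
  obtain ⟨b, -, hb⟩ := hm.exists_bound
  have hw : Integrable fun ξ => m ξ * 𝓕 (dilC φ 1) (t • ξ) := by
    have := integrable_pow_mul_symbol hφ (hm.aestronglyMeasurable hN0) hb ht 0
    simp only [pow_zero, one_mul] at this
    refine (integrable_norm_iff ?_).1 this
    exact (hm.aestronglyMeasurable hN0).mul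
      ((continuous_fourier_dilC hφ).comp (continuous_const_smul t)).aestronglyMeasurable
  have hrem : Integrable fun ξ => m ξ * 𝓕 (dilC φ 1) (t • ξ) * (cutRem K ξ : ℂ) := by
    refine hw.mul_bdd (c := 2)
      (Complex.continuous_ofReal.comp (continuous_cutRem K)).aestronglyMeasurable
      (Eventually.of_forall fun ξ => ?_)
    rw [Complex.norm_real]
    exact abs_cutRem_le K ξ
  have hpiece : ∀ k ∈ Finset.range (2 * K), Integrable fun ξ =>
      annSymbol m φ (t / ((2 : ℝ) ^ k / 2 ^ K)) (((2 : ℝ) ^ k / 2 ^ K) • ξ) := fun k _ =>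
    ((contDiff_annSymbol hφ hm _).continuous.integrable_of_hasCompactSupport
      (hasCompactSupport_annSymbol m φ _)).comp_smul (by positivity)
  ext z
  simp only [mulKer, Real.fourier_eq]
  rw [← integral_finsetSum, ← integral_add]
  · refine integral_congr_ae (Eventually.of_forall fun ξ => ?_)
    simp only
    rw [← Finset.smul_sum, ← smul_add]
    congr 1
    simp only [← Real.fourier_eq]
    have h1 : ∀ k ∈ Finset.range (2 * K),
        annSymbol m φ (t / ((2 : ℝ) ^ k / 2 ^ K)) (((2 : ℝ) ^ k / 2 ^ K) • ξ) =
        m ξ * 𝓕 (dilC φ 1) (t • ξ) * ((lowCut (((2 : ℝ) ^ k / 2 ^ K) • ξ) -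
          lowCut ((2 * ((2 : ℝ) ^ k / 2 ^ K)) • ξ) : ℝ) : ℂ) := fun k _ =>
      annSymbol_smul hm (by positivity) ξ
    rw [Finset.sum_congr rfl h1, ← Finset.mul_sum, ← Complex.ofReal_sum, sum_lowCut_sub, cutRem]
    push_cast
    ring
  · exact integrable_finsetSum _ fun k hk =>
      (Real.fourierIntegral_convergent_iff z).2 (hpiece k hk)
  · exact (Real.fourierIntegral_convergent_iff z).2 hrem
  · exact fun k hk => (Real.fourierIntegral_convergent_iff z).2 (hpiece k hk)

/-- Calderón–Zygmund estimates for the kernels, uniform in the mollification. -/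
theorem exists_JB_mulKer (hN0 : N ≠ 0) (hφ : GoodPhi φ) (hm : HomSymbol m) (J : ℕ) :
    ∃ C, 0 < C ∧ ∀ t, 0 < t → ∀ z : RN N, z ≠ 0 →
      JB J ‖z‖ (C * (‖z‖ ^ N)⁻¹) (mulKer m φ t) z := by
  obtain ⟨c, hc0, hc⟩ := exists_JB_fourier_annSymbol_smul (φ := φ) hN0 hφ hm J
  obtain ⟨b, hb0, hb⟩ := hm.exists_bound
  refine ⟨5 * c, by positivity, fun t ht z hz i hi => ?_⟩
  have hz0 : 0 < ‖z‖ := norm_pos_iff.2 hz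
  have hmeas : ∀ K, AEStronglyMeasurable
      (fun ξ => m ξ * 𝓕 (dilC φ 1) (t • ξ) * (cutRem K ξ : ℂ)) := fun K =>
    ((hm.aestronglyMeasurable hN0).mul
      ((continuous_fourier_dilC hφ).comp (continuous_const_smul t)).aestronglyMeasurable).mul
      (Complex.continuous_ofReal.comp (continuous_cutRem K)).aestronglyMeasurable
  have hint := integrable_pow_mul_symbol hφ (hm.aestronglyMeasurable hN0) hb ht
  have hbd : ∀ K n (ξ : RN N), ‖ξ‖ ^ n * ‖m ξ * 𝓕 (dilC φ 1) (t • ξ) * (cutRem K ξ : ℂ)‖ ≤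
      2 * (‖ξ‖ ^ n * ‖m ξ * 𝓕 (dilC φ 1) (t • ξ)‖) := by
    intro K n ξ
    rw [norm_mul _ (cutRem K ξ : ℂ), Complex.norm_real, Real.norm_eq_abs, ← mul_assoc, mul_comm]
    gcongr
    exact abs_cutRem_le K ξ
  have hrem : ∀ K n, Integrable fun ξ : RN N =>
      ‖ξ‖ ^ n * ‖m ξ * 𝓕 (dilC φ 1) (t • ξ) * (cutRem K ξ : ℂ)‖ := fun K n =>
    ((hint n).const_mul 2).mono'
      ((continuous_norm.pow n).aestronglyMeasurable.mul (hmeas K).norm)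
      (Eventually.of_forall fun ξ => by
        rw [Real.norm_of_nonneg (by positivity)]
        exact hbd K n ξ)
  have hpc : ∀ K k, ContDiff ℝ (⊤ : ℕ∞) (𝓕 (fun ξ =>
      annSymbol m φ (t / ((2 : ℝ) ^ k / 2 ^ K)) (((2 : ℝ) ^ k / 2 ^ K) • ξ))) := by
    intro K k
    have hcs : HasCompactSupport fun ξ =>
        annSymbol m φ (t / ((2 : ℝ) ^ k / 2 ^ K)) (((2 : ℝ) ^ k / 2 ^ K) • ξ) :=
      (hasCompactSupport_annSymbol m φ _).comp_homeomorph (Homeomorph.smulOfNeZero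
        ((2 : ℝ) ^ k / 2 ^ K) (by positivity))
    exact (𝓕 (hcs.toSchwartzMap ((contDiff_annSymbol hφ hm _).comp (contDiff_const_smul _))) :
      SchwartzMap (RN N) ℂ).smooth _
  have hrc : ∀ K, ContDiff ℝ (⊤ : ℕ∞)
      (𝓕 (fun ξ => m ξ * 𝓕 (dilC φ 1) (t • ξ) * (cutRem K ξ : ℂ))) := fun K =>
    Real.contDiff_fourier fun n _ => hrem K n
  have hK : ∀ K : ℕ, ‖iteratedFDeriv ℝ i (mulKer m φ t) z‖ * ‖z‖ ^ i ≤ 5 * c * (‖z‖ ^ N)⁻¹ +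
      (2 * Real.pi) ^ i * (∫ ξ, ‖ξ‖ ^ i *
        ‖m ξ * 𝓕 (dilC φ 1) (t • ξ) * (cutRem K ξ : ℂ)‖) * ‖z‖ ^ i := by
    intro K
    have e0 : iteratedFDeriv ℝ i (mulKer m φ t) z = (∑ k ∈ Finset.range (2 * K), iteratedFDeriv ℝ i
        (𝓕 (fun ξ => annSymbol m φ (t / ((2 : ℝ) ^ k / 2 ^ K)) (((2 : ℝ) ^ k / 2 ^ K) • ξ))) z) +
        iteratedFDeriv ℝ i
          (𝓕 (fun ξ => m ξ * 𝓕 (dilC φ 1) (t • ξ) * (cutRem K ξ : ℂ))) z := by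
      have hs : ContDiff ℝ i fun z => ∑ k ∈ Finset.range (2 * K), 𝓕 (fun ξ =>
          annSymbol m φ (t / ((2 : ℝ) ^ k / 2 ^ K)) (((2 : ℝ) ^ k / 2 ^ K) • ξ)) z :=
        ContDiff.sum fun k _ => (hpc K k).of_le (by exact_mod_cast le_top)
      rw [mulKer_eq_sum_add hN0 hφ hm ht K, fun_iteratedFDeriv_add_apply hs.contDiffAt
        ((hrc K).of_le (by exact_mod_cast le_top)).contDiffAt,
        iteratedFDeriv_sum fun k _ => (hpc K k).of_le (by exact_mod_cast le_top)]
      simp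
    rw [e0]
    have e1 : ∀ k ∈ Finset.range (2 * K), ‖iteratedFDeriv ℝ i (𝓕 (fun ξ =>
        annSymbol m φ (t / ((2 : ℝ) ^ k / 2 ^ K)) (((2 : ℝ) ^ k / 2 ^ K) • ξ))) z‖ * ‖z‖ ^ i ≤
        c * (‖z‖ ^ N)⁻¹ * min (‖z‖ * 2 ^ K / 2 ^ k) (2 ^ k / (‖z‖ * 2 ^ K)) := by
      intro k _
      refine (hc t ht ((2 : ℝ) ^ k / 2 ^ K) (by positivity) z hz i hi).trans (le_of_eq ?_)
      congr 2 <;> field_simp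
    have e2 := norm_iteratedFDeriv_fourier_le (hrem K) (hmeas K) i z
    refine (mul_le_mul_of_nonneg_right (norm_add_le _ _) (by positivity)).trans ?_
    rw [add_mul]
    refine add_le_add ?_ (mul_le_mul_of_nonneg_right e2 (by positivity))
    refine (mul_le_mul_of_nonneg_right (norm_sum_le _ _) (by positivity)).trans ?_
    rw [Finset.sum_mul]
    refine (Finset.sum_le_sum e1).trans ?_
    rw [← Finset.mul_sum]
    calc _ ≤ c * (‖z‖ ^ N)⁻¹ * 5 := by
          gcongr
          exact sum_min_pow_le_five _ (by positivity)
      _ = _ := by ring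
  have hlim : Tendsto (fun K : ℕ => ∫ ξ : RN N, ‖ξ‖ ^ i *
      ‖m ξ * 𝓕 (dilC φ 1) (t • ξ) * (cutRem K ξ : ℂ)‖) atTop (𝓝 0) := by
    rw [← integral_zero (RN N) ℝ]
    refine tendsto_integral_of_dominated_convergence _ (fun K => (hrem K i).aestronglyMeasurable)
      ((hint i).const_mul 2) (fun K => Eventually.of_forall fun ξ => ?_) ?_
    · rw [Real.norm_of_nonneg (by positivity)]
      exact hbd K i ξ
    · have : Nonempty (Fin N) := ⟨⟨0, Nat.pos_of_ne_zero hN0⟩⟩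
      have h0 : ∀ᵐ ξ : RN N, ξ ≠ 0 := by simp [ae_iff]
      filter_upwards [h0] with ξ hξ
      refine tendsto_const_nhds.congr' ?_
      filter_upwards [eventually_cutRem_eq_zero hξ] with K hK
      simp [hK]
  have hlim2 := ((hlim.const_mul ((2 * Real.pi) ^ i)).mul_const (‖z‖ ^ i)).const_add
    (5 * c * (‖z‖ ^ N)⁻¹)
  rw [mul_zero, zero_mul, add_zero] at hlim2
  exact ge_of_tendsto hlim2 (Eventually.of_forall hK)

end annular

/-! ### The `L²` theory of the maximal operator of a multiplier -/

open scoped FourierTransform RealInnerProductSpace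

/-- The maximal operator attached to the mollified kernels of a multiplier. -/
def kerMax (m : RN N → ℂ) (φ : RN N → ℝ) (g : RN N → ℂ) (x : RN N) : ℝ≥0∞ :=
  ⨆ t ∈ Ioi (0 : ℝ), ‖∫ y, g y * mulKer m φ t (x - y)‖ₑ

theorem fourier_comp_const_sub (g : RN N → ℂ) (x ξ : RN N) :
    𝓕 (fun y => g (x - y)) ξ = 𝐞 (-inner ℝ x ξ) • 𝓕 g (-ξ) := by
  rw [Real.fourier_eq, Real.fourier_eq, ← integral_sub_left_eq_self _ volume x]
  have : ∀ y, 𝐞 (-inner ℝ (x - y) ξ) • g (x - (x - y)) =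
      𝐞 (-inner ℝ x ξ) • (𝐞 (-inner ℝ y (-ξ)) • g y) := fun y => by
    rw [smul_smul, ← AddChar.map_add_eq_mul, sub_sub_cancel]
    congr 2
    rw [inner_sub_left, inner_neg_right]
    ring
  simp only [this]
  simp only [Circle.smul_def, smul_eq_mul]
  rw [integral_const_mul]

theorem integral_comp_sub_mul_fourier {g h : RN N → ℂ} (hg : Integrable g) (hh : Integrable h)
    (x : RN N) : ∫ y, g (x - y) * 𝓕 h y = 𝓕 (fun ξ => h ξ * 𝓕 g (-ξ)) x := by
  have h1 := VectorFourier.integral_fourierIntegral_smul_eq_flip (μ := volume) (ν := volume)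
    (L := innerₗ (RN N)) Real.continuous_fourierChar continuous_inner hh (hg.comp_sub_left x)
  have h2 : ∫ ξ, 𝓕 h ξ • g (x - ξ) = ∫ ξ, h ξ • 𝓕 (fun y => g (x - y)) ξ := by
    rw [flip_innerₗ] at h1
    exact h1
  simp only [smul_eq_mul, fourier_comp_const_sub] at h2
  rw [Real.fourier_eq]
  calc _ = ∫ ξ, 𝓕 h ξ * g (x - ξ) := by simp only [mul_comm]
    _ = _ := h2
    _ = _ := by
      refine integral_congr_ae (Eventually.of_forall fun ξ => ?_)
      simp only [Circle.smul_def, smul_eq_mul]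
      rw [real_inner_comm]
      ring

theorem continuous_fourier_of_integrable {h : RN N → ℂ} (hh : Integrable h) :
    Continuous (𝓕 h) :=
  VectorFourier.fourierIntegral_continuous Real.continuous_fourierChar continuous_inner hh

theorem norm_fourier_le (h : RN N → ℂ) (x : RN N) : ‖𝓕 h x‖ ≤ ∫ ξ, ‖h ξ‖ :=
  VectorFourier.norm_fourierIntegral_le_integral_norm _ _ _ _ _

theorem lintegral_enorm_sq_fourier (S : SchwartzMap (RN N) ℂ) :
    ∫⁻ x, ‖(𝓕 S : SchwartzMap (RN N) ℂ) x‖ₑ ^ (2 : ℝ) = ∫⁻ x, ‖S x‖ₑ ^ (2 : ℝ) := by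
  have key : ∀ S : SchwartzMap (RN N) ℂ,
      ∫⁻ x, ‖S x‖ₑ ^ (2 : ℝ) = ENNReal.ofReal (∫ x, ‖S x‖ ^ 2) := fun S => by
    rw [ofReal_integral_eq_lintegral_ofReal ((S.memLp 2 volume).integrable_norm_pow two_ne_zero)
      (Eventually.of_forall fun x => by positivity)]
    refine lintegral_congr fun x => ?_
    rw [ENNReal.ofReal_pow (norm_nonneg _), ofReal_norm]
    norm_cast
  rw [key, key, SchwartzMap.integral_norm_sq_fourier]

section L2

variable {φ : RN N → ℝ} {m : RN N → ℂ}

theorem cutRem_eq_one {K : ℕ} {ξ : RN N} (h : ‖ξ‖ < (2 ^ K)⁻¹ ∨ 2 * 2 ^ K < ‖ξ‖) :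
    cutRem K ξ = 1 := by
  have hK : (1 : ℝ) ≤ 2 ^ K := one_le_pow₀ one_le_two
  have hK0 : (0 : ℝ) < 2 ^ K := by positivity
  have hKi : ((2 : ℝ) ^ K)⁻¹ ≤ 1 := inv_le_one_of_one_le₀ hK
  rcases h with h | h
  · rw [cutRem, ContDiffBump.one_of_mem_closedBall, ContDiffBump.one_of_mem_closedBall]
    · norm_num
    · rw [mem_closedBall_zero_iff, norm_smul, Real.norm_of_nonneg hK0.le]
      show 2 ^ K * ‖ξ‖ ≤ 1
      calc _ ≤ 2 ^ K * ((2 : ℝ) ^ K)⁻¹ := by gcongr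
        _ = 1 := mul_inv_cancel₀ hK0.ne'
    · rw [mem_closedBall_zero_iff, norm_smul, Real.norm_of_nonneg (by positivity)]
      show (2 ^ K)⁻¹ * ‖ξ‖ ≤ 1
      exact mul_le_one₀ hKi (norm_nonneg _) (h.le.trans hKi)
  · rw [cutRem, ContDiffBump.zero_of_le_dist, ContDiffBump.zero_of_le_dist]
    · norm_num
    · rw [dist_zero_right, norm_smul, Real.norm_of_nonneg hK0.le]
      show 2 ≤ 2 ^ K * ‖ξ‖
      nlinarith
    · rw [dist_zero_right, norm_smul, Real.norm_of_nonneg (by positivity)]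
      show 2 ≤ (2 ^ K)⁻¹ * ‖ξ‖
      rw [inv_mul_eq_div, le_div_iff₀ hK0]
      linarith

theorem contDiff_cutRem (K : ℕ) : ContDiff ℝ (⊤ : ℕ∞) (cutRem (N := N) K) :=
  contDiff_const.sub ((lowCut.contDiff.comp (contDiff_const_smul _)).sub
    (lowCut.contDiff.comp (contDiff_const_smul _)))

theorem HomSymbol.contDiff_cut (hm : HomSymbol m) {G : RN N → ℂ} (hG : ContDiff ℝ (⊤ : ℕ∞) G)
    (K : ℕ) : ContDiff ℝ (⊤ : ℕ∞) fun ξ => ((1 - cutRem K ξ : ℝ) : ℂ) * (m ξ * G ξ) := by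
  rw [contDiff_iff_contDiffAt]
  intro ξ
  rcases eq_or_ne ξ 0 with rfl | h
  · refine (contDiffAt_const (c := (0 : ℂ))).congr_of_eventuallyEq ?_
    filter_upwards [ball_mem_nhds (0 : RN N) (show (0 : ℝ) < (2 ^ K)⁻¹ by positivity)] with ξ hξ
    rw [cutRem_eq_one (Or.inl (mem_ball_zero_iff.1 hξ))]
    simp
  · have : ContDiff ℝ (⊤ : ℕ∞) fun ξ : RN N => ((1 - cutRem K ξ : ℝ) : ℂ) :=
      Complex.ofRealCLM.contDiff.comp (contDiff_const.sub (contDiff_cutRem K))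
    exact this.contDiffAt.mul ((hm.smooth ξ h).mul hG.contDiffAt)

theorem HomSymbol.hasCompactSupport_cut (m G : RN N → ℂ) (K : ℕ) :
    HasCompactSupport fun ξ => ((1 - cutRem K ξ : ℝ) : ℂ) * (m ξ * G ξ) :=
  hasCompactSupport_of_eq_zero (w := 0) (ρ := 2 * 2 ^ K) fun ξ hξ => by
    rw [cutRem_eq_one (Or.inr (by simpa using hξ))]
    simp

theorem HomSymbol.lintegral_fourier_sq_le (hN0 : N ≠ 0) (hm : HomSymbol m) {b : ℝ}
    (hb : ∀ ξ, ‖m ξ‖ ≤ b) {G : RN N → ℂ} (hG : ContDiff ℝ (⊤ : ℕ∞) G) (hGi : Integrable G) :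
    ∫⁻ x, ‖𝓕 (fun ξ => m ξ * G ξ) x‖ₑ ^ (2 : ℝ) ≤
      ENNReal.ofReal (2 * b) ^ (2 : ℝ) * ∫⁻ ξ, ‖G ξ‖ₑ ^ (2 : ℝ) := by
  set H : ℕ → SchwartzMap (RN N) ℂ := fun K =>
    (HomSymbol.hasCompactSupport_cut m G K).toSchwartzMap (hm.contDiff_cut hG K) with hH
  have hHv : ∀ K ξ, H K ξ = ((1 - cutRem K ξ : ℝ) : ℂ) * (m ξ * G ξ) := fun K ξ => rfl
  have hb0 : 0 ≤ b := (norm_nonneg _).trans (hb 0)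
  have hcb : ∀ (K : ℕ) (ξ : RN N), |1 - cutRem K ξ| ≤ 2 := fun K ξ => by
    have h1 := lowCut.nonneg (x := ((2 : ℝ) ^ K)⁻¹ • ξ)
    have h2 := lowCut.le_one (x := ((2 : ℝ) ^ K)⁻¹ • ξ)
    have h3 := lowCut.nonneg (x := (2 : ℝ) ^ K • ξ)
    have h4 := lowCut.le_one (x := (2 : ℝ) ^ K • ξ)
    rw [cutRem, abs_le]
    constructor <;> linarith
  have hbd : ∀ K ξ, ‖H K ξ‖ ≤ 2 * b * ‖G ξ‖ := fun K ξ => by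
    rw [hHv, norm_mul, norm_mul, Complex.norm_real, Real.norm_eq_abs, mul_assoc]
    have := hcb K ξ
    have := hb ξ
    gcongr
  have : Nonempty (Fin N) := ⟨⟨0, Nat.pos_of_ne_zero hN0⟩⟩
  have h0 : ∀ᵐ ξ : RN N, ξ ≠ 0 := by simp [ae_iff]
  have hlim : ∀ x, Tendsto (fun K => (𝓕 (H K) : SchwartzMap (RN N) ℂ) x) atTop
      (𝓝 (𝓕 (fun ξ => m ξ * G ξ) x)) := by
    intro x
    have e : ∀ K, (𝓕 (H K) : SchwartzMap (RN N) ℂ) x = ∫ v, 𝐞 (-inner ℝ v x) • H K v :=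
      fun K => by rw [SchwartzMap.fourier_coe, Real.fourier_eq]
    simp only [e]
    rw [Real.fourier_eq]
    refine tendsto_integral_of_dominated_convergence (fun ξ => 2 * b * ‖G ξ‖)
      (fun K => ?_) (hGi.norm.const_mul _) (fun K => Eventually.of_forall fun ξ => ?_) ?_
    · exact ((Real.fourierIntegral_convergent_iff x).2 (H K).integrable).aestronglyMeasurable
    · rw [Circle.norm_smul]
      exact hbd K ξ
    · filter_upwards [h0] with ξ hξ
      refine tendsto_const_nhds.congr' ?_
      filter_upwards [eventually_cutRem_eq_zero hξ] with K hK
      simp [hHv, hK]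
  calc ∫⁻ x, ‖𝓕 (fun ξ => m ξ * G ξ) x‖ₑ ^ (2 : ℝ)
      = ∫⁻ x, liminf (fun K => ‖(𝓕 (H K) : SchwartzMap (RN N) ℂ) x‖ₑ ^ (2 : ℝ)) atTop := by
        refine lintegral_congr fun x => ?_
        exact (((ENNReal.continuous_rpow_const.tendsto _).comp
          ((continuous_enorm.tendsto _).comp (hlim x))).liminf_eq).symm
    _ ≤ liminf (fun K => ∫⁻ x, ‖(𝓕 (H K) : SchwartzMap (RN N) ℂ) x‖ₑ ^ (2 : ℝ)) atTop :=
        lintegral_liminf_le fun K => ((SchwartzMap.continuous _).enorm.measurable.pow_const _)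
    _ ≤ liminf (fun _ : ℕ => ENNReal.ofReal (2 * b) ^ (2 : ℝ) * ∫⁻ ξ, ‖G ξ‖ₑ ^ (2 : ℝ)) atTop := by
        refine liminf_le_liminf (Eventually.of_forall fun K => ?_)
        rw [lintegral_enorm_sq_fourier, ← lintegral_const_mul _
          (hG.continuous.enorm.measurable.pow_const _)]
        refine lintegral_mono fun ξ => ?_
        rw [← ENNReal.mul_rpow_of_nonneg _ _ (by norm_num)]
        refine ENNReal.rpow_le_rpow ?_ (by norm_num)
        rw [← ofReal_norm, ← ofReal_norm, ← ENNReal.ofReal_mul (by positivity)]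
        exact ENNReal.ofReal_le_ofReal (hbd K ξ)
    _ = _ := liminf_const _

theorem GoodPhi.exists_enorm_convAt_le_hlMax (hφ : GoodPhi φ) : ∃ C : ℝ≥0∞, C ≠ ⊤ ∧
    ∀ (W : RN N → ℂ) (x : RN N), ∀ t, 0 < t →
      ‖convAt φ t W x‖ₑ ≤ C * hlMax (fun y => ‖W y‖ₑ) x := by
  obtain ⟨c, hc0, hc⟩ := hφ.exists_JB_dil 0
  refine ⟨ENNReal.ofReal c * ENNReal.ofReal (2 ^ N) * volume (ball (0 : RN N) 1),
    ENNReal.mul_ne_top (by finiteness) measure_ball_lt_top.ne, fun W x t ht => ?_⟩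
  have hpt : ∀ y, ‖dil φ t (x - y) • W y‖ₑ ≤
      (ball x (2 * t)).indicator (fun y => ENNReal.ofReal (c * (t ^ N)⁻¹) * ‖W y‖ₑ) y := by
    intro y
    by_cases hy : y ∈ ball x (2 * t)
    · rw [indicator_of_mem hy, enorm_smul]
      gcongr
      rw [← ofReal_norm]
      refine ENNReal.ofReal_le_ofReal ?_
      have := (hc t ht (x - y)).norm_le
      simpa [dilC] using this
    · rw [hφ.dil_eq_zero ht, zero_smul]
      · simp
      · rw [mem_ball', dist_eq_norm, not_lt] at hy
        linarith
  unfold convAt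
  calc _ ≤ ∫⁻ y, ‖dil φ t (x - y) • W y‖ₑ := enorm_integral_le_lintegral_enorm _
    _ ≤ ∫⁻ y, (ball x (2 * t)).indicator
        (fun y => ENNReal.ofReal (c * (t ^ N)⁻¹) * ‖W y‖ₑ) y := lintegral_mono hpt
    _ = ENNReal.ofReal (c * (t ^ N)⁻¹) * ∫⁻ y in ball x (2 * t), ‖W y‖ₑ := by
      rw [lintegral_indicator measurableSet_ball, lintegral_const_mul' _ _ ENNReal.ofReal_ne_top]
    _ ≤ ENNReal.ofReal (c * (t ^ N)⁻¹) *
        (volume (ball (0 : RN N) (2 * t)) * hlMax (fun y => ‖W y‖ₑ) x) := by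
      gcongr
      exact lintegral_ball_le_hlMax _ x (by positivity)
    _ = _ := by
      rw [volume_ball_zero_eq (by positivity), ← mul_assoc, ← mul_assoc]
      congr 2
      rw [← ENNReal.ofReal_mul (by positivity), ← ENNReal.ofReal_mul (by positivity)]
      congr 1
      rw [mul_pow]
      field_simp

theorem HomSymbol.integrable_mul_fourier (hN0 : N ≠ 0) (hφ : GoodPhi φ) (hm : HomSymbol m)
    {t : ℝ} (ht : 0 < t) : Integrable fun ξ => m ξ * 𝓕 (dilC φ 1) (t • ξ) := by
  obtain ⟨b, -, hb⟩ := hm.exists_bound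
  have := integrable_pow_mul_symbol hφ (hm.aestronglyMeasurable hN0) hb ht 0
  simp only [pow_zero, one_mul] at this
  refine (integrable_norm_iff ?_).1 this
  exact (hm.aestronglyMeasurable hN0).mul
    ((continuous_fourier_dilC hφ).comp (continuous_const_smul t)).aestronglyMeasurable

theorem GoodPhi.fourier_dilC_neg (hφ : GoodPhi φ) (t : ℝ) (ξ : RN N) :
    𝓕 (dilC φ t) (-ξ) = 𝓕 (dilC φ t) ξ := by
  have h := fourier_comp_const_sub (dilC φ t) 0 (-ξ)
  simp only [zero_sub, inner_zero_left, neg_zero, AddChar.map_zero_eq_one, one_smul, neg_neg] at h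
  have e : (fun y => dilC φ t (-y)) = dilC φ t := by
    ext y
    simp only [dilC, hφ.dil_neg]
  rw [← h, e]

/-- The convolution with a mollified kernel is a mollification of the multiplier transform. -/
theorem HomSymbol.integral_mul_mulKer (hN0 : N ≠ 0) (hφ : GoodPhi φ) (hm : HomSymbol m)
    {g : RN N → ℂ} (hg : ContDiff ℝ (⊤ : ℕ∞) g) (hgc : HasCompactSupport g) {t : ℝ} (ht : 0 < t)
    (x : RN N) : ∫ y, g y * mulKer m φ t (x - y) =
      convAt φ t (𝓕 fun ξ => m ξ * 𝓕 g (-ξ)) x := by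
  have hgi := hg.continuous.integrable_of_hasCompactSupport (μ := volume) hgc
  have hGi : Integrable (𝓕 g) :=
    (𝓕 (hgc.toSchwartzMap hg) : SchwartzMap (RN N) ℂ).integrable
  obtain ⟨b, -, hb⟩ := hm.exists_bound
  have h1 := integral_comp_sub_mul_fourier hgi (hm.integrable_mul_fourier hN0 hφ ht) x
  have h2 := integral_comp_sub_mul_fourier (x := x)
    ((hφ.contDiff_dilC t).continuous.integrable_of_hasCompactSupport (μ := volume)
      (hφ.hasCompactSupport_dilC ht))
    (hGi.comp_neg.bdd_mul (hm.aestronglyMeasurable hN0) (Eventually.of_forall hb))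
  have e1 : ∫ y, g y * mulKer m φ t (x - y) = ∫ y, g (x - y) * mulKer m φ t y := by
    rw [← integral_sub_left_eq_self _ volume x]
    simp
  rw [e1, mulKer, h1]
  have e2 : ∀ W : RN N → ℂ, convAt φ t W x = ∫ y, dilC φ t (x - y) * W y := fun W => by
    simp only [convAt, dilC, Complex.real_smul]
  rw [e2, h2]
  refine congrArg (fun h : RN N → ℂ => (𝓕 h : RN N → ℂ) x) (funext fun ξ => ?_)
  rw [hφ.fourier_dilC_neg, fourier_dilC φ ht]
  ring

/-- The maximal operator is dominated by the maximal function of the multiplier transform. -/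
theorem HomSymbol.exists_kerMax_le (hN0 : N ≠ 0) (hφ : GoodPhi φ) (hm : HomSymbol m) :
    ∃ C : ℝ≥0∞, C ≠ ⊤ ∧ ∀ g : RN N → ℂ, ContDiff ℝ (⊤ : ℕ∞) g → HasCompactSupport g →
      ∃ W : RN N → ℂ, Continuous W ∧ (∃ c : ℝ, ∀ x, ‖W x‖ ≤ c) ∧
        (∀ x, kerMax m φ g x ≤ C * hlMax (fun y => ‖W y‖ₑ) x) ∧
        ∫⁻ x, ‖W x‖ₑ ^ (2 : ℝ) ≤ C * ∫⁻ x, ‖g x‖ₑ ^ (2 : ℝ) := by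
  obtain ⟨b, -, hb⟩ := hm.exists_bound
  obtain ⟨C, hC, h⟩ := hφ.exists_enorm_convAt_le_hlMax
  refine ⟨C + ENNReal.ofReal (2 * b) ^ (2 : ℝ), ?_, fun g hg hgc => ?_⟩
  · have : ENNReal.ofReal (2 * b) ^ (2 : ℝ) ≠ ⊤ :=
      ENNReal.rpow_ne_top_of_nonneg (by norm_num) ENNReal.ofReal_ne_top
    finiteness
  set S := hgc.toSchwartzMap hg with hS
  have hGi : Integrable (𝓕 g) := (𝓕 S : SchwartzMap (RN N) ℂ).integrable
  have hGs : ContDiff ℝ (⊤ : ℕ∞) (𝓕 g) := (𝓕 S : SchwartzMap (RN N) ℂ).smooth _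
  have hhi : Integrable fun ξ => m ξ * 𝓕 g (-ξ) :=
    hGi.comp_neg.bdd_mul (hm.aestronglyMeasurable hN0) (Eventually.of_forall hb)
  refine ⟨𝓕 fun ξ => m ξ * 𝓕 g (-ξ), continuous_fourier_of_integrable hhi,
    ⟨_, norm_fourier_le _⟩, fun x => iSup₂_le fun t ht => ?_, ?_⟩
  · rw [hm.integral_mul_mulKer hN0 hφ hg hgc ht]
    exact (h _ x t ht).trans (mul_le_mul_left le_self_add _)
  · refine (hm.lintegral_fourier_sq_le hN0 hb (hGs.comp contDiff_neg) hGi.comp_neg).trans ?_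
    have e1 : ∫⁻ ξ, ‖(𝓕 g ∘ Neg.neg) ξ‖ₑ ^ (2 : ℝ) = ∫⁻ ξ, ‖𝓕 g ξ‖ₑ ^ (2 : ℝ) :=
      lintegral_neg_eq_self (fun ξ => ‖𝓕 g ξ‖ₑ ^ (2 : ℝ))
    rw [e1]
    have e2 := lintegral_enorm_sq_fourier S
    have e3 : ∫⁻ ξ, ‖𝓕 g ξ‖ₑ ^ (2 : ℝ) = ∫⁻ ξ, ‖g ξ‖ₑ ^ (2 : ℝ) := e2
    rw [e3]
    exact mul_le_mul_left le_add_self _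

theorem HomSymbol.exists_lintegral_kerMax_sq_le (hN0 : N ≠ 0) (hφ : GoodPhi φ)
    (hm : HomSymbol m) : ∃ C : ℝ≥0∞, C ≠ ⊤ ∧ ∀ g : RN N → ℂ, ContDiff ℝ (⊤ : ℕ∞) g →
      HasCompactSupport g →
        ∫⁻ x, kerMax m φ g x ^ (2 : ℝ) ≤ C * ∫⁻ x, ‖g x‖ₑ ^ (2 : ℝ) := by
  obtain ⟨C, hC, h⟩ := hm.exists_kerMax_le hN0 hφ
  obtain ⟨D, hD, h2⟩ := hlMax_strong_type (N := N) hN0 2 one_lt_two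
  refine ⟨C ^ (2 : ℝ) * (D * C), ?_, fun g hg hgc => ?_⟩
  · have : C ^ (2 : ℝ) ≠ ⊤ := ENNReal.rpow_ne_top_of_nonneg (by norm_num) hC
    finiteness
  obtain ⟨W, hW, ⟨c, hc⟩, h3, h4⟩ := h g hg hgc
  calc _ ≤ ∫⁻ x, C ^ (2 : ℝ) * hlMax (fun y => ‖W y‖ₑ) x ^ (2 : ℝ) := by
        refine lintegral_mono fun x => ?_
        rw [← ENNReal.mul_rpow_of_nonneg _ _ (by norm_num)]
        exact ENNReal.rpow_le_rpow (h3 x) (by norm_num)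
    _ = C ^ (2 : ℝ) * ∫⁻ x, hlMax (fun y => ‖W y‖ₑ) x ^ (2 : ℝ) :=
        lintegral_const_mul' _ _ (ENNReal.rpow_ne_top_of_nonneg (by norm_num) hC)
    _ ≤ C ^ (2 : ℝ) * (D * ∫⁻ x, ‖W x‖ₑ ^ (2 : ℝ)) := by
        gcongr
        refine h2 _ hW.enorm.measurable ⟨ENNReal.ofReal c, ENNReal.ofReal_ne_top, fun x => ?_⟩
        rw [← ofReal_norm]
        exact ENNReal.ofReal_le_ofReal (hc x)
    _ ≤ C ^ (2 : ℝ) * (D * (C * ∫⁻ x, ‖g x‖ₑ ^ (2 : ℝ))) := by gcongr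
    _ = _ := by ring

theorem HomSymbol.kerMax_ne_top (hN0 : N ≠ 0) (hφ : GoodPhi φ) (hm : HomSymbol m)
    {g : RN N → ℂ} (hg : ContDiff ℝ (⊤ : ℕ∞) g) (hgc : HasCompactSupport g) (x : RN N) :
    kerMax m φ g x ≠ ⊤ := by
  obtain ⟨C, hC, h⟩ := hm.exists_kerMax_le hN0 hφ
  obtain ⟨W, hW, ⟨c, hc⟩, h3, h4⟩ := h g hg hgc
  refine ne_top_of_le_ne_top (ENNReal.mul_ne_top hC (ENNReal.ofReal_ne_top (r := c)))
    ((h3 x).trans ?_)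
  gcongr
  refine hlMax_le_const (fun y => ?_) x
  rw [← ofReal_norm]
  exact ENNReal.ofReal_le_ofReal (hc y)

theorem HomSymbol.continuous_integral_mul_mulKer (hN0 : N ≠ 0) (hφ : GoodPhi φ)
    (hm : HomSymbol m) {g : RN N → ℂ} (hg : Continuous g) (hgc : HasCompactSupport g) {t : ℝ}
    (ht : 0 < t) : Continuous fun x => ∫ y, g y * mulKer m φ t (x - y) :=
  HasCompactSupport.continuous_convolution_left (μ := volume) (ContinuousLinearMap.mul ℂ ℂ) hgc hg
    (contDiff_mulKer hN0 hφ hm ht).continuous.locallyIntegrable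

theorem HomSymbol.lowerSemicontinuous_kerMax (hN0 : N ≠ 0) (hφ : GoodPhi φ) (hm : HomSymbol m)
    {g : RN N → ℂ} (hg : Continuous g) (hgc : HasCompactSupport g) :
    LowerSemicontinuous (kerMax m φ g) :=
  lowerSemicontinuous_iSup fun _ => lowerSemicontinuous_iSup fun ht =>
    (hm.continuous_integral_mul_mulKer hN0 hφ hg hgc ht).enorm.lowerSemicontinuous

theorem HomSymbol.integrable_mul_mulKer (hN0 : N ≠ 0) (hφ : GoodPhi φ) (hm : HomSymbol m)
    {g : RN N → ℂ} (hg : Continuous g) (hgc : HasCompactSupport g) {t : ℝ} (ht : 0 < t)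
    (x : RN N) : Integrable fun y => g y * mulKer m φ t (x - y) :=
  (hg.mul ((contDiff_mulKer hN0 hφ hm ht).continuous.comp (continuous_const.sub continuous_id)))
    |>.integrable_of_hasCompactSupport hgc.mul_right

theorem HomSymbol.kerMax_add_le (hN0 : N ≠ 0) (hφ : GoodPhi φ) (hm : HomSymbol m)
    {g h : RN N → ℂ} (hg : Continuous g) (hgc : HasCompactSupport g) (hh : Continuous h)
    (hhc : HasCompactSupport h) (x : RN N) :
    kerMax m φ (fun y => g y + h y) x ≤ kerMax m φ g x + kerMax m φ h x := by
  refine iSup₂_le fun t ht => ?_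
  simp only [add_mul]
  rw [integral_add (hm.integrable_mul_mulKer hN0 hφ hg hgc ht x)
    (hm.integrable_mul_mulKer hN0 hφ hh hhc ht x)]
  refine (enorm_add_le _ _).trans (add_le_add ?_ ?_)
  · exact le_iSup₂ (f := fun t (_ : t ∈ Ioi (0 : ℝ)) => ‖∫ y, g y * mulKer m φ t (x - y)‖ₑ) t ht
  · exact le_iSup₂ (f := fun t (_ : t ∈ Ioi (0 : ℝ)) => ‖∫ y, h y * mulKer m φ t (x - y)‖ₑ) t ht

end L2

/-! ### Cutoffs adapted to the distance to a set -/

/-- A mollified indicator of `{4 s < dist(·, E)}`. -/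
def distCut (φ : RN N → ℝ) (E : Set (RN N)) (s : ℝ) (y : RN N) : ℂ :=
  ∫ z in {z | 4 * s < infDist z E}, dilC φ s (y - z)

/-- A smooth cutoff to the band where the distance to `E` is comparable to `s`. -/
def bandCut (φ : RN N → ℝ) (E : Set (RN N)) (s : ℝ) (y : RN N) : ℂ :=
  distCut φ E s y - distCut φ E (2 * s) y

section cutoffs

variable {φ : RN N → ℝ} {E : Set (RN N)} {s : ℝ}

theorem measurableSet_lt_infDist (E : Set (RN N)) (c : ℝ) :
    MeasurableSet {z : RN N | c < infDist z E} :=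
  (isOpen_lt continuous_const (continuous_infDist_pt E)).measurableSet

theorem GoodPhi.dilC_eq_zero (hφ : GoodPhi φ) (hs : 0 < s) {z : RN N} (hz : s < ‖z‖) :
    dilC φ s z = 0 := by
  simp [dilC, hφ.dil_eq_zero hs hz]

theorem GoodPhi.integral_dilC_sub (hφ : GoodPhi φ) (hs : 0 < s) (y : RN N) :
    ∫ z, dilC φ s (y - z) = 1 := by
  rw [integral_sub_left_eq_self (fun z => dilC φ s z)]
  have : ∫ z, dilC φ s z = ((∫ z, dil φ s z : ℝ) : ℂ) := integral_ofReal
  rw [this, hφ.integral_dil hs, Complex.ofReal_one]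

theorem distCut_eq_one (hφ : GoodPhi φ) (hs : 0 < s) {y : RN N} (h : 5 * s < infDist y E) :
    distCut φ E s y = 1 := by
  rw [distCut, setIntegral_eq_integral_of_forall_compl_eq_zero, hφ.integral_dilC_sub hs]
  intro z hz
  refine hφ.dilC_eq_zero hs ?_
  rw [mem_ofPred_eq, not_lt] at hz
  have := infDist_le_infDist_add_dist (s := E) (x := y) (y := z)
  rw [← dist_eq_norm]
  linarith

theorem distCut_eq_zero (hφ : GoodPhi φ) (hs : 0 < s) {y : RN N} (h : infDist y E ≤ 3 * s) :
    distCut φ E s y = 0 := by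
  refine setIntegral_eq_zero_of_forall_eq_zero fun z hz => ?_
  refine hφ.dilC_eq_zero hs ?_
  rw [mem_ofPred_eq] at hz
  have := infDist_le_infDist_add_dist (s := E) (x := z) (y := y)
  rw [← dist_eq_norm, dist_comm]
  linarith

theorem contDiff_distCut (hφ : GoodPhi φ) (hs : 0 < s) :
    ContDiff ℝ (⊤ : ℕ∞) (distCut φ E s) :=
  contDiff_setIntegral_comp_sub (hφ.contDiff_dilC s) (hφ.hasCompactSupport_dilC hs)
    (measurableSet_lt_infDist E _)

theorem contDiff_bandCut (hφ : GoodPhi φ) (hs : 0 < s) :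
    ContDiff ℝ (⊤ : ℕ∞) (bandCut φ E s) :=
  (contDiff_distCut hφ hs).sub (contDiff_distCut hφ (by positivity))

theorem bandCut_eq_zero (hφ : GoodPhi φ) (hs : 0 < s) {y : RN N}
    (h : infDist y E ≤ 3 * s ∨ 10 * s < infDist y E) : bandCut φ E s y = 0 := by
  rw [bandCut]
  rcases h with h | h
  · rw [distCut_eq_zero hφ hs h, distCut_eq_zero hφ (by positivity) (by linarith), sub_zero]
  · rw [distCut_eq_one hφ hs (by linarith), distCut_eq_one hφ (by positivity) (by linarith),
      sub_self]

theorem GoodPhi.exists_JB_bandCut (hφ : GoodPhi φ) (n : ℕ) :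
    ∃ c, 0 < c ∧ ∀ s, 0 < s → ∀ (E : Set (RN N)) (x : RN N),
      JB n s c (distCut φ E s) x ∧ JB n s c (bandCut φ E s) x := by
  obtain ⟨c, hc, h⟩ := hφ.exists_JB_setIntegral n
  refine ⟨c + c, by positivity, fun s hs E x => ?_⟩
  have h1 : JB n s c (distCut φ E s) x := h s hs _ (measurableSet_lt_infDist E _) x
  have h2 : JB n s c (distCut φ E (2 * s)) x :=
    (h (2 * s) (by positivity) _ (measurableSet_lt_infDist E _) x).mono_scale hs.le (by linarith)
  exact ⟨h1.mono (by linarith), h1.sub hs.le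
    ((contDiff_distCut hφ hs).contDiffAt.of_le (by exact_mod_cast le_top))
    ((contDiff_distCut hφ (by positivity)).contDiffAt.of_le (by exact_mod_cast le_top)) h2⟩

theorem bandCut_mul_dilC_eq_zero (hφ : GoodPhi φ) (hs : 0 < s) {z : RN N}
    (h : ¬(2 * s < infDist z E ∧ infDist z E ≤ 11 * s)) (y : RN N) :
    bandCut φ E s y * dilC φ s (y - z) = 0 := by
  rcases lt_or_ge s ‖y - z‖ with hy | hy
  · rw [hφ.dilC_eq_zero hs hy, mul_zero]
  · rw [← dist_eq_norm] at hy
    have h1 := infDist_le_infDist_add_dist (s := E) (x := y) (y := z)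
    have h2 := infDist_le_infDist_add_dist (s := E) (x := z) (y := y)
    rw [dist_comm] at h2
    rw [bandCut_eq_zero hφ hs, zero_mul]
    by_contra! h3
    exact h ⟨by linarith, by linarith⟩

theorem GoodPhi.exists_norm_integral_bandCut_le (hφ : GoodPhi φ) {r : ℝ} (hr0 : 0 < r)
    (hr1 : r ≤ 1) : ∃ L : ℕ, ∃ C : ℝ, 0 < C ∧ ∀ (ℓ : ℝ) (f : RN N → ℂ), Continuous f →
      HasCompactSupport f → ∀ E : Set (RN N), IsClosed E → E.Nonempty → ∀ l : ℝ, 0 ≤ l →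
        (∀ x ∈ E, gMax φ r ℓ f x ≤ ENNReal.ofReal l) → ∀ s ∈ Ioo (0 : ℝ) ℓ,
          ∀ (z : RN N) (η : RN N → ℂ), ContDiff ℝ (⊤ : ℕ∞) η → ∀ H : ℝ, 0 ≤ H →
            (2 * s < infDist z E → ∀ y, dist y z ≤ s → JB L s H η y) →
              ‖∫ y, f y * (bandCut φ E s y * (dilC φ s (y - z) * η y))‖ ≤ C * H * l := by
  obtain ⟨L, hL⟩ := hφ.exists_enorm_integral_le_gMax hr0 hr1
  obtain ⟨C, hC, hP⟩ := hL 12 (by norm_num)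
  obtain ⟨c₁, hc₁, h₁⟩ := hφ.exists_JB_bandCut L
  obtain ⟨c₂, hc₂, h₂⟩ := hφ.exists_JB_dil L
  refine ⟨L, C * (2 ^ L * (c₁ * (2 ^ L * c₂))), by positivity,
    fun ℓ f hf hfc E hE hEn l hl hG s hs z η hη H hH hJ => ?_⟩
  by_cases hz : 2 * s < infDist z E ∧ infDist z E ≤ 11 * s
  swap
  · simp_rw [← mul_assoc (bandCut φ E s _), bandCut_mul_dilC_eq_zero hφ hs.1 hz]
    simp only [zero_mul, mul_zero, integral_zero, norm_zero]
    positivity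
  obtain ⟨x, hx, hzx⟩ := hE.exists_infDist_eq_dist hEn z
  have hJ' := hJ hz.1
  have hψ : ContDiff ℝ (⊤ : ℕ∞) fun y => bandCut φ E s y * (dilC φ s (y - z) * η y) :=
    (contDiff_bandCut hφ hs.1).mul
      (((hφ.contDiff_dilC s).comp (contDiff_id.sub contDiff_const)).mul hη)
  have hfar : ∀ y, s < dist y z → bandCut φ E s y * (dilC φ s (y - z) * η y) = 0 := fun y hy => by
    rw [hφ.dilC_eq_zero hs.1 (by rwa [← dist_eq_norm]), zero_mul, mul_zero]
  have key := hP ℓ f hf hfc s hs x _ hψ (fun y hy => hfar y (by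
    have := dist_triangle y z x
    linarith [hz.2])) (2 ^ L * (c₁ * (2 ^ L * (c₂ * H)))) (by positivity) (fun y => by
      have hs0 := hs.1
      rcases lt_or_ge s (dist y z) with hy | hy
      · refine JB.of_eventually_zero (by positivity) ?_
        filter_upwards [(isOpen_lt continuous_const (continuous_id.dist continuous_const)).mem_nhds
          hy] with w hw using hfar w hw
      · have hd : JB L s (c₂ * (s ^ N)⁻¹) (fun y => dilC φ s (y - z)) y :=
          JB.comp_sub z (h₂ s hs0 _)
        have hdc : ContDiff ℝ (⊤ : ℕ∞) fun y => dilC φ s (y - z) :=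
          (hφ.contDiff_dilC s).comp (contDiff_id.sub contDiff_const)
        have := (h₁ s hs0 E y).2.mul hs0.le
          ((contDiff_bandCut hφ hs0).contDiffAt.of_le (by exact_mod_cast le_top))
          ((hdc.mul hη).contDiffAt.of_le (by exact_mod_cast le_top))
          (hd.mul hs0.le (hdc.contDiffAt.of_le (by exact_mod_cast le_top))
            (hη.contDiffAt.of_le (by exact_mod_cast le_top)) (hJ' y hy))
        exact this.mono (le_of_eq (by field_simp)))
  rw [← ofReal_norm] at key
  have := key.trans (mul_le_mul_right (hG x hx) _)
  rw [← ENNReal.ofReal_mul (by positivity), ENNReal.ofReal_le_ofReal_iff (by positivity)] at this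
  exact this.trans (le_of_eq (by ring))

end cutoffs

section approx

variable {φ : RN N → ℝ} {E : Set (RN N)} {s : ℝ}

theorem convAt_sub_const (hφ : GoodPhi φ) (hs : 0 < s) {f : RN N → ℂ} (hf : Continuous f) (c : ℂ)
    (x : RN N) : convAt φ s (fun y => f y - c) x = convAt φ s f x - c := by
  rw [convAt_eq φ, convAt_eq φ]
  simp only [smul_sub]
  rw [integral_sub (hφ.integrable_dil_smul hs (W := fun y => f (x - y)) (by fun_prop))
    (hφ.integrable_dil_smul hs continuous_const), integral_smul_const, hφ.integral_dil hs,
    one_smul]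

theorem convAt_one (hφ : GoodPhi φ) (hs : 0 < s) (x : RN N) :
    convAt φ s (fun _ => 1) x = 1 := by
  rw [convAt_eq φ, integral_smul_const, hφ.integral_dil hs, one_smul]

theorem convAt_eq_integral_mul (hφ : GoodPhi φ) (s : ℝ) (f : RN N → ℂ) (z : RN N) :
    convAt φ s f z = ∫ y, f y * dilC φ s (y - z) := by
  rw [convAt]
  refine integral_congr_ae (Eventually.of_forall fun y => ?_)
  simp only [dilC, hφ.dil_sub_comm s z y, Complex.real_smul, mul_comm]

theorem convAt_eq_convolution (φ : RN N → ℝ) (s : ℝ) (f : RN N → ℂ) :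
    convAt φ s f = convolution (dil φ s) f (ContinuousLinearMap.lsmul ℝ ℝ) volume :=
  funext fun x => convAt_eq φ s f x

theorem contDiff_convAt (hφ : GoodPhi φ) (hs : 0 < s) {f : RN N → ℂ} (hf : Continuous f) :
    ContDiff ℝ (⊤ : ℕ∞) (convAt φ s f) := by
  rw [convAt_eq_convolution]
  exact (hφ.hasCompactSupport_dil hs).contDiff_convolution_left _ (hφ.contDiff_dil s)
    hf.locallyIntegrable

theorem hasCompactSupport_convAt (hφ : GoodPhi φ) (hs : 0 < s) {f : RN N → ℂ}
    (hfc : HasCompactSupport f) : HasCompactSupport (convAt φ s f) := by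
  rw [convAt_eq_convolution]
  exact (hφ.hasCompactSupport_dil hs).convolution _ hfc

theorem integral_mul_convAt_of_hasCompactSupport (hφ : GoodPhi φ) (hs : 0 < s) {f r : RN N → ℂ}
    (hf : Continuous f) (hfc : HasCompactSupport f) (hr : Continuous r) :
    ∫ x, f x * convAt φ s r x = ∫ z, convAt φ s f z * r z := by
  have hd := (hφ.contDiff_dilC s).continuous
  have e1 : ∀ x, f x * convAt φ s r x = ∫ z, f x * (r z * dilC φ s (z - x)) := fun x => by
    rw [convAt_eq_integral_mul hφ, integral_const_mul]
  have e2 : ∀ z, convAt φ s f z * r z = ∫ x, f x * (r z * dilC φ s (z - x)) := fun z => by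
    rw [convAt_eq_integral_mul hφ, ← integral_mul_const]
    refine integral_congr_ae (Eventually.of_forall fun y => ?_)
    simp only [dilC, hφ.dil_sub_comm s z y]
    ring
  simp_rw [e1, e2]
  refine integral_integral_swap_of_hasCompactSupport (f := fun x z => f x * (r z * dilC φ s (z - x)))
    (by unfold Function.uncurry; fun_prop) ?_
  refine HasCompactSupport.intro (K := tsupport f ×ˢ cthickening s (tsupport f))
    (hfc.isCompact.prod hfc.isCompact.cthickening) fun p hp => ?_
  rw [Function.uncurry]
  by_cases h1 : p.1 ∈ tsupport f
  · have h2 : p.2 ∉ cthickening s (tsupport f) := fun h2 => hp ⟨h1, h2⟩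
    have : s < dist p.2 p.1 := by
      by_contra! h
      exact h2 (mem_cthickening_of_dist_le _ _ _ _ h1 h)
    rw [hφ.dilC_eq_zero hs (by rwa [← dist_eq_norm]), mul_zero, mul_zero]
  · rw [image_eq_zero_of_notMem_tsupport h1, zero_mul]

/-- The part of `f` living in a band around `E`. -/
def bandPart (φ : RN N → ℝ) (E : Set (RN N)) (s : ℝ) (f : RN N → ℂ) (y : RN N) : ℂ :=
  f y * bandCut φ E s y

/-- The double mollification of the band part. -/
def bandApprox (φ : RN N → ℝ) (E : Set (RN N)) (s : ℝ) (f : RN N → ℂ) : RN N → ℂ :=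
  convAt φ s (convAt φ s (bandPart φ E s f))

theorem contDiff_bandPart (hφ : GoodPhi φ) (hs : 0 < s) {f : RN N → ℂ}
    (hf : ContDiff ℝ (⊤ : ℕ∞) f) : ContDiff ℝ (⊤ : ℕ∞) (bandPart φ E s f) :=
  hf.mul (contDiff_bandCut hφ hs)

theorem continuous_bandPart (hφ : GoodPhi φ) (hs : 0 < s) {f : RN N → ℂ}
    (hf : Continuous f) : Continuous (bandPart φ E s f) :=
  hf.mul (contDiff_bandCut hφ hs).continuous

theorem hasCompactSupport_bandPart {f : RN N → ℂ} (hf : HasCompactSupport f) :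
    HasCompactSupport (bandPart φ E s f) := hf.mul_right

theorem contDiff_bandApprox (hφ : GoodPhi φ) (hs : 0 < s) {f : RN N → ℂ} (hf : Continuous f) :
    ContDiff ℝ (⊤ : ℕ∞) (bandApprox φ E s f) :=
  contDiff_convAt hφ hs (continuous_convAt hφ hs (continuous_bandPart hφ hs hf))

theorem hasCompactSupport_bandApprox (hφ : GoodPhi φ) (hs : 0 < s) {f : RN N → ℂ}
    (hfc : HasCompactSupport f) : HasCompactSupport (bandApprox φ E s f) :=
  hasCompactSupport_convAt hφ hs (hasCompactSupport_convAt hφ hs (hasCompactSupport_bandPart hfc))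

theorem convAt_bandPart_mul (hφ : GoodPhi φ) (s : ℝ) (f K : RN N → ℂ) (z : RN N) :
    convAt φ s (fun y => bandPart φ E s f y * K y) z =
      ∫ y, f y * (bandCut φ E s y * (dilC φ s (y - z) * K y)) := by
  rw [convAt_eq_integral_mul hφ]
  refine integral_congr_ae (Eventually.of_forall fun y => ?_)
  simp only [bandPart]
  ring

theorem convAt_bandPart (hφ : GoodPhi φ) (s : ℝ) (f : RN N → ℂ) (z : RN N) :
    convAt φ s (bandPart φ E s f) z =
      ∫ y, f y * (bandCut φ E s y * (dilC φ s (y - z) * 1)) := by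
  simpa using convAt_bandPart_mul (E := E) hφ s f (fun _ => 1) z

theorem convAt_bandPart_eq_zero (hφ : GoodPhi φ) (hs : 0 < s) {f : RN N → ℂ} {z : RN N}
    (h : ¬(2 * s < infDist z E ∧ infDist z E ≤ 11 * s)) :
    convAt φ s (bandPart φ E s f) z = 0 := by
  rw [convAt_bandPart hφ]
  simp_rw [← mul_assoc (bandCut φ E s _), bandCut_mul_dilC_eq_zero hφ hs h]
  simp

theorem GoodPhi.exists_norm_bandApprox_le (hφ : GoodPhi φ) {r : ℝ} (hr0 : 0 < r)
    (hr1 : r ≤ 1) : ∃ C : ℝ, 0 < C ∧ ∀ (ℓ : ℝ) (f : RN N → ℂ), Continuous f →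
      HasCompactSupport f → ∀ E : Set (RN N), IsClosed E → E.Nonempty → ∀ l : ℝ, 0 ≤ l →
        (∀ x ∈ E, gMax φ r ℓ f x ≤ ENNReal.ofReal l) → ∀ s ∈ Ioo (0 : ℝ) ℓ, ∀ x,
          ‖bandApprox φ E s f x‖ ≤
            {x | s < infDist x E ∧ infDist x E ≤ 12 * s}.indicator (fun _ => C * l) x := by
  obtain ⟨L, C, hC, h⟩ := hφ.exists_norm_integral_bandCut_le hr0 hr1
  refine ⟨C, hC, fun ℓ f hf hfc E hE hEn l hl hG s hs x => ?_⟩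
  have h1 : ∀ z, ‖convAt φ s (bandPart φ E s f) z‖ ≤ C * l := fun z => by
    rw [convAt_bandPart hφ]
    have := h ℓ f hf hfc E hE hEn l hl hG s hs z (fun _ => 1) contDiff_const 1 zero_le_one
      fun _ y _ i _ => by
        rcases eq_or_ne i 0 with rfl | hi
        · simp
        · rw [iteratedFDeriv_const_of_ne hi]; simp
    simpa using this
  by_cases hx : s < infDist x E ∧ infDist x E ≤ 12 * s
  · rw [indicator_of_mem (by exact hx)]
    exact norm_convAt_le hφ hs.1 fun y _ => h1 y
  · rw [indicator_of_notMem (by exact hx)]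
    refine norm_convAt_le hφ hs.1 fun y hy => ?_
    rw [convAt_bandPart_eq_zero hφ hs.1, norm_zero]
    rintro ⟨h2, h3⟩
    have h4 := infDist_le_infDist_add_dist (s := E) (x := y) (y := x)
    have h5 := infDist_le_infDist_add_dist (s := E) (x := x) (y := y)
    rw [dist_comm] at h5
    exact hx ⟨by linarith, by linarith⟩

theorem integral_bandPart_sub_mul (hφ : GoodPhi φ) (hs : 0 < s) {f K : RN N → ℂ}
    (hf : Continuous f) (hfc : HasCompactSupport f) (hK : Continuous K) :
    ∫ y, (bandPart φ E s f y - bandApprox φ E s f y) * K y =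
      ∫ z, ∫ y, f y * (bandCut φ E s y * (dilC φ s (y - z) * (K y - convAt φ s K z))) := by
  have hv := continuous_bandPart (E := E) hφ hs hf
  have hvc := hasCompactSupport_bandPart (φ := φ) (E := E) (s := s) hfc
  have hw := continuous_convAt hφ hs hv
  have hwc := hasCompactSupport_convAt hφ hs hvc
  have hvK : Continuous fun y => bandPart φ E s f y * K y := hv.mul hK
  have hvKc : HasCompactSupport fun y => bandPart φ E s f y * K y := hvc.mul_right
  have e1 : ∀ z, ∫ y, f y * (bandCut φ E s y * (dilC φ s (y - z) * (K y - convAt φ s K z))) =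
      convAt φ s (fun y => bandPart φ E s f y * K y) z -
        convAt φ s (bandPart φ E s f) z * convAt φ s K z := fun z => by
    rw [convAt_eq_integral_mul hφ s (fun y => bandPart φ E s f y * K y),
      convAt_eq_integral_mul hφ s (bandPart φ E s f), ← integral_mul_const, ← integral_sub]
    · refine integral_congr_ae (Eventually.of_forall fun y => ?_)
      simp only [bandPart]
      ring
    · exact (hvK.mul ((hφ.contDiff_dilC s).continuous.comp (continuous_id.sub
        continuous_const))).integrable_of_hasCompactSupport hvKc.mul_right
    · exact ((hv.mul ((hφ.contDiff_dilC s).continuous.comp (continuous_id.sub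
        continuous_const))).integrable_of_hasCompactSupport hvc.mul_right).mul_const _
  simp_rw [e1, sub_mul]
  rw [integral_sub, integral_sub]
  · congr 1
    · have := integral_mul_convAt_of_hasCompactSupport hφ hs hvK hvKc
        (continuous_const (y := (1 : ℂ)))
      simpa [convAt_one hφ hs] using this
    · exact (integral_mul_convAt_of_hasCompactSupport hφ hs hw hwc hK).symm
  · exact (continuous_convAt hφ hs hvK).integrable_of_hasCompactSupport
      (hasCompactSupport_convAt hφ hs hvKc)
  · exact (hw.mul (continuous_convAt hφ hs hK)).integrable_of_hasCompactSupport hwc.mul_right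
  · exact hvK.integrable_of_hasCompactSupport hvKc
  · exact ((contDiff_bandApprox hφ hs hf).continuous.mul hK).integrable_of_hasCompactSupport
      (hasCompactSupport_bandApprox hφ hs hfc).mul_right

theorem HomSymbol.exists_JB_mulKer_sub_convAt (hN0 : N ≠ 0) (hφ : GoodPhi φ) {m : RN N → ℂ}
    (hm : HomSymbol m) (J : ℕ) : ∃ C : ℝ, 0 < C ∧ ∀ t, 0 < t → ∀ s, 0 < s → ∀ x z : RN N,
      2 * s < dist x z → ∀ y, dist y z ≤ s → JB J s (C * s / dist x z ^ (N + 1))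
        (fun y => mulKer m φ t (x - y) - convAt φ s (fun y => mulKer m φ t (x - y)) z) y := by
  obtain ⟨C, hC, h⟩ := exists_JB_mulKer hN0 hφ hm (J + 1)
  refine ⟨C * 2 ^ (N + 2), by positivity, fun t ht s hs x z hxz y hy => ?_⟩
  set K : RN N → ℂ := fun y => mulKer m φ t (x - y) with hKdef
  set ρ := dist x z with hρ
  have hρ0 : 0 < ρ := by linarith
  have hK : ContDiff ℝ (⊤ : ℕ∞) K :=
    (contDiff_mulKer hN0 hφ hm ht).comp (contDiff_const.sub contDiff_id)
  have hd : ∀ w, dist w z ≤ s → ∀ i ≤ J + 1, i ≠ 0 →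
      ‖iteratedFDeriv ℝ i K w‖ * s ^ i ≤ C * 2 ^ (N + 1) * s / ρ ^ (N + 1) := by
    intro w hw i hi hi0
    have hxw : ρ / 2 ≤ ‖x - w‖ := by
      rw [← dist_eq_norm]
      have := dist_triangle x w z
      linarith
    have hxw0 : 0 < ‖x - w‖ := by linarith
    have hsx : s ≤ ‖x - w‖ := by linarith
    have h1 := JB.comp_const_sub x (h t ht (x - w) (norm_pos_iff.1 hxw0)) i hi
    have h2 : s ^ i ≤ ‖x - w‖ ^ i * (s / ‖x - w‖) := by
      obtain ⟨j, rfl⟩ := Nat.exists_eq_succ_of_ne_zero hi0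
      rw [pow_succ, pow_succ, mul_assoc, mul_div_cancel₀ _ hxw0.ne']
      gcongr
    calc ‖iteratedFDeriv ℝ i K w‖ * s ^ i
        ≤ ‖iteratedFDeriv ℝ i K w‖ * (‖x - w‖ ^ i * (s / ‖x - w‖)) := by gcongr
      _ = ‖iteratedFDeriv ℝ i K w‖ * ‖x - w‖ ^ i * (s / ‖x - w‖) := by ring
      _ ≤ C * (‖x - w‖ ^ N)⁻¹ * (s / ‖x - w‖) := by gcongr
      _ = C * s / ‖x - w‖ ^ (N + 1) := by rw [pow_succ]; field_simp
      _ ≤ C * s / (ρ / 2) ^ (N + 1) := by gcongr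
      _ = _ := by rw [div_pow]; field_simp
  have hlip : ∀ w, dist w z ≤ s → ‖K w - K y‖ ≤ C * 2 ^ (N + 2) * s / ρ ^ (N + 1) := by
    intro w hw
    have hb : ∀ v ∈ closedBall z s, ‖fderiv ℝ K v‖ ≤ C * 2 ^ (N + 1) / ρ ^ (N + 1) := by
      intro v hv
      have h1 := hd v hv 1 (by omega) one_ne_zero
      rw [norm_iteratedFDeriv_one, pow_one] at h1
      refine le_of_mul_le_mul_right (h1.trans (le_of_eq (by ring))) hs
    have h2 := (convex_closedBall z s).norm_image_sub_le_of_norm_fderiv_le (𝕜 := ℝ)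
      (fun v _ => (hK.differentiable (by simp)) v) hb (x := y) (y := w) hy hw
    refine h2.trans ?_
    have h3 : ‖w - y‖ ≤ 2 * s := by
      rw [← dist_eq_norm]
      have := dist_triangle_right w y z
      linarith
    calc C * 2 ^ (N + 1) / ρ ^ (N + 1) * ‖w - y‖ ≤ C * 2 ^ (N + 1) / ρ ^ (N + 1) * (2 * s) := by
          gcongr
      _ = _ := by ring
  refine JB.sub_const (hK.contDiffAt.of_le (by exact_mod_cast le_top)) ?_ fun i hi hi0 => ?_
  · rw [norm_sub_rev, ← convAt_sub_const hφ hs hK.continuous]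
    exact norm_convAt_le hφ hs fun w hw => hlip w hw
  · refine (hd y hy i (by omega) hi0).trans ?_
    rw [pow_succ 2 (N + 1)]
    gcongr
    nlinarith [pow_pos (two_pos (α := ℝ)) (N + 1)]

theorem HomSymbol.exists_enorm_integral_band_le (hN0 : N ≠ 0) (hφ : GoodPhi φ) {m : RN N → ℂ}
    (hm : HomSymbol m) {r : ℝ} (hr0 : 0 < r) (hr1 : r ≤ 1) :
    ∃ C : ℝ, 0 < C ∧ ∀ (ℓ : ℝ) (f : RN N → ℂ), Continuous f →
      HasCompactSupport f → ∀ E : Set (RN N), IsClosed E → E.Nonempty → ∀ l : ℝ, 0 ≤ l →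
        (∀ x ∈ E, gMax φ r ℓ f x ≤ ENNReal.ofReal l) → ∀ s ∈ Ioo (0 : ℝ) ℓ, ∀ t, 0 < t →
          ∀ x ∈ E, ‖∫ y, (bandPart φ E s f y - bandApprox φ E s f y) * mulKer m φ t (x - y)‖ₑ ≤
            ∫⁻ z, {z | 2 * s < infDist z E ∧ infDist z E ≤ 11 * s}.indicator
              (fun z => ENNReal.ofReal (C * l * s / dist x z ^ (N + 1))) z := by
  obtain ⟨L, C, hC, h⟩ := hφ.exists_norm_integral_bandCut_le hr0 hr1
  obtain ⟨C', hC', hK⟩ := hm.exists_JB_mulKer_sub_convAt hN0 hφ L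
  refine ⟨C * C', by positivity, fun ℓ f hf hfc E hE hEn l hl hG s hs t ht x hx => ?_⟩
  have hKc : ContDiff ℝ (⊤ : ℕ∞) fun y => mulKer m φ t (x - y) :=
    (contDiff_mulKer hN0 hφ hm ht).comp (contDiff_const.sub contDiff_id)
  rw [integral_bandPart_sub_mul hφ hs.1 hf hfc hKc.continuous]
  refine (enorm_integral_le_lintegral_enorm _).trans (lintegral_mono fun z => ?_)
  by_cases hz : 2 * s < infDist z E ∧ infDist z E ≤ 11 * s
  · rw [indicator_of_mem (by exact hz), ← ofReal_norm]
    refine ENNReal.ofReal_le_ofReal ?_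
    have hs0 := hs.1
    have := h ℓ f hf hfc E hE hEn l hl hG s hs z
      (fun y => mulKer m φ t (x - y) - convAt φ s (fun y => mulKer m φ t (x - y)) z)
      (hKc.sub contDiff_const) (C' * s / dist x z ^ (N + 1)) (by positivity)
      fun hzs => hK t ht s hs.1 x z (by
        have := infDist_le_dist_of_mem (x := z) hx
        rw [dist_comm]
        linarith)
    exact this.trans (le_of_eq (by ring))
  · rw [indicator_of_notMem (by exact hz)]
    simp_rw [← mul_assoc (bandCut φ E s _), bandCut_mul_dilC_eq_zero hφ hs.1 hz]
    simp

end approx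

section scales

/-- The dyadic scales below `ℓ`. -/
def dyScale (ℓ : ℝ) (k : ℕ) : ℝ := ℓ / 2 ^ (k + 1)

theorem dyScale_pos {ℓ : ℝ} (hℓ : 0 < ℓ) (k : ℕ) : 0 < dyScale ℓ k := by
  unfold dyScale; positivity

theorem dyScale_lt {ℓ : ℝ} (hℓ : 0 < ℓ) (k : ℕ) : dyScale ℓ k < ℓ :=
  div_lt_self hℓ (one_lt_pow₀ one_lt_two (by omega))

theorem min_dyScale {ℓ d : ℝ} (hℓ : 0 < ℓ) (hd : 0 < d) {k : ℕ} (h : dyScale ℓ k ≤ d) :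
    min (ℓ / (2 * d) / 2 ^ k) (2 ^ k / (ℓ / (2 * d))) = dyScale ℓ k / d := by
  have e1 : ℓ / (2 * d) / 2 ^ k = dyScale ℓ k / d := by
    rw [dyScale, pow_succ]; field_simp
  have e2 : 2 ^ k / (ℓ / (2 * d)) = d / dyScale ℓ k := by
    rw [dyScale, pow_succ]; field_simp
  rw [e1, e2]
  have h0 := dyScale_pos hℓ k
  refine min_eq_left (((div_le_one hd).2 h).trans ((one_le_div h0).2 h))

theorem sum_dyScale_band_le {ℓ : ℝ} (hℓ : 0 < ℓ) (d : ℝ) (K : ℕ) :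
    ∑ k ∈ Finset.range K, (if dyScale ℓ k < d ∧ d ≤ 12 * dyScale ℓ k then (1 : ℝ) else 0) ≤ 60 := by
  rcases le_or_gt d 0 with hd | hd
  · rw [Finset.sum_eq_zero]
    · norm_num
    · intro k _
      rw [if_neg]
      rintro ⟨h, -⟩
      linarith [dyScale_pos hℓ k]
  calc _ ≤ ∑ k ∈ Finset.range K, 12 * min (ℓ / (2 * d) / 2 ^ k) (2 ^ k / (ℓ / (2 * d))) := by
        refine Finset.sum_le_sum fun k _ => ?_
        split_ifs with h
        · rw [min_dyScale hℓ hd h.1.le, ← mul_div_assoc, one_le_div hd]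
          exact h.2
        · positivity
    _ ≤ 12 * 5 := by
        rw [← Finset.mul_sum]
        exact mul_le_mul_of_nonneg_left (sum_min_pow_le_five K (by positivity)) (by norm_num)
    _ = 60 := by norm_num

theorem sum_dyScale_le {ℓ : ℝ} (hℓ : 0 < ℓ) {d : ℝ} (hd0 : 0 ≤ d) (K : ℕ) :
    ∑ k ∈ Finset.range K, (if dyScale ℓ k < d then dyScale ℓ k else 0) ≤ 5 * d := by
  rcases hd0.eq_or_lt with rfl | hd
  · rw [Finset.sum_eq_zero]
    · norm_num
    · intro k _
      rw [if_neg]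
      linarith [dyScale_pos hℓ k]
  calc _ ≤ ∑ k ∈ Finset.range K, d * min (ℓ / (2 * d) / 2 ^ k) (2 ^ k / (ℓ / (2 * d))) := by
        refine Finset.sum_le_sum fun k _ => ?_
        split_ifs with h
        · rw [min_dyScale hℓ hd h.le, mul_div_cancel₀ _ hd.ne']
        · positivity
    _ ≤ d * 5 := by
        rw [← Finset.mul_sum]
        exact mul_le_mul_of_nonneg_left (sum_min_pow_le_five K (by positivity)) hd.le
    _ = 5 * d := mul_comm _ _

variable {φ : RN N → ℝ} {E : Set (RN N)}

theorem sum_bandCut (φ : RN N → ℝ) (E : Set (RN N)) (ℓ : ℝ) (K : ℕ) (y : RN N) :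
    ∑ k ∈ Finset.range K, bandCut φ E (dyScale ℓ k) y =
      distCut φ E (ℓ / 2 ^ K) y - distCut φ E ℓ y := by
  have : ∀ k, bandCut φ E (dyScale ℓ k) y =
      distCut φ E (ℓ / 2 ^ (k + 1)) y - distCut φ E (ℓ / 2 ^ k) y := fun k => by
    rw [bandCut, dyScale, pow_succ]
    congr 2
    field_simp
  simp_rw [this]
  rw [Finset.sum_range_sub (fun k => distCut φ E (ℓ / 2 ^ k) y)]
  simp

theorem measurable_infDist_div (E : Set (RN N)) :
    Measurable fun q : RN N × RN N => ENNReal.ofReal (infDist q.2 E / dist q.1 q.2 ^ (N + 1)) := by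
  refine ENNReal.measurable_ofReal.comp (Measurable.div ?_ ?_)
  · exact ((continuous_infDist_pt E).comp continuous_snd).measurable
  · exact ((continuous_fst.dist continuous_snd).pow _).measurable

theorem lintegral_comp_inv_smul_sub {d : ℝ} (hd : 0 < d) (z : RN N) (h : RN N → ℝ≥0∞) :
    ∫⁻ x, h (d⁻¹ • (x - z)) = ENNReal.ofReal (d ^ N) * ∫⁻ x, h x := by
  rw [lintegral_sub_right_eq_self (fun x => h (d⁻¹ • x)) z]
  have e := (Homeomorph.smulOfNeZero d⁻¹ (inv_ne_zero hd.ne') (α := RN N)).measurableEmbedding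
    |>.lintegral_map (μ := volume) h
  simp only [Homeomorph.smulOfNeZero_apply] at e
  have e2 : Measure.map (fun x : RN N => d⁻¹ • x)
      (volume : Measure (RN N)) = ENNReal.ofReal (d ^ N) • volume := by
    have := Measure.map_addHaar_smul (volume : Measure (RN N)) (inv_ne_zero hd.ne')
    rw [finrank_euclideanSpace_fin, ← inv_pow, inv_inv, abs_of_pos (by positivity)] at this
    exact this
  rw [← e, e2, lintegral_smul_measure, smul_eq_mul]

theorem exists_setLIntegral_infDist_div_le : ∃ C : ℝ≥0∞, C ≠ ⊤ ∧
    ∀ (E : Set (RN N)), IsClosed E → E.Nonempty →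
      ∫⁻ x in E, (∫⁻ z, ENNReal.ofReal (infDist z E / dist x z ^ (N + 1))) ≤ C * volume Eᶜ := by
  have hint : Integrable fun w : RN N => (1 + ‖w‖) ^ (-((N : ℝ) + 1)) :=
    integrable_one_add_norm (by rw [finrank_euclideanSpace_fin]; linarith)
  refine ⟨ENNReal.ofReal (2 ^ (N + 1)) * ∫⁻ w : RN N, ENNReal.ofReal ((1 + ‖w‖) ^ (-((N : ℝ) + 1))),
    ENNReal.mul_ne_top ENNReal.ofReal_ne_top hint.lintegral_lt_top.ne, fun E hE hEn => ?_⟩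
  rw [lintegral_lintegral_swap (measurable_infDist_div E).aemeasurable,
    ← setLIntegral_const, ← lintegral_indicator hE.measurableSet.compl]
  refine lintegral_mono fun z => ?_
  by_cases hz : z ∈ E
  · simp [infDist_zero_of_mem hz]
  rw [indicator_of_mem (by exact hz)]
  set d := infDist z E with hd
  have hd0 : 0 < d := (hE.notMem_iff_infDist_pos hEn).1 hz
  calc ∫⁻ x in E, ENNReal.ofReal (d / dist x z ^ (N + 1))
      ≤ ∫⁻ x in E, ENNReal.ofReal (2 ^ (N + 1) * (d ^ N)⁻¹) *
          ENNReal.ofReal ((1 + ‖d⁻¹ • (x - z)‖) ^ (-((N : ℝ) + 1))) := by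
        refine setLIntegral_mono_ae' hE.measurableSet (Eventually.of_forall fun x hx => ?_)
        rw [← ENNReal.ofReal_mul (by positivity)]
        refine ENNReal.ofReal_le_ofReal ?_
        have hdx : d ≤ dist x z := by rw [dist_comm]; exact infDist_le_dist_of_mem hx
        have hx0 : 0 < dist x z := hd0.trans_le hdx
        have e : ‖d⁻¹ • (x - z)‖ = dist x z / d := by
          rw [norm_smul, norm_inv, Real.norm_of_nonneg hd0.le, ← dist_eq_norm]; ring
        have e2 : (1 + dist x z / d) ^ (-((N : ℝ) + 1)) = ((1 + dist x z / d) ^ (N + 1))⁻¹ := by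
          rw [Real.rpow_neg (by positivity)]
          congr 1
          exact_mod_cast Real.rpow_natCast _ (N + 1)
        rw [e, e2]
        have h1 : 1 + dist x z / d ≤ 2 * (dist x z / d) := by
          have := (one_le_div hd0).2 hdx
          linarith
        calc d / dist x z ^ (N + 1)
            = 2 ^ (N + 1) * (d ^ N)⁻¹ * ((2 * (dist x z / d)) ^ (N + 1))⁻¹ := by
              rw [mul_pow, div_pow, pow_succ d]; field_simp
          _ ≤ _ := by gcongr
    _ ≤ ∫⁻ x, ENNReal.ofReal (2 ^ (N + 1) * (d ^ N)⁻¹) *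
          ENNReal.ofReal ((1 + ‖d⁻¹ • (x - z)‖) ^ (-((N : ℝ) + 1))) := setLIntegral_le_lintegral _ _
    _ = _ := by
        rw [lintegral_const_mul' _ _ ENNReal.ofReal_ne_top,
          lintegral_comp_inv_smul_sub hd0 z
            (fun w => ENNReal.ofReal ((1 + ‖w‖) ^ (-((N : ℝ) + 1)))), ← mul_assoc,
          ← ENNReal.ofReal_mul (by positivity)]
        congr 2
        field_simp

end scales

/-! ### Calderón–Zygmund decomposition relative to a closed set -/

section decomposition

variable {φ : RN N → ℝ} {m : RN N → ℂ}

theorem GoodPhi.exists_enorm_le_gMax (hφ : GoodPhi φ) {r : ℝ} (hr0 : 0 < r) (hr1 : r ≤ 1) :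
    ∃ C : ℝ, 0 < C ∧ ∀ ℓ, 0 < ℓ → ∀ f : RN N → ℂ, Continuous f → HasCompactSupport f →
      ∀ x, ‖f x‖ₑ ≤ ENNReal.ofReal C * gMax φ r ℓ f x := by
  obtain ⟨C, hC, h⟩ := hφ.exists_locMax_le_gMax hr0 hr1
  exact ⟨C, hC, fun ℓ hℓ f hf hfc x => (enorm_le_locMax hφ hℓ hf x).trans (h ℓ f hf hfc x)⟩

theorem GoodPhi.exists_decomposition (hφ : GoodPhi φ) {r : ℝ} (hr0 : 0 < r) (hr1 : r ≤ 1) :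
    ∃ C : ℝ, 0 < C ∧ ∀ ℓ, 0 < ℓ → ∀ f : RN N → ℂ, ContDiff ℝ (⊤ : ℕ∞) f → HasCompactSupport f →
      ∀ E : Set (RN N), IsClosed E → E.Nonempty → (∀ y, f y ≠ 0 → infDist y E ≤ 3 * ℓ) →
        ∀ l : ℝ, 0 < l → (∀ x ∈ E, gMax φ r ℓ f x ≤ ENNReal.ofReal l) →
          ∃ (K : ℕ) (g b : RN N → ℂ), ContDiff ℝ (⊤ : ℕ∞) g ∧ HasCompactSupport g ∧
            ContDiff ℝ (⊤ : ℕ∞) b ∧ HasCompactSupport b ∧ (f = fun y => g y + b y) ∧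
              (∀ x, ‖g x‖ ≤ C * l) ∧ (∀ x ∈ E, g x = f x) ∧
                b = fun y => ∑ k ∈ Finset.range K, (bandPart φ E (dyScale ℓ k) f y -
                  bandApprox φ E (dyScale ℓ k) f y) := by
  obtain ⟨C₁, hC₁, h₁⟩ := hφ.exists_enorm_le_gMax hr0 hr1
  obtain ⟨C₂, hC₂, h₂⟩ := hφ.exists_norm_bandApprox_le hr0 hr1
  obtain ⟨c, hc, hcut⟩ := hφ.exists_JB_bandCut 0
  refine ⟨(C₁ + 1) * (1 + c) + C₂ * 60, by positivity,
    fun ℓ hℓ f hf hfc E hE hEn hsupp l hl hG => ?_⟩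
  have hfE : ∀ x ∈ E, ‖f x‖ ≤ C₁ * l := fun x hx => by
    have := (h₁ ℓ hℓ f hf.continuous hfc x).trans (mul_le_mul_right (hG x hx) _)
    rwa [← ofReal_norm, ← ENNReal.ofReal_mul hC₁.le,
      ENNReal.ofReal_le_ofReal_iff (by positivity)] at this
  obtain ⟨δ, hδ, hunif⟩ := Metric.uniformContinuous_iff.1
    (hfc.uniformContinuous_of_continuous hf.continuous) l hl
  obtain ⟨K, hK⟩ : ∃ K : ℕ, 5 * (ℓ / 2 ^ K) < δ := by
    have : Tendsto (fun K : ℕ => 5 * (ℓ * (2⁻¹ : ℝ) ^ K)) atTop (𝓝 (5 * (ℓ * 0))) :=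
      ((tendsto_pow_atTop_nhds_zero_of_lt_one (by norm_num) (by norm_num)).const_mul ℓ).const_mul 5
    rw [mul_zero, mul_zero] at this
    obtain ⟨K, hK⟩ := (this.eventually (gt_mem_nhds hδ)).exists
    exact ⟨K, by rwa [inv_pow] at hK⟩
  have hsc := fun k => dyScale_pos hℓ k
  have hK0 : 0 < ℓ / 2 ^ K := by positivity
  have hnear : ∀ y, infDist y E ≤ 5 * (ℓ / 2 ^ K) → ‖f y‖ ≤ (C₁ + 1) * l := fun y hy => by
    obtain ⟨x, hx, hyx⟩ := hE.exists_infDist_eq_dist hEn y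
    have h3 := (hunif (a := y) (b := x) (by rw [← hyx]; linarith)).le
    rw [dist_eq_norm] at h3
    have h4 := norm_add_le (f y - f x) (f x)
    rw [sub_add_cancel] at h4
    linarith [hfE x hx]
  set g : RN N → ℂ := fun y => f y * (1 - distCut φ E (ℓ / 2 ^ K) y) +
    ∑ k ∈ Finset.range K, bandApprox φ E (dyScale ℓ k) f y with hg
  set b : RN N → ℂ := fun y => ∑ k ∈ Finset.range K, (bandPart φ E (dyScale ℓ k) f y -
    bandApprox φ E (dyScale ℓ k) f y) with hb
  have hbs : ContDiff ℝ (⊤ : ℕ∞) b := ContDiff.sum fun k _ =>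
    (contDiff_bandPart hφ (hsc k) hf).sub (contDiff_bandApprox hφ (hsc k) hf.continuous)
  have hbc : HasCompactSupport b := by
    have : ∀ S : Finset ℕ, HasCompactSupport fun y => ∑ k ∈ S,
        (bandPart φ E (dyScale ℓ k) f y - bandApprox φ E (dyScale ℓ k) f y) := fun S => by
      induction S using Finset.induction_on with
      | empty =>
        simp only [Finset.sum_empty]
        exact HasCompactSupport.zero
      | insert k S hk ih =>
        simp_rw [Finset.sum_insert hk]
        exact ((hasCompactSupport_bandPart hfc).sub
          (hasCompactSupport_bandApprox hφ (hsc k) hfc)).add ih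
    exact this _
  have hfgb : ∀ y, f y = g y + b y := fun y => by
    have e1 : f y * distCut φ E ℓ y = 0 := by
      by_cases h : f y = 0
      · rw [h, zero_mul]
      · rw [distCut_eq_zero hφ hℓ (hsupp y h), mul_zero]
    have e2 : ∑ k ∈ Finset.range K, bandPart φ E (dyScale ℓ k) f y =
        f y * distCut φ E (ℓ / 2 ^ K) y := by
      simp only [bandPart]
      rw [← Finset.mul_sum, sum_bandCut, mul_sub, e1, sub_zero]
    simp only [hg, hb, Finset.sum_sub_distrib, e2]
    ring
  have hgeq : g = fun y => f y - b y := funext fun y => by rw [hfgb y, add_sub_cancel_right]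
  refine ⟨K, g, b, hgeq ▸ hf.sub hbs, hgeq ▸ hfc.sub hbc, hbs, hbc, funext hfgb, fun x => ?_,
    fun x hx => ?_, rfl⟩
  · rw [add_mul]
    refine (norm_add_le _ _).trans (add_le_add ?_ ?_)
    · by_cases h : 5 * (ℓ / 2 ^ K) < infDist x E
      · rw [distCut_eq_one hφ hK0 h, sub_self, mul_zero, norm_zero]
        positivity
      · rw [norm_mul]
        have h5 := ((hcut _ hK0 E x).1).norm_le
        have h6 := norm_sub_le 1 (distCut φ E (ℓ / 2 ^ K) x)
        rw [norm_one] at h6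
        calc _ ≤ ((C₁ + 1) * l) * (1 + c) := by
              gcongr
              · exact hnear x (not_lt.1 h)
              · linarith
          _ = _ := by ring
    · calc _ ≤ ∑ k ∈ Finset.range K, C₂ * l *
            (if dyScale ℓ k < infDist x E ∧ infDist x E ≤ 12 * dyScale ℓ k then (1 : ℝ) else 0) := by
            refine norm_sum_le_of_le _ fun k _ => ?_
            have := h₂ ℓ f hf.continuous hfc E hE hEn l hl.le hG _ ⟨hsc k, dyScale_lt hℓ k⟩ x
            refine this.trans (le_of_eq ?_)
            simp only [indicator, mem_ofPred_eq, mul_ite, mul_one, mul_zero]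
        _ ≤ C₂ * l * 60 := by
            rw [← Finset.mul_sum]
            exact mul_le_mul_of_nonneg_left (sum_dyScale_band_le hℓ _ K) (by positivity)
        _ = _ := by ring
  · have hd := infDist_zero_of_mem hx
    simp only [hg]
    rw [distCut_eq_zero hφ hK0 (by rw [hd]; positivity), sub_zero, mul_one,
      Finset.sum_eq_zero fun k _ => ?_, add_zero]
    have := h₂ ℓ f hf.continuous hfc E hE hEn l hl.le hG _ ⟨hsc k, dyScale_lt hℓ k⟩ x
    rw [indicator_of_notMem] at this
    · exact norm_le_zero_iff.1 this
    · rw [mem_ofPred_eq, hd]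
      rintro ⟨h, -⟩
      linarith [hsc k]

theorem HomSymbol.exists_kerMax_sum_band_le (hN0 : N ≠ 0) (hφ : GoodPhi φ) (hm : HomSymbol m)
    {r : ℝ} (hr0 : 0 < r) (hr1 : r ≤ 1) :
    ∃ C : ℝ, 0 < C ∧ ∀ ℓ, 0 < ℓ → ∀ f : RN N → ℂ, Continuous f → HasCompactSupport f →
      ∀ E : Set (RN N), IsClosed E → E.Nonempty → ∀ l : ℝ, 0 ≤ l →
        (∀ x ∈ E, gMax φ r ℓ f x ≤ ENNReal.ofReal l) → ∀ K : ℕ, ∀ x ∈ E,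
          kerMax m φ (fun y => ∑ k ∈ Finset.range K, (bandPart φ E (dyScale ℓ k) f y -
            bandApprox φ E (dyScale ℓ k) f y)) x ≤
              ENNReal.ofReal (C * l) *
                ∫⁻ z, ENNReal.ofReal (infDist z E / dist x z ^ (N + 1)) := by
  obtain ⟨C, hC, h⟩ := hm.exists_enorm_integral_band_le hN0 hφ hr0 hr1
  refine ⟨C * 5, by positivity, fun ℓ hℓ f hf hfc E hE hEn l hl hG K x hx => ?_⟩
  refine iSup₂_le fun t ht => ?_
  have ht : 0 < t := ht
  have hsc := fun k => dyScale_pos hℓ k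
  simp_rw [Finset.sum_mul]
  have hint : ∀ k ∈ Finset.range K, Integrable fun y => (bandPart φ E (dyScale ℓ k) f y -
      bandApprox φ E (dyScale ℓ k) f y) * mulKer m φ t (x - y) := fun k _ =>
    hm.integrable_mul_mulKer hN0 hφ
      ((continuous_bandPart hφ (hsc k) hf).sub (contDiff_bandApprox hφ (hsc k) hf).continuous)
      ((hasCompactSupport_bandPart hfc).sub (hasCompactSupport_bandApprox hφ (hsc k) hfc)) ht x
  rw [integral_finsetSum _ hint]
  calc _ ≤ ∑ k ∈ Finset.range K, ∫⁻ z,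
        {z | 2 * dyScale ℓ k < infDist z E ∧ infDist z E ≤ 11 * dyScale ℓ k}.indicator
          (fun z => ENNReal.ofReal (C * l * dyScale ℓ k / dist x z ^ (N + 1))) z :=
        (enorm_sum_le _ _).trans (Finset.sum_le_sum fun k _ =>
          h ℓ f hf hfc E hE hEn l hl hG _ ⟨hsc k, dyScale_lt hℓ k⟩ t ht x hx)
    _ = ∫⁻ z, ∑ k ∈ Finset.range K,
        {z | 2 * dyScale ℓ k < infDist z E ∧ infDist z E ≤ 11 * dyScale ℓ k}.indicator
          (fun z => ENNReal.ofReal (C * l * dyScale ℓ k / dist x z ^ (N + 1))) z := by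
        rw [lintegral_finsetSum]
        intro k _
        refine Measurable.indicator ?_ ?_
        · exact ENNReal.measurable_ofReal.comp (measurable_const.div
            ((continuous_const.dist continuous_id).pow _).measurable)
        · exact (measurableSet_lt_infDist E _).inter
            (isClosed_le (continuous_infDist_pt E) continuous_const).measurableSet
    _ ≤ ∫⁻ z, ENNReal.ofReal (C * 5 * l) *
          ENNReal.ofReal (infDist z E / dist x z ^ (N + 1)) := by
        refine lintegral_mono fun z => ?_
        rw [← ENNReal.ofReal_mul (by positivity)]
        calc _ ≤ ∑ k ∈ Finset.range K, ENNReal.ofReal (C * l / dist x z ^ (N + 1) *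
              (if dyScale ℓ k < infDist z E then dyScale ℓ k else 0)) := by
              refine Finset.sum_le_sum fun k _ => ?_
              simp only [indicator, mem_ofPred_eq]
              split_ifs with h1 h2 h3
              · exact le_of_eq (by congr 1; ring)
              · exact absurd (by linarith [h1.1, hsc k]) h2
              · positivity
              · positivity
          _ = ENNReal.ofReal (C * l / dist x z ^ (N + 1) *
                ∑ k ∈ Finset.range K, (if dyScale ℓ k < infDist z E then dyScale ℓ k else 0)) := by
              rw [Finset.mul_sum, ENNReal.ofReal_sum_of_nonneg]
              intro k _
              have := (hsc k).le
              positivity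
          _ ≤ ENNReal.ofReal (C * l / dist x z ^ (N + 1) * (5 * infDist z E)) := by
              gcongr
              exact sum_dyScale_le hℓ infDist_nonneg K
          _ = _ := by congr 1; ring
    _ = _ := by rw [lintegral_const_mul' _ _ ENNReal.ofReal_ne_top]

end decomposition

section calderonZygmund

variable {φ : RN N → ℝ} {m : RN N → ℂ}

theorem meas_ofReal_le_le_lintegral {α : Type*} [MeasurableSpace α] {μ : Measure α} {l : ℝ}
    (hl : 0 < l) {f : α → ℝ≥0∞} (hf : Measurable f) :
    μ {x | ENNReal.ofReal l ≤ f x} ≤ ENNReal.ofReal l⁻¹ * ∫⁻ x, f x ∂μ := by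
  have h := mul_meas_ge_le_lintegral (μ := μ) hf (ENNReal.ofReal l)
  calc μ {x | ENNReal.ofReal l ≤ f x}
      = ENNReal.ofReal l⁻¹ * (ENNReal.ofReal l * μ {x | ENNReal.ofReal l ≤ f x}) := by
        rw [← mul_assoc, ← ENNReal.ofReal_mul (by positivity), inv_mul_cancel₀ hl.ne',
          ENNReal.ofReal_one, one_mul]
    _ ≤ _ := by gcongr

theorem HomSymbol.exists_meas_kerMax_le (hN0 : N ≠ 0) (hφ : GoodPhi φ) (hm : HomSymbol m)
    {r : ℝ} (hr0 : 0 < r) (hr1 : r ≤ 1) :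
    ∃ A B : ℝ≥0∞, A ≠ ⊤ ∧ B ≠ ⊤ ∧ ∀ ℓ, 0 < ℓ → ∀ f : RN N → ℂ, ContDiff ℝ (⊤ : ℕ∞) f →
      HasCompactSupport f → ∀ l : ℝ, 0 < l →
        {x | gMax φ r ℓ f x ≤ ENNReal.ofReal l}.Nonempty →
        (∀ y, f y ≠ 0 → infDist y {x | gMax φ r ℓ f x ≤ ENNReal.ofReal l} ≤ 3 * ℓ) →
        volume {x | ENNReal.ofReal l < kerMax m φ f x} ≤
          A * volume {x | ENNReal.ofReal l < gMax φ r ℓ f x} + B * ENNReal.ofReal (l⁻¹ ^ 2) *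
            ∫⁻ x, (if gMax φ r ℓ f x ≤ ENNReal.ofReal l then gMax φ r ℓ f x ^ (2 : ℝ) else 0) := by
  obtain ⟨C, hC, hdec⟩ := hφ.exists_decomposition hr0 hr1
  obtain ⟨C₁, hC₁, h₁⟩ := hφ.exists_enorm_le_gMax hr0 hr1
  obtain ⟨C₃, hC₃, h₃⟩ := hm.exists_lintegral_kerMax_sq_le hN0 hφ
  obtain ⟨C₄, hC₄, h₄⟩ := hm.exists_kerMax_sum_band_le hN0 hφ hr0 hr1
  obtain ⟨C₅, hC₅, h₅⟩ := exists_setLIntegral_infDist_div_le (N := N)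
  refine ⟨1 + ENNReal.ofReal (4 * C ^ 2) * C₃ + ENNReal.ofReal (2 * C₄) * C₅,
    ENNReal.ofReal (4 * C₁ ^ 2) * C₃, ?_, ENNReal.mul_ne_top ENNReal.ofReal_ne_top hC₃,
    fun ℓ hℓ f hf hfc l hl hEn hsupp => ?_⟩
  · exact ENNReal.add_ne_top.2 ⟨ENNReal.add_ne_top.2 ⟨ENNReal.one_ne_top,
      ENNReal.mul_ne_top ENNReal.ofReal_ne_top hC₃⟩, ENNReal.mul_ne_top ENNReal.ofReal_ne_top hC₅⟩
  set G := gMax φ r ℓ f with hGdef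
  set E : Set (RN N) := {x | G x ≤ ENNReal.ofReal l} with hEdef
  have hGm : Measurable G := measurable_gMax hr0 ℓ f
  have hE : IsClosed E := (lowerSemicontinuous_gMax hr0 ℓ f).isClosed_preimage _
  have hEc : Eᶜ = {x | ENNReal.ofReal l < G x} := by ext x; simp [hEdef]
  have hG : ∀ x ∈ E, G x ≤ ENNReal.ofReal l := fun x hx => hx
  obtain ⟨K, g, b, hg, hgc, hb, hbc, hfgb, hgb, hgE, hbK⟩ :=
    hdec ℓ hℓ f hf hfc E hE hEn hsupp l hl hG
  have hMg : Measurable (kerMax m φ g) :=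
    (hm.lowerSemicontinuous_kerMax hN0 hφ hg.continuous hgc).measurable
  have hMb : Measurable (kerMax m φ b) :=
    (hm.lowerSemicontinuous_kerMax hN0 hφ hb.continuous hbc).measurable
  have hl2 : 0 < l / 2 := by positivity
  have hsub : {x | ENNReal.ofReal l < kerMax m φ f x} ⊆
      (Eᶜ ∪ {x | ENNReal.ofReal ((l / 2) ^ 2) ≤ kerMax m φ g x ^ (2 : ℝ)}) ∪
        ({x | ENNReal.ofReal (l / 2) ≤ kerMax m φ b x} ∩ E) := by
    intro x hx
    by_cases hxE : x ∈ E
    · have h1 : ENNReal.ofReal l < kerMax m φ g x + kerMax m φ b x := by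
        refine lt_of_lt_of_le (mem_ofPred_eq ▸ hx) ?_
        rw [hfgb]
        exact hm.kerMax_add_le hN0 hφ hg.continuous hgc hb.continuous hbc x
      rcases le_or_gt (ENNReal.ofReal (l / 2)) (kerMax m φ b x) with h2 | h2
      · exact Or.inr ⟨h2, hxE⟩
      · refine Or.inl (Or.inr ?_)
        have h3 : ENNReal.ofReal (l / 2) ≤ kerMax m φ g x := by
          by_contra! h3
          have := ENNReal.add_lt_add h3 h2
          rw [← ENNReal.ofReal_add hl2.le hl2.le, add_halves] at this
          exact lt_asymm this h1
        rw [mem_ofPred_eq, ← Real.rpow_natCast, ← ENNReal.ofReal_rpow_of_pos hl2]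
        exact ENNReal.rpow_le_rpow h3 (by norm_num)
    · exact Or.inl (Or.inl hxE)
  have hgsq : ∫⁻ x, ‖g x‖ₑ ^ (2 : ℝ) ≤ ENNReal.ofReal ((C * l) ^ 2) * volume Eᶜ +
      ENNReal.ofReal (C₁ ^ 2) * ∫⁻ x, (if G x ≤ ENNReal.ofReal l then G x ^ (2 : ℝ) else 0) := by
    rw [← setLIntegral_const, ← lintegral_indicator hE.measurableSet.compl,
      ← lintegral_const_mul' _ _ ENNReal.ofReal_ne_top, ← lintegral_add_left
        (measurable_const.indicator hE.measurableSet.compl)]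
    refine lintegral_mono fun x => ?_
    by_cases hx : x ∈ E
    · rw [indicator_of_notMem (by simpa using hx), zero_add, if_pos (hG x hx), hgE x hx,
        ← Real.rpow_natCast, ← ENNReal.ofReal_rpow_of_pos hC₁]
      rw [show (((2 : ℕ) : ℝ)) = 2 by norm_num, ← ENNReal.mul_rpow_of_nonneg _ _ (by norm_num)]
      exact ENNReal.rpow_le_rpow (h₁ ℓ hℓ f hf.continuous hfc x) (by norm_num)
    · rw [indicator_of_mem (by exact hx), ← Real.rpow_natCast,
        ← ENNReal.ofReal_rpow_of_pos (by positivity), ← ofReal_norm]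
      refine le_add_right (ENNReal.rpow_le_rpow (ENNReal.ofReal_le_ofReal (hgb x)) (by norm_num))
  have hbE : ∫⁻ x in E, kerMax m φ b x ≤ ENNReal.ofReal (C₄ * l) * (C₅ * volume Eᶜ) := by
    refine le_trans (setLIntegral_mono_ae' hE.measurableSet (Eventually.of_forall fun x hx => ?_))
      ((lintegral_const_mul' _ _ ENNReal.ofReal_ne_top).le.trans
        (mul_le_mul_right (h₅ E hE hEn) _))
    rw [hbK]
    exact h₄ ℓ hℓ f hf.continuous hfc E hE hEn l hl.le hG K x hx
  have hmg := (meas_ofReal_le_le_lintegral (μ := volume) (l := (l / 2) ^ 2) (by positivity)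
    (hMg.pow_const (2 : ℝ))).trans (mul_le_mul_right ((h₃ g hg hgc).trans
      (mul_le_mul_right hgsq C₃)) _)
  have hmb := (meas_ofReal_le_le_lintegral (μ := volume.restrict E) hl2 hMb).trans
    (mul_le_mul_right hbE _)
  have hms : MeasurableSet {x | ENNReal.ofReal (l / 2) ≤ kerMax m φ b x} := hMb measurableSet_Ici
  rw [Measure.restrict_apply hms] at hmb
  rw [← hEc]
  refine (measure_mono hsub).trans ((measure_union_le _ _).trans
    ((add_le_add ((measure_union_le _ _).trans (add_le_add le_rfl hmg)) hmb).trans (le_of_eq ?_)))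
  have e1 : ENNReal.ofReal ((l / 2) ^ 2)⁻¹ * ENNReal.ofReal ((C * l) ^ 2) =
      ENNReal.ofReal (4 * C ^ 2) := by
    rw [← ENNReal.ofReal_mul (by positivity)]
    congr 1
    field_simp
    norm_num
  have e2 : ENNReal.ofReal ((l / 2) ^ 2)⁻¹ * ENNReal.ofReal (C₁ ^ 2) =
      ENNReal.ofReal (4 * C₁ ^ 2) * ENNReal.ofReal (l⁻¹ ^ 2) := by
    rw [← ENNReal.ofReal_mul (by positivity), ← ENNReal.ofReal_mul (by positivity)]
    congr 1
    field_simp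
    norm_num
  have e3 : ENNReal.ofReal (l / 2)⁻¹ * ENNReal.ofReal (C₄ * l) = ENNReal.ofReal (2 * C₄) := by
    rw [← ENNReal.ofReal_mul (by positivity)]
    congr 1
    field_simp
  set I := ∫⁻ x, (if G x ≤ ENNReal.ofReal l then G x ^ (2 : ℝ) else 0)
  calc _ = volume Eᶜ + (ENNReal.ofReal ((l / 2) ^ 2)⁻¹ * ENNReal.ofReal ((C * l) ^ 2) * C₃ *
        volume Eᶜ + ENNReal.ofReal ((l / 2) ^ 2)⁻¹ * ENNReal.ofReal (C₁ ^ 2) * C₃ * I) +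
        ENNReal.ofReal (l / 2)⁻¹ * ENNReal.ofReal (C₄ * l) * C₅ * volume Eᶜ := by ring
    _ = _ := by rw [e1, e2, e3]; ring

theorem HomSymbol.exists_setLIntegral_kerMax_le (hN0 : N ≠ 0) (hφ : GoodPhi φ)
    (hm : HomSymbol m) {r p : ℝ} (hr0 : 0 < r) (hr1 : r ≤ 1) (hp0 : 0 < p) (hp : p < 2) :
    ∃ C : ℝ≥0∞, C ≠ ⊤ ∧ ∀ (x₀ : RN N) (ℓ : ℝ), 0 < ℓ → ∀ f : RN N → ℂ,
      ContDiff ℝ (⊤ : ℕ∞) f → (∀ y, f y ≠ 0 → dist y x₀ ≤ ℓ) →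
        ∫⁻ x in ball x₀ (2 * ℓ), kerMax m φ f x ^ p ≤ C * ∫⁻ x, gMax φ r ℓ f x ^ p := by
  obtain ⟨A, B, hA, hB, h⟩ := hm.exists_meas_kerMax_le hN0 hφ hr0 hr1
  refine ⟨1 + A + ENNReal.ofReal p * B * ENNReal.ofReal (2 - p)⁻¹, ?_,
    fun x₀ ℓ hℓ f hf hsupp => ?_⟩
  · exact ENNReal.add_ne_top.2 ⟨ENNReal.add_ne_top.2 ⟨ENNReal.one_ne_top, hA⟩,
      ENNReal.mul_ne_top (ENNReal.mul_ne_top ENNReal.ofReal_ne_top hB) ENNReal.ofReal_ne_top⟩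
  have hfc : HasCompactSupport f := hasCompactSupport_of_eq_zero (w := x₀) (ρ := ℓ) fun y hy => by
    by_contra h0
    exact absurd (hsupp y h0) (not_le.2 hy)
  have hMm : Measurable (kerMax m φ f) :=
    (hm.lowerSemicontinuous_kerMax hN0 hφ hf.continuous hfc).measurable
  obtain ⟨c, hc⟩ := hf.continuous.bounded_above_of_compact_support hfc
  have hgood := lintegral_rpow_le_of_good_level (volume : Measure (RN N))
    (F := (ball x₀ (2 * ℓ)).indicator (kerMax m φ f)) (G := gMax φ r ℓ f)
    (hMm.indicator measurableSet_ball) (fun x => by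
      by_cases hx : x ∈ ball x₀ (2 * ℓ)
      · rw [indicator_of_mem hx]; exact hm.kerMax_ne_top hN0 hφ hf hfc x
      · rw [indicator_of_notMem hx]; exact ENNReal.zero_ne_top)
    (measurable_gMax hr0 ℓ f)
    (fun x => ne_top_of_le_ne_top ENNReal.ofReal_ne_top (gMax_le hφ hr0 ℓ hc x)) hp0 hp (1 + A) B
    (fun l hl => by
      by_cases hball : ball x₀ (2 * ℓ) ⊆ {x | ENNReal.ofReal l < gMax φ r ℓ f x}
      · refine le_add_right ?_
        rw [add_mul, one_mul]
        refine le_add_right (measure_mono fun x hx => hball ?_)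
        by_contra hxb
        rw [mem_ofPred_eq, indicator_of_notMem hxb] at hx
        exact not_lt_zero hx
      · obtain ⟨x₁, hx₁, hx₁'⟩ := not_subset.1 hball
        rw [mem_ofPred_eq, not_lt] at hx₁'
        refine (measure_mono fun x hx => ?_).trans ((h ℓ hℓ f hf hfc l hl ⟨x₁, hx₁'⟩
          fun y hy => ?_).trans (add_le_add (mul_le_mul_left le_add_self _) le_rfl))
        · exact lt_of_lt_of_le (mem_ofPred_eq ▸ hx) (indicator_le_self _ _ x)
        · refine (infDist_le_dist_of_mem (y := x₁) hx₁').trans ?_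
          have h1 := dist_triangle_right y x₁ x₀
          have h2 := hsupp y hy
          have h3 := mem_ball.1 hx₁
          linarith)
  refine le_trans (le_of_eq ?_) hgood
  rw [← lintegral_indicator measurableSet_ball]
  refine lintegral_congr fun x => ?_
  by_cases hx : x ∈ ball x₀ (2 * ℓ)
  · rw [indicator_of_mem hx, indicator_of_mem hx]
  · rw [indicator_of_notMem hx, indicator_of_notMem hx, ENNReal.zero_rpow_of_pos hp0]

end calderonZygmund

/-! ### The `L^p` maximal estimate for systems of multipliers -/

section systems

open scoped FourierTransform

variable {φ : RN N → ℝ}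

theorem sum_rpow_le {ι : Type*} (s : Finset ι) (a : ι → ℝ≥0∞) {p : ℝ} (hp : 0 < p) :
    (∑ i ∈ s, a i) ^ p ≤ (s.card : ℝ≥0∞) ^ p * ∑ i ∈ s, a i ^ p := by
  rcases s.eq_empty_or_nonempty with rfl | hs
  · simp [hp]
  obtain ⟨i, hi, h⟩ := s.exists_max_image a hs
  calc (∑ i ∈ s, a i) ^ p ≤ (s.card * a i) ^ p := by
        refine ENNReal.rpow_le_rpow ?_ hp.le
        simpa using Finset.sum_le_card_nsmul s a (a i) h
    _ = (s.card : ℝ≥0∞) ^ p * a i ^ p := ENNReal.mul_rpow_of_nonneg _ _ hp.le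
    _ ≤ _ := by
        gcongr
        exact Finset.single_le_sum (f := fun i => a i ^ p) (fun _ _ => zero_le) hi

theorem hasCompactSupport_of_dist_le {w : RN N → ℂ} {x₀ : RN N} {ℓ : ℝ}
    (hw : ∀ y, w y ≠ 0 → dist y x₀ ≤ ℓ) : HasCompactSupport w :=
  hasCompactSupport_of_eq_zero (w := x₀) (ρ := ℓ) fun y hy => by
    by_contra h
    exact absurd (hw y h) (not_le.2 hy)

theorem convAt_eq_zero_of_notMem (hφ : GoodPhi φ) {x₀ x : RN N} {ℓ t : ℝ} (ht : t ∈ Ioo 0 ℓ)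
    {w : RN N → ℂ} (hw : ∀ y, w y ≠ 0 → dist y x₀ ≤ ℓ) (hx : x ∉ ball x₀ (2 * ℓ)) :
    convAt φ t w x = 0 := by
  refine norm_le_zero_iff.1 (norm_convAt_le hφ ht.1 fun y hy => ?_)
  by_contra h
  have h1 := hw y (by rintro h0; simp [h0] at h)
  have h2 := dist_triangle_left x x₀ y
  have h3 : 2 * ℓ ≤ dist x x₀ := by simpa using hx
  have := ht.2
  linarith

theorem locMax_eq_zero_of_notMem (hφ : GoodPhi φ) {x₀ x : RN N} {ℓ : ℝ} {w : RN N → ℂ}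
    (hw : ∀ y, w y ≠ 0 → dist y x₀ ≤ ℓ) (hx : x ∉ ball x₀ (2 * ℓ)) : locMax φ ℓ w x = 0 := by
  simp only [locMax, ENNReal.iSup_eq_zero]
  intro t ht
  rw [convAt_eq_zero_of_notMem hφ ht hw hx, enorm_zero]

theorem lintegral_locMax_eq_setLIntegral (hφ : GoodPhi φ) {x₀ : RN N} {ℓ p : ℝ} (hp : 0 < p)
    {w : RN N → ℂ} (hw : ∀ y, w y ≠ 0 → dist y x₀ ≤ ℓ) :
    ∫⁻ x, locMax φ ℓ w x ^ p = ∫⁻ x in ball x₀ (2 * ℓ), locMax φ ℓ w x ^ p := by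
  rw [setLIntegral_eq_of_support_subset]
  intro x hx
  by_contra h
  exact hx (by simp [locMax_eq_zero_of_notMem hφ hw h, hp])

theorem locMax_le_sum_kerMax {ι : Type*} [Fintype ι] {m : ι → RN N → ℂ} {ℓ : ℝ} {w : RN N → ℂ}
    {f : ι → RN N → ℂ} (h : ∀ t, 0 < t → ∀ x,
      convAt φ t w x = ∑ j, ∫ y, f j y * mulKer (m j) φ t (x - y)) (x : RN N) :
    locMax φ ℓ w x ≤ ∑ j, kerMax (m j) φ (f j) x := by
  refine iSup₂_le fun t ht => ?_
  rw [h t ht.1]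
  refine (enorm_sum_le _ _).trans (Finset.sum_le_sum fun j _ => ?_)
  exact le_iSup₂ (f := fun t (_ : t ∈ Ioi (0 : ℝ)) =>
    ‖∫ y, f j y * mulKer (m j) φ t (x - y)‖ₑ) t ht.1

theorem lintegral_locMax_rpow_le (hN0 : N ≠ 0) (hφ : GoodPhi φ) {p : ℝ} (hp : 1 < p) :
    ∃ C : ℝ≥0∞, C ≠ ⊤ ∧ ∀ (ℓ : ℝ) (w : RN N → ℂ), Continuous w → HasCompactSupport w →
      ∫⁻ x, locMax φ ℓ w x ^ p ≤ C * ∫⁻ x, ‖w x‖ₑ ^ p := by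
  obtain ⟨C, hC, h⟩ := hφ.exists_enorm_convAt_le_hlMax
  obtain ⟨D, hD, h2⟩ := hlMax_strong_type (N := N) hN0 p hp
  have hp0 : 0 ≤ p := by linarith
  have hCp : C ^ p ≠ ⊤ := ENNReal.rpow_ne_top_of_nonneg hp0 hC
  refine ⟨C ^ p * D, ENNReal.mul_ne_top hCp hD, fun ℓ w hw hwc => ?_⟩
  obtain ⟨c, hc⟩ := hw.bounded_above_of_compact_support hwc
  calc _ ≤ ∫⁻ x, C ^ p * hlMax (fun y => ‖w y‖ₑ) x ^ p := by
        refine lintegral_mono fun x => ?_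
        rw [← ENNReal.mul_rpow_of_nonneg _ _ hp0]
        exact ENNReal.rpow_le_rpow (iSup₂_le fun t ht => h w x t ht.1) hp0
    _ = C ^ p * ∫⁻ x, hlMax (fun y => ‖w y‖ₑ) x ^ p := lintegral_const_mul' _ _ hCp
    _ ≤ C ^ p * (D * ∫⁻ x, ‖w x‖ₑ ^ p) := by
        gcongr
        refine h2 _ hw.enorm.measurable ⟨ENNReal.ofReal c, ENNReal.ofReal_ne_top, fun x => ?_⟩
        rw [← ofReal_norm]
        exact ENNReal.ofReal_le_ofReal (hc x)
    _ = _ := (mul_assoc _ _ _).symm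

theorem mulKer_comp_neg (hφ : GoodPhi φ) (m : RN N → ℂ) (t : ℝ) (z : RN N) :
    mulKer (fun ξ => m (-ξ)) φ t z = mulKer m φ t (-z) := by
  have h := fourier_comp_const_sub (fun ξ => m ξ * 𝓕 (dilC φ 1) (t • ξ)) 0 z
  simp only [zero_sub, inner_zero_left, neg_zero, AddChar.map_zero_eq_one, one_smul] at h
  rw [mulKer, mulKer, ← h]
  simp only [smul_neg, hφ.fourier_dilC_neg]

/-- Duality between a multiplier and its reflection. -/
theorem HomSymbol.enorm_integral_mul_le (hN0 : N ≠ 0) (hφ : GoodPhi φ) {m : RN N → ℂ}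
    (hm : HomSymbol m) {f g : RN N → ℂ} (hf : Continuous f) (hfc : HasCompactSupport f)
    (hg : Continuous g) (hgc : HasCompactSupport g) {t : ℝ} (ht : 0 < t) :
    ‖∫ x, (∫ y, f y * mulKer m φ t (x - y)) * g x‖ₑ ≤
      ∫⁻ y, ‖f y‖ₑ * kerMax (fun ξ => m (-ξ)) φ g y := by
  have hk := (contDiff_mulKer hN0 hφ hm ht).continuous
  have hint : Integrable (fun q : RN N × RN N => f q.2 * mulKer m φ t (q.1 - q.2) * g q.1)
      (volume.prod volume) := by
    refine Continuous.integrable_of_hasCompactSupport ?_ ?_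
    · exact ((hf.comp continuous_snd).mul (hk.comp (continuous_fst.sub continuous_snd))).mul
        (hg.comp continuous_fst)
    · refine HasCompactSupport.intro (hgc.isCompact.prod hfc.isCompact) fun q hq => ?_
      rcases not_and_or.1 (fun h => hq (mem_prod.2 h)) with h | h
      · rw [image_eq_zero_of_notMem_tsupport h, mul_zero]
      · rw [image_eq_zero_of_notMem_tsupport h, zero_mul, zero_mul]
  have e : ∫ x, (∫ y, f y * mulKer m φ t (x - y)) * g x =
      ∫ y, f y * ∫ x, g x * mulKer (fun ξ => m (-ξ)) φ t (y - x) := by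
    simp only [← integral_mul_const, ← integral_const_mul]
    rw [integral_integral_swap hint]
    refine integral_congr_ae (Eventually.of_forall fun y => integral_congr_ae
      (Eventually.of_forall fun x => ?_))
    simp only [mulKer_comp_neg hφ, neg_sub]
    ring
  rw [e]
  refine (enorm_integral_le_lintegral_enorm _).trans (lintegral_mono fun y => ?_)
  rw [enorm_mul]
  gcongr
  exact le_iSup₂ (f := fun t (_ : t ∈ Ioi (0 : ℝ)) =>
    ‖∫ x, g x * mulKer (fun ξ => m (-ξ)) φ t (y - x)‖ₑ) t ht

theorem enorm_integral_mul_le_sum_kerMax (hN0 : N ≠ 0) (hφ : GoodPhi φ) {ι : Type*} [Fintype ι]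
    {m : ι → RN N → ℂ} (hm : ∀ j, HomSymbol (m j)) {w g : RN N → ℂ} {f : ι → RN N → ℂ}
    (hw : Continuous w) (hwc : HasCompactSupport w) (hg : Continuous g) (hgc : HasCompactSupport g)
    (hf : ∀ j, Continuous (f j)) (hfc : ∀ j, HasCompactSupport (f j))
    (h : ∀ t, 0 < t → ∀ x, convAt φ t w x = ∑ j, ∫ y, f j y * mulKer (m j) φ t (x - y)) :
    ‖∫ x, w x * g x‖ₑ ≤ ∑ j, ∫⁻ y, ‖f j y‖ₑ * kerMax (fun ξ => m j (-ξ)) φ g y := by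
  obtain ⟨c, hc⟩ := hw.bounded_above_of_compact_support hwc
  have hlim : Tendsto (fun t => ∫ x, convAt φ t w x * g x) (𝓝[>] 0) (𝓝 (∫ x, w x * g x)) := by
    refine tendsto_integral_filter_of_dominated_convergence (fun x => c * ‖g x‖) ?_ ?_ ?_ ?_
    · filter_upwards [self_mem_nhdsWithin] with t ht
      exact ((continuous_convAt hφ ht hw).mul hg).aestronglyMeasurable
    · filter_upwards [self_mem_nhdsWithin] with t ht
      refine Eventually.of_forall fun x => ?_
      rw [norm_mul]
      exact mul_le_mul_of_nonneg_right (norm_convAt_le hφ ht fun y _ => hc y) (norm_nonneg _)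
    · exact (hg.integrable_of_hasCompactSupport hgc).norm.const_mul c
    · exact Eventually.of_forall fun x => (tendsto_convAt hφ hw x).mul_const _
  refine le_of_tendsto hlim.enorm ?_
  filter_upwards [self_mem_nhdsWithin] with t ht
  have hi : ∀ j, Integrable fun x => (∫ y, f j y * mulKer (m j) φ t (x - y)) * g x := fun j =>
    (((hm j).continuous_integral_mul_mulKer hN0 hφ (hf j) (hfc j) ht).mul hg)
      |>.integrable_of_hasCompactSupport hgc.mul_left
  simp only [h t ht, Finset.sum_mul]
  rw [integral_finsetSum _ fun j _ => hi j]
  exact (enorm_sum_le _ _).trans (Finset.sum_le_sum fun j _ =>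
    (hm j).enorm_integral_mul_le hN0 hφ (hf j) (hfc j) hg hgc ht)

/-- A smooth dual function for the `L^p` norm. -/
theorem exists_dual_function {p q : ℝ} (hpq : p.HolderConjugate q) (hp : 2 < p) {x₀ : RN N} {ℓ : ℝ}
    {w : RN N → ℂ} (hw : ContDiff ℝ (⊤ : ℕ∞) w) (hws : ∀ y, w y ≠ 0 → dist y x₀ ≤ ℓ)
    (hX : ∫⁻ x, ‖w x‖ₑ ^ p ≠ 0) :
    ∃ g : RN N → ℂ, ContDiff ℝ (⊤ : ℕ∞) g ∧ (∀ y, g y ≠ 0 → dist y x₀ ≤ ℓ) ∧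
      ∫⁻ x, ‖w x‖ₑ ^ p ≤ ‖∫ x, w x * g x‖ₑ ∧
      ∫⁻ x, ‖g x‖ₑ ^ q ≤ ENNReal.ofReal (2 * 2 ^ (p / 2)) * ∫⁻ x, ‖w x‖ₑ ^ p := by
  have hwc := hasCompactSupport_of_dist_le hws
  obtain ⟨c, hc⟩ := hw.continuous.bounded_above_of_compact_support hwc
  have hp0 : 0 < p := by linarith
  set X := ∫⁻ x, ‖w x‖ₑ ^ p with hXdef
  obtain ⟨ε, hε, hεX⟩ : ∃ ε : ℝ, 0 < ε ∧
      ENNReal.ofReal (ε ^ (p / 2)) * volume (closedBall x₀ ℓ) ≤ X := by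
    rcases eq_or_ne X ⊤ with hT | hT
    · exact ⟨1, one_pos, by rw [hT]; exact le_top⟩
    obtain ⟨V, hV0, hV⟩ : ∃ V : ℝ, 0 ≤ V ∧ volume (closedBall x₀ ℓ) = ENNReal.ofReal V :=
      ⟨_, ENNReal.toReal_nonneg, (ENNReal.ofReal_toReal measure_closedBall_lt_top.ne).symm⟩
    obtain ⟨Y, hY0, hY⟩ : ∃ Y : ℝ, 0 < Y ∧ X = ENNReal.ofReal Y :=
      ⟨_, ENNReal.toReal_pos hX hT, (ENNReal.ofReal_toReal hT).symm⟩
    refine ⟨(Y / (V + 1)) ^ (2 / p), by positivity, ?_⟩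
    rw [← Real.rpow_mul (by positivity), show 2 / p * (p / 2) = 1 by field_simp, Real.rpow_one, hV,
      hY, ← ENNReal.ofReal_mul (by positivity)]
    refine ENNReal.ofReal_le_ofReal ?_
    rw [div_mul_eq_mul_div, div_le_iff₀ (by positivity)]
    exact mul_le_mul_of_nonneg_left (by linarith) hY0.le
  have hbase : ∀ x, 0 < ‖w x‖ ^ 2 + ε := fun x => by positivity
  have hsm : ContDiff ℝ (⊤ : ℕ∞) fun x => (‖w x‖ ^ 2 + ε) ^ ((p - 2) / 2) :=
    ((hw.norm_sq ℝ).add contDiff_const).rpow_const_of_ne fun x => (hbase x).ne'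
  set ρ : RN N → ℝ := fun x => (‖w x‖ ^ 2 + ε) ^ ((p - 2) / 2) with hρ
  have hρ0 : ∀ x, 0 ≤ ρ x := fun x => by positivity
  have hg : ContDiff ℝ (⊤ : ℕ∞) fun x => (starRingEnd ℂ) (w x) * (ρ x : ℂ) :=
    (Complex.conjCLE.contDiff.comp hw).mul (Complex.ofRealCLM.contDiff.comp hsm)
  refine ⟨fun x => (starRingEnd ℂ) (w x) * (ρ x : ℂ), hg, fun y hy => hws y ?_, ?_, ?_⟩
  · rintro h
    simp [h] at hy
  · have e : ∀ x, w x * ((starRingEnd ℂ) (w x) * (ρ x : ℂ)) = ((‖w x‖ ^ 2 * ρ x : ℝ) : ℂ) := by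
      intro x
      rw [← mul_assoc, Complex.mul_conj, Complex.normSq_eq_norm_sq]
      push_cast
      rfl
    simp only [e]
    rw [integral_complex_ofReal, ← ofReal_norm, Complex.norm_real, Real.norm_of_nonneg
      (integral_nonneg fun x => by have := hρ0 x; positivity), ofReal_integral_eq_lintegral_ofReal]
    · refine lintegral_mono fun x => ?_
      rw [← ofReal_norm, ENNReal.ofReal_rpow_of_nonneg (norm_nonneg _) hp0.le]
      refine ENNReal.ofReal_le_ofReal ?_
      rcases eq_or_ne ‖w x‖ 0 with h0 | h0
      · rw [h0, Real.zero_rpow hp0.ne']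
        simp
      have hpos : 0 < ‖w x‖ := lt_of_le_of_ne (norm_nonneg _) h0.symm
      calc ‖w x‖ ^ p = ‖w x‖ ^ 2 * (‖w x‖ ^ 2) ^ ((p - 2) / 2) := by
            rw [← Real.rpow_natCast, ← Real.rpow_mul hpos.le, ← Real.rpow_add hpos]
            congr 1
            push_cast
            ring
        _ ≤ _ := by
            refine mul_le_mul_of_nonneg_left ?_ (by positivity)
            exact Real.rpow_le_rpow (by positivity) (by linarith) (by linarith)
    · refine Continuous.integrable_of_hasCompactSupport
        ((hw.continuous.norm.pow 2).mul hsm.continuous) ?_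
      refine HasCompactSupport.intro hwc.isCompact fun x hx => ?_
      simp [image_eq_zero_of_notMem_tsupport hx]
    · exact Eventually.of_forall fun x => by have := hρ0 x; positivity
  · have hpt : ∀ x, ‖(starRingEnd ℂ) (w x) * (ρ x : ℂ)‖ₑ ^ q ≤ ENNReal.ofReal (2 ^ (p / 2)) *
        (‖w x‖ₑ ^ p + (closedBall x₀ ℓ).indicator (fun _ => ENNReal.ofReal (ε ^ (p / 2))) x) := by
      intro x
      by_cases hx : w x = 0
      · simp [hx, hpq.symm.pos]
      rw [indicator_of_mem (mem_closedBall.2 (hws x hx)), ← ofReal_norm, ← ofReal_norm,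
        ENNReal.ofReal_rpow_of_nonneg (norm_nonneg _) hp0.le,
        ENNReal.ofReal_rpow_of_nonneg (norm_nonneg _) hpq.symm.nonneg,
        ← ENNReal.ofReal_add (by positivity) (by positivity), ← ENNReal.ofReal_mul (by positivity)]
      refine ENNReal.ofReal_le_ofReal ?_
      rw [norm_mul, RCLike.norm_conj, Complex.norm_real, Real.norm_of_nonneg (hρ0 x)]
      have h1 : ‖w x‖ ≤ (‖w x‖ ^ 2 + ε) ^ ((1 : ℝ) / 2) := by
        rw [← Real.sqrt_eq_rpow]
        exact Real.le_sqrt_of_sq_le (by linarith)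
      have h2 : ‖w x‖ * ρ x ≤ (‖w x‖ ^ 2 + ε) ^ ((p - 1) / 2) := by
        calc _ ≤ (‖w x‖ ^ 2 + ε) ^ ((1 : ℝ) / 2) * ρ x := mul_le_mul_of_nonneg_right h1 (hρ0 x)
          _ = _ := by
            rw [hρ, ← Real.rpow_add (hbase x)]
            congr 1
            ring
      calc (‖w x‖ * ρ x) ^ q ≤ ((‖w x‖ ^ 2 + ε) ^ ((p - 1) / 2)) ^ q :=
            Real.rpow_le_rpow (mul_nonneg (norm_nonneg _) (hρ0 x)) h2 hpq.symm.nonneg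
        _ = (‖w x‖ ^ 2 + ε) ^ (p / 2) := by
            rw [← Real.rpow_mul (hbase x).le]
            congr 1
            have := hpq.sub_one_mul_conj
            linarith
        _ ≤ (2 * max (‖w x‖ ^ 2) ε) ^ (p / 2) := by
            refine Real.rpow_le_rpow (hbase x).le ?_ (by positivity)
            have := le_max_left (‖w x‖ ^ 2) ε
            have := le_max_right (‖w x‖ ^ 2) ε
            linarith
        _ = 2 ^ (p / 2) * (max (‖w x‖ ^ 2) ε) ^ (p / 2) :=
            Real.mul_rpow (by norm_num) (by positivity)
        _ ≤ _ := by
            refine mul_le_mul_of_nonneg_left ?_ (by positivity)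
            have e1 : (‖w x‖ ^ 2) ^ (p / 2) = ‖w x‖ ^ p := by
              rw [← Real.rpow_natCast, ← Real.rpow_mul (norm_nonneg _)]
              congr 1
              push_cast
              ring
            have := Real.rpow_nonneg (norm_nonneg (w x)) p
            have := Real.rpow_nonneg hε.le (p / 2)
            rcases le_total (‖w x‖ ^ 2) ε with h | h
            · rw [max_eq_right h]; linarith
            · rw [max_eq_left h, e1]; linarith
    calc _ ≤ _ := lintegral_mono hpt
      _ = ENNReal.ofReal (2 ^ (p / 2)) *
          (X + ENNReal.ofReal (ε ^ (p / 2)) * volume (closedBall x₀ ℓ)) := by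
        rw [lintegral_const_mul' _ _ ENNReal.ofReal_ne_top, lintegral_add_right _
          (measurable_const.indicator measurableSet_closedBall),
          lintegral_indicator measurableSet_closedBall, lintegral_const,
          Measure.restrict_apply_univ]
      _ ≤ ENNReal.ofReal (2 ^ (p / 2)) * (X + X) := by gcongr
      _ = _ := by
        rw [mul_comm (2 : ℝ), ENNReal.ofReal_mul (by positivity), mul_assoc]
        congr 1
        simp [two_mul]

end systems

section systemsLp

variable {φ : RN N → ℝ}

/-- `w` is the image of the family `f` under the multipliers `m`, tested against `φ`. -/
def IsTransform {ι : Type*} [Fintype ι] (φ : RN N → ℝ) (m : ι → RN N → ℂ) (f : ι → RN N → ℂ)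
    (w : RN N → ℂ) : Prop :=
  ∀ t, 0 < t → ∀ x, convAt φ t w x = ∑ j, ∫ y, f j y * mulKer (m j) φ t (x - y)

variable {ι : Type*} [Fintype ι] {m : ι → RN N → ℂ}

theorem lintegral_locMax_le_of_kerMax (hN0 : N ≠ 0) (hφ : GoodPhi φ) (hm : ∀ j, HomSymbol (m j))
    {p : ℝ} (hp0 : 0 < p) {x₀ : RN N} {ℓ : ℝ} {w : RN N → ℂ} (hws : ∀ y, w y ≠ 0 → dist y x₀ ≤ ℓ)
    {f : ι → RN N → ℂ} (hf : ∀ j, Continuous (f j)) (hfc : ∀ j, HasCompactSupport (f j))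
    (h : IsTransform φ m f w) {C : ℝ≥0∞}
    (hC : ∀ j, ∫⁻ x in ball x₀ (2 * ℓ), kerMax (m j) φ (f j) x ^ p ≤
      C * ∫⁻ x, locMax φ ℓ (f j) x ^ p) :
    ∫⁻ x, locMax φ ℓ w x ^ p ≤
      (Fintype.card ι : ℝ≥0∞) ^ p * C * ∑ j, ∫⁻ x, locMax φ ℓ (f j) x ^ p := by
  rw [lintegral_locMax_eq_setLIntegral hφ hp0 hws]
  have hcard : (Fintype.card ι : ℝ≥0∞) ^ p ≠ ⊤ :=
    ENNReal.rpow_ne_top_of_nonneg hp0.le (ENNReal.natCast_ne_top _)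
  have hmeas : ∀ j, Measurable fun x => kerMax (m j) φ (f j) x ^ p := fun j =>
    ((hm j).lowerSemicontinuous_kerMax hN0 hφ (hf j) (hfc j)).measurable.pow_const p
  calc _ ≤ ∫⁻ x in ball x₀ (2 * ℓ), (Fintype.card ι : ℝ≥0∞) ^ p *
        ∑ j, kerMax (m j) φ (f j) x ^ p := by
        refine lintegral_mono fun x => ?_
        exact (ENNReal.rpow_le_rpow (locMax_le_sum_kerMax h x) hp0.le).trans (sum_rpow_le _ _ hp0)
    _ = (Fintype.card ι : ℝ≥0∞) ^ p *
        ∑ j, ∫⁻ x in ball x₀ (2 * ℓ), kerMax (m j) φ (f j) x ^ p := by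
        rw [lintegral_const_mul' _ _ hcard, lintegral_finsetSum _ fun j _ => hmeas j]
    _ ≤ (Fintype.card ι : ℝ≥0∞) ^ p * ∑ j, C * ∫⁻ x, locMax φ ℓ (f j) x ^ p := by
        gcongr with j
        exact hC j
    _ = _ := by rw [← Finset.mul_sum, mul_assoc]

theorem lintegral_enorm_le_locMax (hφ : GoodPhi φ) {ℓ : ℝ} (hℓ : 0 < ℓ) {p : ℝ} (hp0 : 0 ≤ p)
    {f : RN N → ℂ} (hf : Continuous f) :
    ∫⁻ x, ‖f x‖ₑ ^ p ≤ ∫⁻ x, locMax φ ℓ f x ^ p :=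
  lintegral_mono fun x => ENNReal.rpow_le_rpow (enorm_le_locMax hφ hℓ hf x) hp0

theorem exists_lintegral_enorm_le_sum (hN0 : N ≠ 0) (hφ : GoodPhi φ) (hm : ∀ j, HomSymbol (m j))
    {p : ℝ} (hp : 2 < p) : ∃ C : ℝ≥0∞, C ≠ ⊤ ∧ ∀ (x₀ : RN N) (ℓ : ℝ), 0 < ℓ →
      ∀ w : RN N → ℂ, ContDiff ℝ (⊤ : ℕ∞) w → (∀ y, w y ≠ 0 → dist y x₀ ≤ ℓ) →
      ∀ f : ι → RN N → ℂ, (∀ j, ContDiff ℝ (⊤ : ℕ∞) (f j)) →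
        (∀ j y, f j y ≠ 0 → dist y x₀ ≤ ℓ) → IsTransform φ m f w →
        ∫⁻ x, ‖w x‖ₑ ^ p ≤ C * ∑ j, ∫⁻ x, ‖f j x‖ₑ ^ p := by
  have hp0 : 0 < p := by linarith
  have hpq : p.HolderConjugate (Real.conjExponent p) := .conjExponent (by linarith)
  set q := Real.conjExponent p with hq
  have hq0 : 0 < q := hpq.symm.pos
  have hq1 : 1 < q := hpq.symm.lt
  have hq2 : q < 2 := by
    rw [hq, Real.conjExponent, div_lt_iff₀ (by linarith)]
    linarith
  choose A hA hA' using fun j => (hm j).comp_neg.exists_setLIntegral_kerMax_le hN0 hφ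
    (r := 1 / 2) (by norm_num) (by norm_num) hq0 hq2
  obtain ⟨B, hB, hB'⟩ := lintegral_gMax_rpow_le hN0 hφ (r := 1 / 2) (p := q) (by norm_num)
    (by linarith)
  obtain ⟨D, hD, hD'⟩ := lintegral_locMax_rpow_le hN0 hφ hq1
  set K : ℝ≥0∞ := (∑ j, A j) * (B * (D * ENNReal.ofReal (2 * 2 ^ (p / 2)))) with hK
  have hKtop : K ≠ ⊤ := by
    have : ∑ j, A j ≠ ⊤ := ENNReal.sum_ne_top.2 fun j _ => hA j
    finiteness
  refine ⟨(K ^ (1 / q)) ^ p * (Fintype.card ι : ℝ≥0∞) ^ p,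
    ENNReal.mul_ne_top (ENNReal.rpow_ne_top_of_nonneg hp0.le
      (ENNReal.rpow_ne_top_of_nonneg (by positivity) hKtop))
    (ENNReal.rpow_ne_top_of_nonneg hp0.le (ENNReal.natCast_ne_top _)),
    fun x₀ ℓ hℓ w hw hws f hf hfs h => ?_⟩
  set X := ∫⁻ x, ‖w x‖ₑ ^ p with hX
  rcases eq_or_ne X 0 with hX0 | hX0
  · rw [hX0]; exact zero_le
  have hwc := hasCompactSupport_of_dist_le hws
  have hXtop : X ≠ ⊤ := by
    obtain ⟨c, hc⟩ := hw.continuous.bounded_above_of_compact_support hwc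
    have hle : X ≤ ∫⁻ x, (closedBall x₀ ℓ).indicator (fun _ => ENNReal.ofReal c ^ p) x := by
      refine lintegral_mono fun x => ?_
      by_cases hx : w x = 0
      · simp [hx, hp0]
      rw [indicator_of_mem (mem_closedBall.2 (hws x hx)), ← ofReal_norm]
      exact ENNReal.rpow_le_rpow (ENNReal.ofReal_le_ofReal (hc x)) hp0.le
    refine ne_top_of_le_ne_top ?_ hle
    rw [lintegral_indicator measurableSet_closedBall, lintegral_const, Measure.restrict_apply_univ]
    exact ENNReal.mul_ne_top (ENNReal.rpow_ne_top_of_nonneg hp0.le ENNReal.ofReal_ne_top)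
      measure_closedBall_lt_top.ne
  obtain ⟨g, hg, hgs, hXg, hgq⟩ := exists_dual_function hpq hp hw hws hX0
  have hgc := hasCompactSupport_of_dist_le hgs
  have hfc := fun j => hasCompactSupport_of_dist_le (hfs j)
  have hker : ∀ j, ∫⁻ x in ball x₀ (2 * ℓ), kerMax (fun ξ => m j (-ξ)) φ g x ^ q ≤ K * X := by
    intro j
    calc _ ≤ A j * ∫⁻ x, gMax φ (1 / 2) ℓ g x ^ q := hA' j x₀ ℓ hℓ g hg hgs
      _ ≤ (∑ j, A j) * (B * (D * (ENNReal.ofReal (2 * 2 ^ (p / 2)) * X))) := by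
        gcongr
        · exact Finset.single_le_sum (fun _ _ => zero_le) (Finset.mem_univ j)
        · refine (hB' ℓ g hg.continuous hgc).trans ?_
          gcongr
          refine (hD' ℓ g hg.continuous hgc).trans ?_
          gcongr
      _ = _ := by rw [hK]; ring
  have hterm : ∀ j, ∫⁻ y, ‖f j y‖ₑ * kerMax (fun ξ => m j (-ξ)) φ g y ≤
      (∫⁻ y, ‖f j y‖ₑ ^ p) ^ (1 / p) * (K * X) ^ (1 / q) := by
    intro j
    have hkm := ((hm j).comp_neg.lowerSemicontinuous_kerMax hN0 hφ hg.continuous hgc).measurable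
    have e : ∫⁻ y, ‖f j y‖ₑ * kerMax (fun ξ => m j (-ξ)) φ g y =
        ∫⁻ y in ball x₀ (2 * ℓ), ‖f j y‖ₑ * kerMax (fun ξ => m j (-ξ)) φ g y := by
      rw [setLIntegral_eq_of_support_subset]
      intro y hy
      have : f j y ≠ 0 := by rintro h0; simp [h0] at hy
      rw [mem_ball]
      linarith [hfs j y this]
    rw [e]
    refine (ENNReal.lintegral_mul_le_Lp_mul_Lq _ hpq (hf j).continuous.enorm.aemeasurable
      hkm.aemeasurable).trans ?_
    refine mul_le_mul' (ENNReal.rpow_le_rpow (setLIntegral_le_lintegral _ _) (by positivity))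
      (ENNReal.rpow_le_rpow (hker j) (by positivity))
  have hmain : X ≤ (∑ j, (∫⁻ y, ‖f j y‖ₑ ^ p) ^ (1 / p)) * (K ^ (1 / q)) * X ^ (1 / q) := by
    calc X ≤ _ := hXg
      _ ≤ _ := enorm_integral_mul_le_sum_kerMax hN0 hφ hm hw.continuous hwc hg.continuous hgc
        (fun j => (hf j).continuous) hfc h
      _ ≤ _ := Finset.sum_le_sum fun j _ => hterm j
      _ = _ := by
        rw [← Finset.sum_mul, ENNReal.mul_rpow_of_nonneg _ _ (by positivity), mul_assoc]
  have hXq0 : X ^ (1 / q) ≠ 0 := by simp [hX0, hXtop]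
  have hXqt : X ^ (1 / q) ≠ ⊤ := ENNReal.rpow_ne_top_of_nonneg (by positivity) hXtop
  have hXp : X ^ (1 / p) ≤ (∑ j, (∫⁻ y, ‖f j y‖ₑ ^ p) ^ (1 / p)) * (K ^ (1 / q)) := by
    have e : X = X ^ (1 / p) * X ^ (1 / q) := by
      rw [← ENNReal.rpow_add _ _ hX0 hXtop, one_div, one_div, hpq.inv_add_inv_eq_one,
        ENNReal.rpow_one]
    rw [← ENNReal.mul_le_mul_iff_left hXq0 hXqt]
    rwa [← e]
  calc X = (X ^ (1 / p)) ^ p := by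
        rw [← ENNReal.rpow_mul, one_div_mul_cancel hp0.ne', ENNReal.rpow_one]
    _ ≤ ((∑ j, (∫⁻ y, ‖f j y‖ₑ ^ p) ^ (1 / p)) * (K ^ (1 / q))) ^ p :=
        ENNReal.rpow_le_rpow hXp hp0.le
    _ = (∑ j, (∫⁻ y, ‖f j y‖ₑ ^ p) ^ (1 / p)) ^ p * (K ^ (1 / q)) ^ p :=
        ENNReal.mul_rpow_of_nonneg _ _ hp0.le
    _ ≤ ((Fintype.card ι : ℝ≥0∞) ^ p * ∑ j, ((∫⁻ y, ‖f j y‖ₑ ^ p) ^ (1 / p)) ^ p) *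
        (K ^ (1 / q)) ^ p := by
        gcongr
        exact sum_rpow_le _ _ hp0
    _ = _ := by
        simp only [← ENNReal.rpow_mul, one_div_mul_cancel hp0.ne', ENNReal.rpow_one]
        ring

/-- Hardy space bound for a system of multipliers, uniformly over all small balls. -/
theorem exists_lintegral_locMax_le_sum (hN0 : N ≠ 0) (hφ : GoodPhi φ) (hm : ∀ j, HomSymbol (m j))
    {p : ℝ} (hp0 : 0 < p) : ∃ C : ℝ≥0∞, C ≠ ⊤ ∧ ∀ (x₀ : RN N) (ℓ : ℝ), 0 < ℓ →
      ∀ w : RN N → ℂ, ContDiff ℝ (⊤ : ℕ∞) w → (∀ y, w y ≠ 0 → dist y x₀ ≤ ℓ) →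
      ∀ f : ι → RN N → ℂ, (∀ j, ContDiff ℝ (⊤ : ℕ∞) (f j)) →
        (∀ j y, f j y ≠ 0 → dist y x₀ ≤ ℓ) → IsTransform φ m f w →
        ∫⁻ x, locMax φ ℓ w x ^ p ≤ C * ∑ j, ∫⁻ x, locMax φ ℓ (f j) x ^ p := by
  have hcard : (Fintype.card ι : ℝ≥0∞) ^ p ≠ ⊤ :=
    ENNReal.rpow_ne_top_of_nonneg hp0.le (ENNReal.natCast_ne_top _)
  rcases lt_trichotomy p 2 with hp | rfl | hp
  · have hr0 : 0 < min 1 (p / 2) := lt_min one_pos (by positivity)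
    choose A hA hA' using fun j => (hm j).exists_setLIntegral_kerMax_le hN0 hφ hr0
      (min_le_left _ _) hp0 hp
    obtain ⟨B, hB, hB'⟩ := lintegral_gMax_rpow_le hN0 hφ (p := p) hr0
      (by linarith [min_le_right 1 (p / 2)])
    refine ⟨(Fintype.card ι : ℝ≥0∞) ^ p * ((∑ j, A j) * B), ?_,
      fun x₀ ℓ hℓ w hw hws f hf hfs h => ?_⟩
    · have : ∑ j, A j ≠ ⊤ := ENNReal.sum_ne_top.2 fun j _ => hA j
      finiteness
    have hfc := fun j => hasCompactSupport_of_dist_le (hfs j)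
    refine lintegral_locMax_le_of_kerMax hN0 hφ hm hp0 hws (fun j => (hf j).continuous) hfc h
      fun j => ?_
    refine (hA' j x₀ ℓ hℓ (f j) (hf j) (hfs j)).trans ?_
    rw [mul_assoc]
    exact mul_le_mul' (Finset.single_le_sum (fun _ _ => zero_le) (Finset.mem_univ j))
      (hB' ℓ (f j) (hf j).continuous (hfc j))
  · choose A hA hA' using fun j => (hm j).exists_lintegral_kerMax_sq_le hN0 hφ
    refine ⟨(Fintype.card ι : ℝ≥0∞) ^ (2 : ℝ) * ∑ j, A j, ?_,
      fun x₀ ℓ hℓ w hw hws f hf hfs h => ?_⟩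
    · exact ENNReal.mul_ne_top hcard (ENNReal.sum_ne_top.2 fun j _ => hA j)
    have hfc := fun j => hasCompactSupport_of_dist_le (hfs j)
    refine lintegral_locMax_le_of_kerMax hN0 hφ hm hp0 hws (fun j => (hf j).continuous) hfc h
      fun j => ?_
    refine (setLIntegral_le_lintegral _ _).trans ((hA' j (f j) (hf j) (hfc j)).trans ?_)
    exact mul_le_mul' (Finset.single_le_sum (fun _ _ => zero_le) (Finset.mem_univ j))
      (lintegral_enorm_le_locMax hφ hℓ hp0.le (hf j).continuous)
  · obtain ⟨A, hA, hA'⟩ := exists_lintegral_enorm_le_sum hN0 hφ hm hp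
    obtain ⟨B, hB, hB'⟩ := lintegral_locMax_rpow_le hN0 hφ (p := p) (by linarith)
    refine ⟨B * A, ENNReal.mul_ne_top hB hA, fun x₀ ℓ hℓ w hw hws f hf hfs h => ?_⟩
    refine (hB' ℓ w hw.continuous (hasCompactSupport_of_dist_le hws)).trans ?_
    rw [mul_assoc]
    refine mul_le_mul_right ((hA' x₀ ℓ hℓ w hw hws f hf hfs h).trans (mul_le_mul_right
      (Finset.sum_le_sum fun j _ => ?_) _)) _
    exact lintegral_enorm_le_locMax hφ hℓ hp0.le (hf j).continuous

end systemsLp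

/-! ### Multi-index derivatives and the Fourier transform -/

section derivatives

open scoped FourierTransform LineDeriv

variable {E E' : Type*} [NormedAddCommGroup E] [NormedSpace ℝ E] [NormedAddCommGroup E']
  [NormedSpace ℝ E']

theorem md_induction {R : (RN N → E) → (RN N → E') → Prop}
    (hR : ∀ i f g, R f g → R (pd i f) (pd i g)) (α : Fin N → ℕ) {f : RN N → E} {g : RN N → E'}
    (h : R f g) : R (md α f) (md α g) := by
  have hit : ∀ i k f g, R f g → R ((pd i)^[k] f) ((pd i)^[k] g) := by
    intro i k
    induction k with
    | zero => exact fun f g h => h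
    | succ k ih =>
      intro f g h
      rw [Function.iterate_succ_apply, Function.iterate_succ_apply]
      exact ih _ _ (hR i _ _ h)
  rw [md, md, List.ofFn_eq_map, List.ofFn_eq_map]
  generalize List.finRange N = l
  induction l with
  | nil => exact h
  | cons i l ih => exact hit i _ _ _ ih

theorem ContDiff.pd_smooth (i : Fin N) {f : RN N → E} (hf : ContDiff ℝ (⊤ : ℕ∞) f) :
    ContDiff ℝ (⊤ : ℕ∞) (pd i f) :=
  (hf.fderiv_right (m := ((⊤ : ℕ∞) : WithTop ℕ∞)) (by simp)).clm_apply contDiff_const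

theorem ContDiff.md_smooth (α : Fin N → ℕ) {f : RN N → E} (hf : ContDiff ℝ (⊤ : ℕ∞) f) :
    ContDiff ℝ (⊤ : ℕ∞) (md α f) :=
  md_induction (R := fun (f _ : RN N → E) => ContDiff ℝ (⊤ : ℕ∞) f) (fun i _ _ h => h.pd_smooth i)
    α (g := f) hf

theorem tsupport_md_subset (α : Fin N → ℕ) (f : RN N → E) : tsupport (md α f) ⊆ tsupport f :=
  md_induction (R := fun (g _ : RN N → E) => tsupport g ⊆ tsupport f)
    (fun _ _ _ h => (tsupport_fderiv_apply_subset ℝ _).trans h) α (g := f) subset_rfl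

theorem md_apply (α : Fin N → ℕ) {n : ℕ} {u : RN N → Fin n → ℂ} (hu : ContDiff ℝ (⊤ : ℕ∞) u)
    (k : Fin n) : (fun x => md α u x k) = md α fun x => u x k := by
  refine (md_induction (R := fun (f : RN N → Fin n → ℂ) (g : RN N → ℂ) =>
    ContDiff ℝ (⊤ : ℕ∞) f ∧ (fun x => f x k) = g) (fun i f g h => ⟨h.1.pd_smooth i, ?_⟩) α
    ⟨hu, rfl⟩).2
  rw [← h.2]
  ext x
  have hd : DifferentiableAt ℝ f x := h.1.differentiable (by simp) x
  have h1 := ((ContinuousLinearMap.proj (R := ℝ) (φ := fun _ : Fin n => ℂ) k).hasFDerivAt.comp x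
    hd.hasFDerivAt).fderiv
  have h2 : fderiv ℝ (fun x => f x k) x =
      (ContinuousLinearMap.proj (R := ℝ) (φ := fun _ : Fin n => ℂ) k).comp (fderiv ℝ f x) := h1
  simp only [pd]
  rw [h2]
  rfl

theorem fourier_pd (i : Fin N) {f : RN N → ℂ} (hf : ContDiff ℝ (⊤ : ℕ∞) f)
    (hfc : HasCompactSupport f) (ξ : RN N) :
    𝓕 (pd i f) ξ = 2 * Real.pi * Complex.I * (ξ i : ℂ) * 𝓕 f ξ := by
  have h := DFunLike.congr_fun (SchwartzMap.fourier_lineDerivOp_eq (hfc.toSchwartzMap hf)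
    (EuclideanSpace.single i (1 : ℝ))) ξ
  have ht : (fun ξ : RN N => inner ℝ ξ (EuclideanSpace.single i (1 : ℝ))).HasTemperateGrowth := by
    fun_prop
  rw [smul_apply, SchwartzMap.smulLeftCLM_apply_apply ht] at h
  have h1 : (𝓕 (∂_{EuclideanSpace.single i (1 : ℝ)} (hfc.toSchwartzMap hf)) :
    SchwartzMap (RN N) ℂ) ξ = 𝓕 (pd i f) ξ := rfl
  have h2 : (𝓕 (hfc.toSchwartzMap hf) : SchwartzMap (RN N) ℂ) ξ = 𝓕 f ξ := rfl
  rw [h1, h2] at h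
  rw [h, EuclideanSpace.inner_single_right]
  simp only [smul_eq_mul, Complex.real_smul]
  simp [mul_assoc]

theorem fourier_md (α : Fin N → ℕ) {f : RN N → ℂ} (hf : ContDiff ℝ (⊤ : ℕ∞) f)
    (hfc : HasCompactSupport f) (ξ : RN N) :
    𝓕 (md α f) ξ = (2 * Real.pi * Complex.I) ^ mOrder α * (∏ i, (ξ i : ℂ) ^ α i) * 𝓕 f ξ := by
  have hit : ∀ i k (f : RN N → ℂ), ContDiff ℝ (⊤ : ℕ∞) f → HasCompactSupport f →
      ContDiff ℝ (⊤ : ℕ∞) ((pd i)^[k] f) ∧ HasCompactSupport ((pd i)^[k] f) ∧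
      𝓕 ((pd i)^[k] f) ξ = (2 * Real.pi * Complex.I * (ξ i : ℂ)) ^ k * 𝓕 f ξ := by
    intro i k
    induction k with
    | zero => exact fun f hf hfc => ⟨hf, hfc, by simp⟩
    | succ k ih =>
      intro f hf hfc
      rw [Function.iterate_succ_apply]
      obtain ⟨h1, h2, h3⟩ := ih (pd i f) (hf.pd_smooth i)
        (hfc.mono' ((subset_tsupport _).trans (tsupport_fderiv_apply_subset ℝ _)))
      refine ⟨h1, h2, ?_⟩
      rw [h3, fourier_pd i hf hfc]
      ring
  have hl : ∀ l : List (Fin N),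
      ContDiff ℝ (⊤ : ℕ∞) ((l.map fun i => (pd i)^[α i]).foldr (· ∘ ·) id f) ∧
      HasCompactSupport ((l.map fun i => (pd i)^[α i]).foldr (· ∘ ·) id f) ∧
      𝓕 ((l.map fun i => (pd i)^[α i]).foldr (· ∘ ·) id f) ξ =
        (l.map fun i => (2 * Real.pi * Complex.I * (ξ i : ℂ)) ^ α i).prod * 𝓕 f ξ := by
    intro l
    induction l with
    | nil => exact ⟨hf, hfc, by simp⟩
    | cons i l ih =>
      obtain ⟨h1, h2, h3⟩ := hit i (α i) _ ih.1 ih.2.1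
      refine ⟨h1, h2, ?_⟩
      refine h3.trans ?_
      rw [ih.2.2, List.map_cons, List.prod_cons]; ring
  rw [md, List.ofFn_eq_map, (hl _).2.2, ← List.ofFn_eq_map, List.prod_ofFn]
  simp only [mul_pow, Finset.prod_mul_distrib, mOrder, Finset.prod_pow_eq_pow_sum]

end derivatives

/-! ### The frozen operator -/

section frozen

open scoped FourierTransform ComplexOrder

variable {φ : RN N → ℝ} {m n₁ n₂ : ℕ}

/-- The principal symbol of a homogeneous constant coefficient operator. -/
def symbolMatrix (m : ℕ) (c : (Fin N → ℕ) → Matrix (Fin n₂) (Fin n₁) ℂ) (ξ : RN N) :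
    Matrix (Fin n₂) (Fin n₁) ℂ :=
  ∑ α ∈ idxEq N m, (∏ i, ((ξ i : ℝ) : ℂ) ^ α i) • c α

/-- The left inverse of the principal symbol. -/
def symbolInv (m : ℕ) (c : (Fin N → ℕ) → Matrix (Fin n₂) (Fin n₁) ℂ) (ξ : RN N) :
    Matrix (Fin n₁) (Fin n₂) ℂ :=
  ((symbolMatrix m c ξ).conjTranspose * symbolMatrix m c ξ)⁻¹ * (symbolMatrix m c ξ).conjTranspose

theorem mOrder_of_mem_idxEq {α : Fin N → ℕ} (hα : α ∈ idxEq N m) : mOrder α = m :=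
  (Finset.mem_filter.1 hα).2

theorem prod_smul_pow (α : Fin N → ℕ) (c : ℝ) (ξ : RN N) :
    ∏ i, (((c • ξ) i : ℝ) : ℂ) ^ α i = (c : ℂ) ^ mOrder α * ∏ i, ((ξ i : ℝ) : ℂ) ^ α i := by
  simp [mul_pow, Finset.prod_mul_distrib, mOrder, Finset.prod_pow_eq_pow_sum]

theorem contDiff_prod_pow (α : Fin N → ℕ) :
    ContDiff ℝ (⊤ : ℕ∞) fun ξ : RN N => ∏ i, ((ξ i : ℝ) : ℂ) ^ α i :=
  contDiff_prod fun i _ => (Complex.ofRealCLM.contDiff.comp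
    (EuclideanSpace.proj (𝕜 := ℝ) i : RN N →L[ℝ] ℝ).contDiff).pow _

theorem symbolMatrix_smul (m : ℕ) (c : (Fin N → ℕ) → Matrix (Fin n₂) (Fin n₁) ℂ) (s : ℝ)
    (ξ : RN N) : symbolMatrix m c (s • ξ) = (s : ℂ) ^ m • symbolMatrix m c ξ := by
  rw [symbolMatrix, symbolMatrix, Finset.smul_sum]
  refine Finset.sum_congr rfl fun α hα => ?_
  rw [prod_smul_pow, mOrder_of_mem_idxEq hα, smul_smul]

theorem contDiff_symbolMatrix (m : ℕ) (c : (Fin N → ℕ) → Matrix (Fin n₂) (Fin n₁) ℂ) (j : Fin n₂)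
    (i : Fin n₁) : ContDiff ℝ (⊤ : ℕ∞) fun ξ => symbolMatrix m c ξ j i := by
  simp only [symbolMatrix, Matrix.sum_apply, Matrix.smul_apply, smul_eq_mul]
  exact ContDiff.sum fun α _ => (contDiff_prod_pow α).mul contDiff_const

variable {c : (Fin N → ℕ) → Matrix (Fin n₂) (Fin n₁) ℂ}

theorem isUnit_det_symbol {ξ : RN N} (h : Function.Injective (symbolMatrix m c ξ).mulVec) :
    IsUnit ((symbolMatrix m c ξ).conjTranspose * symbolMatrix m c ξ).det := by
  rw [← Matrix.isUnit_iff_isUnit_det, ← Matrix.mulVec_injective_iff_isUnit]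
  refine (injective_iff_map_eq_zero (Matrix.mulVecLin _)).2 fun v hv => ?_
  have h1 := (Matrix.conjTranspose_mul_self_mulVec_eq_zero (symbolMatrix m c ξ) v).1 hv
  exact h (h1.trans (Matrix.mulVec_zero _).symm)

theorem symbolInv_mul {ξ : RN N} (h : Function.Injective (symbolMatrix m c ξ).mulVec) :
    symbolInv m c ξ * symbolMatrix m c ξ = 1 := by
  rw [symbolInv, Matrix.mul_assoc, Matrix.nonsing_inv_mul _ (isUnit_det_symbol h)]

theorem contDiff_det {k : ℕ} {M : RN N → Matrix (Fin k) (Fin k) ℂ}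
    (hM : ∀ i j, ContDiff ℝ (⊤ : ℕ∞) fun ξ => M ξ i j) : ContDiff ℝ (⊤ : ℕ∞) fun ξ => (M ξ).det := by
  simp only [Matrix.det_apply']
  exact ContDiff.sum fun σ _ => contDiff_const.mul (contDiff_prod fun i _ => hM _ _)

theorem contDiff_adjugate {k : ℕ} {M : RN N → Matrix (Fin k) (Fin k) ℂ}
    (hM : ∀ i j, ContDiff ℝ (⊤ : ℕ∞) fun ξ => M ξ i j) (i j : Fin k) :
    ContDiff ℝ (⊤ : ℕ∞) fun ξ => (M ξ).adjugate i j := by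
  simp only [Matrix.adjugate_apply]
  refine contDiff_det fun a b => ?_
  by_cases h : a = j
  · subst h
    simpa only [Matrix.updateRow_self] using contDiff_const
  · simpa only [Matrix.updateRow_ne h] using hM a b

theorem contDiff_mul_apply {k l n : ℕ} {A : RN N → Matrix (Fin k) (Fin l) ℂ}
    {B : RN N → Matrix (Fin l) (Fin n) ℂ} (hA : ∀ i j, ContDiff ℝ (⊤ : ℕ∞) fun ξ => A ξ i j)
    (hB : ∀ i j, ContDiff ℝ (⊤ : ℕ∞) fun ξ => B ξ i j) (i : Fin k) (j : Fin n) :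
    ContDiff ℝ (⊤ : ℕ∞) fun ξ => (A ξ * B ξ) i j := by
  simp only [Matrix.mul_apply]
  exact ContDiff.sum fun a _ => (hA i a).mul (hB a j)

/-- The multipliers expressing `∂^β u_i` through the components of the frozen operator. -/
theorem homSymbol_symbolInv (hc : ∀ ξ : RN N, ξ ≠ 0 →
    Function.Injective (symbolMatrix m c ξ).mulVec) {β : Fin N → ℕ} (hβ : mOrder β = m)
    (i : Fin n₁) (j : Fin n₂) :
    HomSymbol fun ξ : RN N => (∏ k, ((ξ k : ℝ) : ℂ) ^ β k) * symbolInv m c ξ i j where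
  smooth ξ hξ := by
    have hP := contDiff_symbolMatrix m c
    have hPs : ∀ i j, ContDiff ℝ (⊤ : ℕ∞) fun ξ => (symbolMatrix m c ξ).conjTranspose i j :=
      fun i j => Complex.conjCLE.contDiff.comp (hP j i)
    have hPP := contDiff_mul_apply hPs hP
    have hdet := (contDiff_det hPP).contDiffAt (x := ξ)
    have e : ∀ ξ, symbolInv m c ξ i j =
        (((symbolMatrix m c ξ).conjTranspose * symbolMatrix m c ξ).det)⁻¹ *
        (((symbolMatrix m c ξ).conjTranspose * symbolMatrix m c ξ).adjugate *
          (symbolMatrix m c ξ).conjTranspose) i j := by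
      intro ξ
      rw [symbolInv, Matrix.inv_def, Matrix.smul_mul, Matrix.smul_apply, Ring.inverse_eq_inv',
        smul_eq_mul]
    simp only [e]
    exact (contDiff_prod_pow β).contDiffAt.mul ((hdet.inv (isUnit_det_symbol (hc ξ hξ)).ne_zero).mul
      (contDiff_mul_apply (contDiff_adjugate hPP) hPs i j).contDiffAt)
  hom s hs ξ := by
    rcases eq_or_ne ξ 0 with rfl | hξ
    · rw [smul_zero]
    have hs0 : (s : ℂ) ≠ 0 := by exact_mod_cast hs.ne'
    have hsm : (s : ℂ) ^ m ≠ 0 := pow_ne_zero _ hs0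
    have hunit := isUnit_det_symbol (hc ξ hξ)
    have e : symbolInv m c (s • ξ) = ((s : ℂ) ^ m)⁻¹ • symbolInv m c ξ := by
      have h2 : IsUnit ((s : ℂ) ^ m * (s : ℂ) ^ m) := (mul_ne_zero hsm hsm).isUnit
      have hstar : star ((s : ℂ) ^ m) = (s : ℂ) ^ m := by simp
      have hPP : (symbolMatrix m c (s • ξ)).conjTranspose * symbolMatrix m c (s • ξ) =
          ((s : ℂ) ^ m * (s : ℂ) ^ m) •
            ((symbolMatrix m c ξ).conjTranspose * symbolMatrix m c ξ) := by
        rw [symbolMatrix_smul, Matrix.conjTranspose_smul, hstar, Matrix.smul_mul, Matrix.mul_smul,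
          smul_smul]
      rw [symbolInv, hPP, ← h2.unit_spec, ← Units.smul_def, Matrix.inv_smul' _ _ hunit,
        symbolMatrix_smul, Matrix.conjTranspose_smul, hstar, symbolInv, Matrix.smul_mul,
        Matrix.mul_smul, Units.smul_def, smul_smul]
      congr 1
      simp only [Units.val_inv_eq_inv_val, h2.unit_spec]
      field_simp
    rw [e, prod_smul_pow, hβ, Matrix.smul_apply, smul_eq_mul]
    field_simp

/-- A component of the frozen operator. -/
def frozenOp (m : ℕ) (c : (Fin N → ℕ) → Matrix (Fin n₂) (Fin n₁) ℂ) (v : Fin n₁ → RN N → ℂ)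
    (j : Fin n₂) (x : RN N) : ℂ :=
  ∑ α ∈ idxEq N m, ∑ i, c α j i * md α (v i) x

theorem contDiff_frozenOp {v : Fin n₁ → RN N → ℂ} (hv : ∀ i, ContDiff ℝ (⊤ : ℕ∞) (v i))
    (j : Fin n₂) : ContDiff ℝ (⊤ : ℕ∞) (frozenOp m c v j) :=
  ContDiff.sum fun α _ => ContDiff.sum fun i _ => contDiff_const.mul ((hv i).md_smooth α)

theorem HasCompactSupport.md_compact (α : Fin N → ℕ) {f : RN N → ℂ} (hf : HasCompactSupport f) :
    HasCompactSupport (md α f) :=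
  hf.mono' ((subset_tsupport _).trans (tsupport_md_subset α f))

theorem frozenOp_eq_zero {v : Fin n₁ → RN N → ℂ} {x : RN N} (h : ∀ i, x ∉ tsupport (v i))
    (j : Fin n₂) : frozenOp m c v j x = 0 := by
  refine Finset.sum_eq_zero fun α _ => Finset.sum_eq_zero fun i _ => ?_
  rw [image_eq_zero_of_notMem_tsupport fun hx => h i (tsupport_md_subset α _ hx), mul_zero]

theorem fourier_frozenOp {v : Fin n₁ → RN N → ℂ} (hv : ∀ i, ContDiff ℝ (⊤ : ℕ∞) (v i))
    (hvc : ∀ i, HasCompactSupport (v i)) (j : Fin n₂) (ξ : RN N) :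
    𝓕 (frozenOp m c v j) ξ =
      (2 * Real.pi * Complex.I) ^ m * ∑ i, symbolMatrix m c ξ j i * 𝓕 (v i) ξ := by
  have hint : ∀ α i, Integrable fun x => 𝐞 (-inner ℝ x ξ) • (c α j i * md α (v i) x) := fun α i =>
    (Real.fourierIntegral_convergent_iff ξ).2 ((((hv i).md_smooth α).continuous
      |>.integrable_of_hasCompactSupport ((hvc i).md_compact α)).const_mul _)
  have e1 : ∀ α i, ∫ x, 𝐞 (-inner ℝ x ξ) • (c α j i * md α (v i) x) =
      c α j i * 𝓕 (md α (v i)) ξ := by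
    intro α i
    rw [Real.fourier_eq, ← integral_const_mul]
    congr 1
    ext x
    simp only [Circle.smul_def, smul_eq_mul]
    ring
  rw [Real.fourier_eq]
  simp only [frozenOp, Finset.smul_sum]
  rw [integral_finsetSum _ fun α _ => integrable_finsetSum _ fun i _ => hint α i]
  simp only [symbolMatrix, Matrix.sum_apply, Matrix.smul_apply, smul_eq_mul, Finset.sum_mul]
  rw [Finset.sum_comm, Finset.mul_sum]
  refine Finset.sum_congr rfl fun α hα => ?_
  rw [integral_finsetSum _ fun i _ => hint α i, Finset.mul_sum]
  refine Finset.sum_congr rfl fun i _ => ?_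
  rw [e1, fourier_md α (hv i) (hvc i), mOrder_of_mem_idxEq hα]
  ring

theorem convAt_sum (hφ : GoodPhi φ) {t : ℝ} (ht : 0 < t) {ι : Type*} (s : Finset ι)
    {W : ι → RN N → ℂ} (hW : ∀ j ∈ s, Continuous (W j)) (x : RN N) :
    convAt φ t (fun y => ∑ j ∈ s, W j y) x = ∑ j ∈ s, convAt φ t (W j) x := by
  simp only [convAt, Finset.smul_sum]
  refine integral_finsetSum _ fun j hj => Continuous.integrable_of_hasCompactSupport
    (((hφ.contDiff_dil t).continuous.comp (continuous_const.sub continuous_id)).smul (hW j hj)) ?_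
  refine HasCompactSupport.intro (isCompact_closedBall x t) fun y hy => ?_
  rw [hφ.dil_eq_zero ht (by simpa [dist_eq_norm, norm_sub_rev] using hy), zero_smul]

theorem isTransform_frozenOp (hN0 : N ≠ 0) (hφ : GoodPhi φ) (hc : ∀ ξ : RN N, ξ ≠ 0 →
    Function.Injective (symbolMatrix m c ξ).mulVec) {β : Fin N → ℕ} (hβ : mOrder β = m)
    {v : Fin n₁ → RN N → ℂ} (hv : ∀ i, ContDiff ℝ (⊤ : ℕ∞) (v i))
    (hvc : ∀ i, HasCompactSupport (v i)) (i : Fin n₁) :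
    IsTransform φ (fun j ξ => (∏ k, ((ξ k : ℝ) : ℂ) ^ β k) * symbolInv m c ξ i j)
      (frozenOp m c v) (md β (v i)) := by
  intro t ht x
  have hM := fun j => homSymbol_symbolInv hc hβ i j
  have hfs := fun j => contDiff_frozenOp (m := m) (c := c) hv j
  have hfc : ∀ j, HasCompactSupport (frozenOp m c v j) := fun j => by
    refine HasCompactSupport.intro (K := ⋃ i, tsupport (v i)) (isCompact_iUnion fun i => hvc i)
      fun x hx => frozenOp_eq_zero (fun i hi => hx (mem_iUnion.2 ⟨i, hi⟩)) j
  have hint : ∀ j, Integrable fun ξ : RN N => ((∏ k, ((ξ k : ℝ) : ℂ) ^ β k) * symbolInv m c ξ i j) *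
      𝓕 (frozenOp m c v j) (-ξ) := fun j => by
    obtain ⟨b, -, hb⟩ := (hM j).exists_bound
    have hGi : Integrable (𝓕 (frozenOp m c v j)) :=
      (𝓕 ((hfc j).toSchwartzMap (hfs j)) : SchwartzMap (RN N) ℂ).integrable
    exact hGi.comp_neg.bdd_mul ((hM j).aestronglyMeasurable hN0) (Eventually.of_forall hb)
  have hW : ∀ y, md β (v i) y = ∑ j, (𝓕 fun ξ : RN N =>
      ((∏ k, ((ξ k : ℝ) : ℂ) ^ β k) * symbolInv m c ξ i j) * 𝓕 (frozenOp m c v j) (-ξ)) y := by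
    intro y
    have hvβ := (hv i).md_smooth β
    have hvβc := (hvc i).md_compact β
    have hinv : 𝓕⁻ (𝓕 (md β (v i))) y = md β (v i) y :=
      congrFun (hvβ.continuous.fourierInv_fourier_eq
        (hvβ.continuous.integrable_of_hasCompactSupport hvβc)
        (𝓕 (hvβc.toSchwartzMap hvβ) : SchwartzMap (RN N) ℂ).integrable) y
    rw [← hinv, Real.fourierInv_eq_fourier_comp_neg]
    simp only [Real.fourier_eq (f := fun ξ : RN N => _ * _)]
    rw [← integral_finsetSum _ fun j _ => (Real.fourierIntegral_convergent_iff y).2 (hint j),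
      Real.fourier_eq]
    have : Nonempty (Fin N) := ⟨⟨0, Nat.pos_of_ne_zero hN0⟩⟩
    have hae : ∀ᵐ ξ : RN N, ξ ≠ 0 := by simp [ae_iff]
    refine integral_congr_ae ?_
    filter_upwards [hae] with ξ hξ
    rw [← Finset.smul_sum]
    congr 1
    have hneg : ∀ i j, symbolMatrix m c (-ξ) i j = (-1) ^ m * symbolMatrix m c ξ i j := by
      intro i j
      rw [← neg_one_smul ℝ ξ, symbolMatrix_smul, Matrix.smul_apply, smul_eq_mul]
      norm_num
    have hnegβ : ∏ k, (((-ξ) k : ℝ) : ℂ) ^ β k = (-1) ^ m * ∏ k, ((ξ k : ℝ) : ℂ) ^ β k := by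
      rw [← neg_one_smul ℝ ξ, prod_smul_pow, hβ]
      norm_num
    simp only [fourier_frozenOp hv hvc, fourier_md β (hv i) (hvc i), hneg, hnegβ, hβ]
    have hI : ∀ i', ∑ j, symbolInv m c ξ i j * symbolMatrix m c ξ j i' = if i = i' then 1 else 0 := by
      intro i'
      have := congrFun (congrFun (symbolInv_mul (hc ξ hξ)) i) i'
      rwa [Matrix.mul_apply, Matrix.one_apply] at this
    symm
    calc _ = (2 * Real.pi * Complex.I) ^ m * ((-1) ^ m * ∏ k, ((ξ k : ℝ) : ℂ) ^ β k) *
          ∑ i', (∑ j, symbolInv m c ξ i j * symbolMatrix m c ξ j i') * 𝓕 (v i') (-ξ) := by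
          simp only [Finset.mul_sum, Finset.sum_mul]
          rw [Finset.sum_comm]
          refine Finset.sum_congr rfl fun i' _ => Finset.sum_congr rfl fun j _ => ?_
          ring
      _ = _ := by
          simp [hI]
  rw [show md β (v i) = _ from funext hW, convAt_sum hφ ht _ fun j _ =>
    continuous_fourier_of_integrable (hint j)]
  exact Finset.sum_congr rfl fun j _ => ((hM j).integral_mul_mulKer hN0 hφ (hfs j) (hfc j) ht x).symm

end frozen

/-! ### Perturbation by small coefficients -/

section perturbation

variable {φ : RN N → ℝ}

theorem GoodPhi.exists_locMax_mul_le_gMax (hφ : GoodPhi φ) {r : ℝ} (hr0 : 0 < r) (hr1 : r ≤ 1)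
    {b : RN N → ℂ} (hb : ContDiff ℝ (⊤ : ℕ∞) b) (hbc : HasCompactSupport b) {x₀ : RN N}
    (hb0 : b x₀ = 0) : ∃ C : ℝ, 0 < C ∧ ∀ ℓ ≤ 1, ∀ f : RN N → ℂ, Continuous f →
      HasCompactSupport f → (∀ y, f y ≠ 0 → dist y x₀ ≤ ℓ) → ∀ x,
      locMax φ ℓ (fun y => b y * f y) x ≤ ENNReal.ofReal (C * ℓ) * gMax φ r ℓ f x := by
  obtain ⟨L, h⟩ := hφ.exists_enorm_integral_le_gMax hr0 hr1
  obtain ⟨C, hC0, hC⟩ := h 1 le_rfl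
  obtain ⟨c, hc0, hc⟩ := hφ.exists_JB_dil L
  obtain ⟨d, hd0, hd⟩ := exists_JB_of_hasCompactSupport hb hbc L
  obtain ⟨K, hK⟩ := hb.lipschitzWith_of_hasCompactSupport hbc (by simp)
  set e : ℝ := max d (3 * K) with he
  have he0 : 0 < e := hd0.trans_le (le_max_left _ _)
  refine ⟨C * (2 ^ L * (c * e)), by positivity, fun ℓ hℓ f hf hfc hfs x => iSup₂_le fun t ht => ?_⟩
  have ht0 := ht.1
  have hℓ0 : 0 < ℓ := ht.1.trans ht.2
  by_cases hx : x ∈ ball x₀ (2 * ℓ)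
  swap
  · rw [convAt_eq_zero_of_notMem hφ ht (fun y hy => hfs y (right_ne_zero_of_mul hy)) hx]
    simp
  rw [← integral_mul_dilC φ]
  have e1 : ∫ z, (b z * f z) * dilC φ t (x - z) = ∫ z, f z * (dilC φ t (x - z) * b z) := by
    congr 1
    ext z
    ring
  have hD : ContDiff ℝ (⊤ : ℕ∞) fun z => dilC φ t (x - z) :=
    (hφ.contDiff_dilC t).comp (contDiff_const.sub contDiff_id)
  have hz : ∀ z, t < dist z x → dilC φ t (x - z) = 0 := fun z hz => by
    have : t < ‖x - z‖ := by rwa [← dist_eq_norm, dist_comm]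
    simp [dilC, hφ.dil_eq_zero ht0 this]
  have hH0 : 0 ≤ 2 ^ L * (c * e) * ℓ := by positivity
  rw [e1, mul_assoc C]
  refine hC ℓ f hf hfc t ht x _ (hD.mul hb) (fun z hzt => ?_) _ hH0 fun y => ?_
  · rw [hz z (by linarith), zero_mul]
  by_cases hy : t < dist y x
  · refine JB.of_eventually_zero (by positivity) ?_
    filter_upwards [(isOpen_lt continuous_const (continuous_id.dist continuous_const)).mem_nhds
      (show y ∈ {y | t < dist y x} from hy)] with z hzt
    rw [hz z hzt, zero_mul]
  have hbJ : JB L t (e * ℓ) b y := by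
    intro i hi
    rcases Nat.eq_zero_or_pos i with rfl | hi0
    · rw [norm_iteratedFDeriv_zero, pow_zero, mul_one]
      have h1 := hK.dist_le_mul y x₀
      rw [hb0, dist_zero_right] at h1
      have h2 : dist y x₀ ≤ 3 * ℓ := by
        linarith [dist_triangle y x x₀, mem_ball.1 hx, not_lt.1 hy, ht.2]
      calc ‖b y‖ ≤ K * (3 * ℓ) := h1.trans (by gcongr)
        _ = 3 * K * ℓ := by ring
        _ ≤ e * ℓ := by gcongr; exact le_max_right _ _
    · have h1 := hd y i hi
      rw [one_pow, mul_one] at h1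
      have h2 : t ^ i ≤ ℓ := (pow_le_of_le_one ht0.le (by linarith [ht.2]) hi0.ne').trans ht.2.le
      calc _ ≤ d * ℓ := by gcongr
        _ ≤ e * ℓ := by gcongr; exact le_max_left _ _
  refine ((JB.comp_const_sub x (hc t ht0 (x - y))).mul ht0.le
    (hD.of_le (by exact_mod_cast le_top)).contDiffAt
    (hb.of_le (by exact_mod_cast le_top)).contDiffAt hbJ).mono (le_of_eq ?_)
  rw [div_eq_mul_inv]
  ring

theorem GoodPhi.exists_lintegral_locMax_mul_le (hN0 : N ≠ 0) (hφ : GoodPhi φ) {p : ℝ} (hp0 : 0 < p)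
    {b : RN N → ℂ} (hb : ContDiff ℝ (⊤ : ℕ∞) b) (hbc : HasCompactSupport b) {x₀ : RN N}
    (hb0 : b x₀ = 0) : ∃ C : ℝ≥0∞, C ≠ ⊤ ∧ ∀ ℓ ≤ 1, ∀ f : RN N → ℂ, Continuous f →
      HasCompactSupport f → (∀ y, f y ≠ 0 → dist y x₀ ≤ ℓ) →
      ∫⁻ x, locMax φ ℓ (fun y => b y * f y) x ^ p ≤
        C * ENNReal.ofReal ℓ ^ p * ∫⁻ x, locMax φ ℓ f x ^ p := by
  have hr0 : 0 < min 1 (p / 2) := lt_min one_pos (by positivity)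
  obtain ⟨C, hC0, hC⟩ := hφ.exists_locMax_mul_le_gMax hr0 (min_le_left _ _) hb hbc hb0
  obtain ⟨D, hD, hDg⟩ := lintegral_gMax_rpow_le hN0 hφ hr0 (p := p)
    (by linarith [min_le_right 1 (p / 2)])
  refine ⟨ENNReal.ofReal C ^ p * D, ENNReal.mul_ne_top
    (ENNReal.rpow_ne_top_of_nonneg hp0.le ENNReal.ofReal_ne_top) hD, fun ℓ hℓ f hf hfc hfs => ?_⟩
  calc _ ≤ ∫⁻ x, ENNReal.ofReal (C * ℓ) ^ p * gMax φ (min 1 (p / 2)) ℓ f x ^ p := by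
        refine lintegral_mono fun x => ?_
        rw [← ENNReal.mul_rpow_of_nonneg _ _ hp0.le]
        exact ENNReal.rpow_le_rpow (hC ℓ hℓ f hf hfc hfs x) hp0.le
    _ = ENNReal.ofReal (C * ℓ) ^ p * ∫⁻ x, gMax φ (min 1 (p / 2)) ℓ f x ^ p :=
        lintegral_const_mul _ ((measurable_gMax hr0 ℓ f).pow_const p)
    _ ≤ ENNReal.ofReal (C * ℓ) ^ p * (D * ∫⁻ x, locMax φ ℓ f x ^ p) := by
        gcongr
        exact hDg ℓ f hf hfc
    _ = _ := by
        rw [ENNReal.ofReal_mul hC0.le, ENNReal.mul_rpow_of_nonneg _ _ hp0.le]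
        ring

theorem lintegral_locMax_sum_le (hφ : GoodPhi φ) {p : ℝ} (hp0 : 0 < p) (ℓ : ℝ) {ι : Type*}
    (s : Finset ι) {W : ι → RN N → ℂ} (hW : ∀ j ∈ s, Continuous (W j)) :
    ∫⁻ x, locMax φ ℓ (fun y => ∑ j ∈ s, W j y) x ^ p ≤
      (s.card : ℝ≥0∞) ^ p * ∑ j ∈ s, ∫⁻ x, locMax φ ℓ (W j) x ^ p := by
  have hm : ∀ j ∈ s, Measurable fun x => locMax φ ℓ (W j) x ^ p := fun j hj =>
    (measurable_locMax hφ ℓ (hW j hj)).pow_const p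
  rw [← lintegral_finsetSum' _ fun j hj => (hm j hj).aemeasurable,
    ← lintegral_const_mul'' _ (Finset.aemeasurable_fun_sum _ fun j hj => (hm j hj).aemeasurable)]
  refine lintegral_mono fun x => ?_
  refine le_trans (ENNReal.rpow_le_rpow (iSup₂_le fun t ht => ?_) hp0.le) (sum_rpow_le s _ hp0)
  rw [convAt_sum hφ ht.1 s hW]
  exact (enorm_sum_le _ _).trans (Finset.sum_le_sum fun j _ => enorm_convAt_le_locMax ht _ _)

theorem lintegral_locMax_add_le (hφ : GoodPhi φ) {p : ℝ} (hp0 : 0 < p) (ℓ : ℝ) {f g : RN N → ℂ}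
    (hf : Continuous f) (hg : Continuous g) :
    ∫⁻ x, locMax φ ℓ (fun y => f y + g y) x ^ p ≤
      2 ^ p * ((∫⁻ x, locMax φ ℓ f x ^ p) + ∫⁻ x, locMax φ ℓ g x ^ p) := by
  have := lintegral_locMax_sum_le hφ hp0 ℓ Finset.univ (W := ![f, g])
    (by simp [Fin.forall_fin_two, hf, hg])
  simpa [Fin.sum_univ_two] using this

theorem lintegral_locMax_rpow_lt_top (hφ : GoodPhi φ) {p : ℝ} (hp0 : 0 < p) {x₀ : RN N} {ℓ : ℝ}
    {w : RN N → ℂ} (hw : Continuous w) (hws : ∀ y, w y ≠ 0 → dist y x₀ ≤ ℓ) :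
    ∫⁻ x, locMax φ ℓ w x ^ p < ⊤ := by
  obtain ⟨c, hc⟩ := hw.bounded_above_of_compact_support (hasCompactSupport_of_dist_le hws)
  rw [lintegral_locMax_eq_setLIntegral hφ hp0 hws]
  calc _ ≤ ∫⁻ _ in ball x₀ (2 * ℓ), ENNReal.ofReal c ^ p := lintegral_mono fun x =>
        ENNReal.rpow_le_rpow (locMax_le hφ ℓ hc x) hp0.le
    _ < ⊤ := by
        rw [setLIntegral_const]
        exact ENNReal.mul_lt_top (ENNReal.rpow_lt_top_of_nonneg hp0.le ENNReal.ofReal_ne_top)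
          measure_ball_lt_top

/-- Passing from the truncation level `ℓ` to the truncation level `1`. -/
theorem GoodPhi.exists_lintegral_locMax_one_le (hN0 : N ≠ 0) (hφ : GoodPhi φ) {p : ℝ} (hp0 : 0 < p)
    {ℓ : ℝ} (hℓ0 : 0 < ℓ) (hℓ1 : ℓ ≤ 1) : ∃ C : ℝ≥0∞, C ≠ ⊤ ∧ ∀ (x₀ : RN N) (w : RN N → ℂ),
      Continuous w → (∀ y, w y ≠ 0 → dist y x₀ ≤ ℓ) →
      ∫⁻ x, locMax φ 1 w x ^ p ≤ C * ∫⁻ x, locMax φ ℓ w x ^ p := by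
  have hr0 : 0 < min 1 (p / 2) := lt_min one_pos (by positivity)
  set r := min 1 (p / 2) with hr
  obtain ⟨D, hD, hDg⟩ := lintegral_gMax_rpow_le hN0 hφ hr0 (p := p)
    (by linarith [min_le_right 1 (p / 2)])
  obtain ⟨L, h⟩ := hφ.exists_enorm_integral_le_gMax hr0 (min_le_left _ _)
  obtain ⟨C, hC0, hC⟩ := h (8 / ℓ) (by rw [le_div_iff₀ hℓ0]; linarith)
  obtain ⟨c, hc0, hc⟩ := hφ.exists_JB_dil L
  have key : ∀ (x₀ : RN N) (w : RN N → ℂ), Continuous w → (∀ y, w y ≠ 0 → dist y x₀ ≤ ℓ) →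
      ∀ x, ∀ x' ∈ ball x₀ ℓ, locMax φ 1 w x ≤
        locMax φ ℓ w x + (ball x₀ 2).indicator 1 x * (ENNReal.ofReal (C * c) * gMax φ r ℓ w x') := by
    intro x₀ w hw hws x x' hx'
    refine iSup₂_le fun t ht => ?_
    by_cases htℓ : t < ℓ
    · exact (enorm_convAt_le_locMax ⟨ht.1, htℓ⟩ w x).trans le_self_add
    by_cases hx : x ∈ ball x₀ 2
    swap
    · rw [convAt_eq_zero_of_notMem hφ ht (fun y hy => (hws y hy).trans hℓ1) (by simpa using hx)]
      simp
    refine le_trans ?_ le_add_self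
    rw [indicator_of_mem hx, Pi.one_apply, one_mul, ← integral_mul_dilC φ]
    refine hC ℓ w hw (hasCompactSupport_of_dist_le hws) (ℓ / 2) ⟨by positivity, by linarith⟩ x' _
      ((hφ.contDiff_dilC t).comp (contDiff_const.sub contDiff_id)) (fun z hz => ?_) c hc0.le
      fun y => ?_
    · have h1 : 8 / ℓ * (ℓ / 2) = 4 := by field_simp; norm_num
      have h2 : t < ‖x - z‖ := by
        rw [← dist_eq_norm, dist_comm]
        linarith [dist_triangle z x x', dist_triangle_right x x' x₀, mem_ball.1 hx, mem_ball.1 hx',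
          ht.2]
      simp [dilC, hφ.dil_eq_zero ht.1 h2]
    · have hle : ℓ / 2 ≤ t := by linarith
      refine ((JB.comp_const_sub x (hc t ht.1 (x - y))).mono_scale (by positivity) hle).mono ?_
      rw [← div_eq_mul_inv]
      gcongr
  set v := volume (ball (0 : RN N) ℓ) with hv
  have hv0 : v ≠ 0 := (measure_ball_pos _ _ hℓ0).ne'
  have hvt : v ≠ ⊤ := measure_ball_lt_top.ne
  set V := volume (ball (0 : RN N) 2) with hV
  have hVt : V ≠ ⊤ := measure_ball_lt_top.ne
  set E := 2 ^ p * (V * ENNReal.ofReal (C * c) ^ p) with hE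
  have h2p : (2 : ℝ≥0∞) ^ p ≠ ⊤ := ENNReal.rpow_ne_top_of_nonneg hp0.le (by simp)
  have hEt : E ≠ ⊤ := ENNReal.mul_ne_top h2p
    (ENNReal.mul_ne_top hVt (ENNReal.rpow_ne_top_of_nonneg hp0.le ENNReal.ofReal_ne_top))
  refine ⟨2 ^ p + v⁻¹ * (E * D), ENNReal.add_ne_top.2 ⟨h2p, ENNReal.mul_ne_top
    (ENNReal.inv_ne_top.2 hv0) (ENNReal.mul_ne_top hEt hD)⟩, fun x₀ w hw hws => ?_⟩
  set I := ∫⁻ x, locMax φ ℓ w x ^ p with hI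
  have h1 : ∀ x' ∈ ball x₀ ℓ, ∫⁻ x, locMax φ 1 w x ^ p ≤
      2 ^ p * I + E * gMax φ r ℓ w x' ^ p := by
    intro x' hx'
    have hm := (measurable_locMax hφ ℓ hw).pow_const p
    have hi : Measurable ((ball x₀ 2).indicator (1 : RN N → ℝ≥0∞)) :=
      measurable_one.indicator measurableSet_ball
    calc _ ≤ ∫⁻ x, 2 ^ p * (locMax φ ℓ w x ^ p +
          (ball x₀ 2).indicator 1 x * (ENNReal.ofReal (C * c) * gMax φ r ℓ w x') ^ p) := by
          refine lintegral_mono fun x => ?_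
          refine (ENNReal.rpow_le_rpow (key x₀ w hw hws x x' hx') hp0.le).trans ?_
          have h3 := sum_rpow_le Finset.univ ![locMax φ ℓ w x, (ball x₀ 2).indicator 1 x *
            (ENNReal.ofReal (C * c) * gMax φ r ℓ w x')] hp0
          simp only [Fin.sum_univ_two, Matrix.cons_val_zero, Matrix.cons_val_one, Finset.card_univ,
            Fintype.card_fin] at h3
          refine h3.trans (le_of_eq ?_)
          congr 2
          by_cases hx : x ∈ ball x₀ 2
          · simp [hx]
          · simp [hx, hp0]
      _ = 2 ^ p * (I + V * (ENNReal.ofReal (C * c) * gMax φ r ℓ w x') ^ p) := by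
          rw [lintegral_const_mul' _ _ h2p, lintegral_add_left hm,
            lintegral_mul_const _ hi, lintegral_indicator_one measurableSet_ball,
            Measure.addHaar_ball_center]
      _ = _ := by
          rw [ENNReal.mul_rpow_of_nonneg _ _ hp0.le, hE]
          ring
  have h2 : v * ∫⁻ x, locMax φ 1 w x ^ p ≤ v * (2 ^ p * I) + E * (D * I) := by
    calc v * ∫⁻ x, locMax φ 1 w x ^ p = ∫⁻ _ in ball x₀ ℓ, ∫⁻ x, locMax φ 1 w x ^ p := by
          rw [setLIntegral_const, Measure.addHaar_ball_center, mul_comm]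
      _ ≤ ∫⁻ x' in ball x₀ ℓ, (2 ^ p * I + E * gMax φ r ℓ w x' ^ p) :=
          setLIntegral_mono' measurableSet_ball h1
      _ = v * (2 ^ p * I) + E * ∫⁻ x' in ball x₀ ℓ, gMax φ r ℓ w x' ^ p := by
          rw [lintegral_add_left measurable_const, setLIntegral_const, Measure.addHaar_ball_center,
            mul_comm, lintegral_const_mul _ ((measurable_gMax hr0 ℓ w).pow_const p)]
      _ ≤ _ := by
          gcongr
          exact (setLIntegral_le_lintegral _ _).trans
            (hDg ℓ w hw (hasCompactSupport_of_dist_le hws))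
  calc ∫⁻ x, locMax φ 1 w x ^ p = v⁻¹ * (v * ∫⁻ x, locMax φ 1 w x ^ p) := by
        rw [← mul_assoc, ENNReal.inv_mul_cancel hv0 hvt, one_mul]
    _ ≤ v⁻¹ * (v * (2 ^ p * I) + E * (D * I)) := by gcongr
    _ = (v⁻¹ * v) * (2 ^ p * I) + v⁻¹ * (E * (D * I)) := by ring
    _ = _ := by
        rw [ENNReal.inv_mul_cancel hv0 hvt]
        ring

end perturbation

/-! ### The local estimate -/

section local_estimate

variable {φ : RN N → ℝ} {m n₁ n₂ : ℕ}

theorem exists_smooth_coeff {Ω : Set (RN N)} (hΩ : IsOpen Ω) {x₀ : RN N} {ρ : ℝ} (hρ : 0 < ρ)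
    (hsub : closedBall x₀ (2 * ρ) ⊆ Ω) {g : RN N → ℂ} (hg : ContDiffOn ℝ (⊤ : ℕ∞) g Ω) :
    ∃ b : RN N → ℂ, ContDiff ℝ (⊤ : ℕ∞) b ∧ HasCompactSupport b ∧ b x₀ = 0 ∧
      ∀ y ∈ ball x₀ ρ, b y = g y - g x₀ := by
  let χ : ContDiffBump x₀ := ⟨ρ, 2 * ρ, hρ, by linarith⟩
  have hχc : HasCompactSupport fun y => (χ y) • (g y - g x₀) := χ.hasCompactSupport.smul_right
  refine ⟨fun y => (χ y) • (g y - g x₀), contDiff_iff_contDiffAt.2 fun y => ?_, hχc, by simp,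
    fun y hy => ?_⟩
  · by_cases hy : y ∈ Ω
    · exact χ.contDiff.contDiffAt.smul ((hg.contDiffAt (hΩ.mem_nhds hy)).sub contDiffAt_const)
    · have hy' : y ∉ tsupport χ := by
        rw [χ.tsupport_eq]
        exact fun h => hy (hsub h)
      refine (contDiffAt_const (c := (0 : ℂ))).congr_of_eventuallyEq ?_
      filter_upwards [notMem_tsupport_iff_eventuallyEq.1 hy'] with z hz
      simp [hz]
  · have : χ y = 1 := χ.one_of_mem_closedBall (ball_subset_closedBall hy)
    simp [this]

/-- The a priori estimate at a small scale for a perturbation of a frozen elliptic operator. -/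
theorem exists_lintegral_locMax_md_le (hN0 : N ≠ 0) (hφ : GoodPhi φ) {p : ℝ} (hp0 : 0 < p)
    {c : (Fin N → ℕ) → Matrix (Fin n₂) (Fin n₁) ℂ}
    (hc : ∀ ξ : RN N, ξ ≠ 0 → Function.Injective (symbolMatrix m c ξ).mulVec) {x₀ : RN N}
    {b : (Fin N → ℕ) → Fin n₂ → Fin n₁ → RN N → ℂ}
    (hb : ∀ α ∈ idxEq N m, ∀ j i, ContDiff ℝ (⊤ : ℕ∞) (b α j i))
    (hbc : ∀ α ∈ idxEq N m, ∀ j i, HasCompactSupport (b α j i))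
    (hb0 : ∀ α ∈ idxEq N m, ∀ j i, b α j i x₀ = 0) :
    ∃ ℓ₀ : ℝ, 0 < ℓ₀ ∧ ∃ C : ℝ≥0∞, C ≠ ⊤ ∧ ∀ ℓ, 0 < ℓ → ℓ ≤ ℓ₀ → ∀ v : Fin n₁ → RN N → ℂ,
      (∀ i, ContDiff ℝ (⊤ : ℕ∞) (v i)) → (∀ i, tsupport (v i) ⊆ closedBall x₀ ℓ) →
      ∑ β ∈ idxEq N m, ∑ i, ∫⁻ x, locMax φ ℓ (md β (v i)) x ^ p ≤
        C * ∑ j, ∫⁻ x, locMax φ ℓ (fun y => frozenOp m c v j y +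
          ∑ α ∈ idxEq N m, ∑ i, b α j i y * md α (v i) y) x ^ p := by
  have hM : ∀ β i, ∃ C : ℝ≥0∞, C ≠ ⊤ ∧ (β ∈ idxEq N m → ∀ (x₀ : RN N) (ℓ : ℝ), 0 < ℓ →
      ∀ v : Fin n₁ → RN N → ℂ, (∀ i, ContDiff ℝ (⊤ : ℕ∞) (v i)) →
      (∀ i, tsupport (v i) ⊆ closedBall x₀ ℓ) → ∫⁻ x, locMax φ ℓ (md β (v i)) x ^ p ≤
        C * ∑ j, ∫⁻ x, locMax φ ℓ (frozenOp m c v j) x ^ p) := by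
    intro β i
    by_cases hβ : β ∈ idxEq N m
    swap
    · exact ⟨0, by simp, fun h => absurd h hβ⟩
    have hβm := mOrder_of_mem_idxEq hβ
    obtain ⟨C, hCt, hC⟩ := exists_lintegral_locMax_le_sum hN0 hφ
      (fun j => homSymbol_symbolInv hc hβm i j) hp0
    refine ⟨C, hCt, fun _ x₀ ℓ hℓ v hv hvs => ?_⟩
    have hvc : ∀ i, HasCompactSupport (v i) := fun i =>
      (isCompact_closedBall x₀ ℓ).of_isClosed_subset (isClosed_tsupport _) (hvs i)
    refine hC x₀ ℓ hℓ _ ((hv i).md_smooth β)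
      (fun y hy => hvs i (tsupport_md_subset β _ (subset_tsupport _ hy))) _
      (fun j => contDiff_frozenOp hv j) (fun j y hy => ?_)
      (isTransform_frozenOp hN0 hφ hc hβm hv hvc i)
    by_contra hd
    exact hy (frozenOp_eq_zero (fun i hi => hd (hvs i hi)) j)
  choose A hAt hA using hM
  have hK : ∀ α j i, ∃ K : ℝ≥0∞, K ≠ ⊤ ∧ (α ∈ idxEq N m → ∀ ℓ ≤ 1, ∀ f : RN N → ℂ, Continuous f →
      HasCompactSupport f → (∀ y, f y ≠ 0 → dist y x₀ ≤ ℓ) →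
      ∫⁻ x, locMax φ ℓ (fun y => -b α j i y * f y) x ^ p ≤
        K * ENNReal.ofReal ℓ ^ p * ∫⁻ x, locMax φ ℓ f x ^ p) := by
    intro α j i
    by_cases hα : α ∈ idxEq N m
    swap
    · exact ⟨0, by simp, fun h => absurd h hα⟩
    obtain ⟨K, hKt, hK⟩ := hφ.exists_lintegral_locMax_mul_le hN0 hp0 (b := fun y => -b α j i y)
      (hb α hα j i).neg (hbc α hα j i).neg (x₀ := x₀) (by simp [hb0 α hα j i])
    exact ⟨K, hKt, fun _ => hK⟩
  choose K hKt hK using hK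
  set S := (idxEq N m ×ˢ (Finset.univ : Finset (Fin n₁))) with hS
  set A' := ∑ β ∈ idxEq N m, ∑ i, A β i with hA'
  set K' := ∑ j, 2 ^ p * ((S.card : ℝ≥0∞) ^ p * ∑ k ∈ S, K k.1 j k.2) with hK'
  have hA't : A' ≠ ⊤ := ENNReal.sum_ne_top.2 fun β _ => ENNReal.sum_ne_top.2 fun i _ => hAt β i
  have h2p : (2 : ℝ≥0∞) ^ p ≠ ⊤ := ENNReal.rpow_ne_top_of_nonneg hp0.le (by simp)
  have hK't : K' ≠ ⊤ := ENNReal.sum_ne_top.2 fun j _ => ENNReal.mul_ne_top h2p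
    (ENNReal.mul_ne_top (ENNReal.rpow_ne_top_of_nonneg hp0.le (by simp))
      (ENNReal.sum_ne_top.2 fun k _ => hKt _ _ _))
  obtain ⟨ℓ₀, hℓ₀, hℓ₁, hsmall⟩ : ∃ ℓ₀ : ℝ, 0 < ℓ₀ ∧ ℓ₀ ≤ 1 ∧
      A' * (K' * ENNReal.ofReal ℓ₀ ^ p) ≤ 2⁻¹ := by
    have ht : Tendsto (fun ℓ : ℝ => A' * (K' * ENNReal.ofReal ℓ ^ p)) (𝓝[>] 0) (𝓝 0) := by
      have h1 : Tendsto (fun ℓ : ℝ => ENNReal.ofReal ℓ ^ p) (𝓝 0) (𝓝 0) := by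
        have := (ENNReal.continuous_rpow_const (y := p)).tendsto 0 |>.comp
          (ENNReal.ofReal_zero ▸ ENNReal.continuous_ofReal.tendsto 0)
        simpa [ENNReal.zero_rpow_of_pos hp0, Function.comp_def] using this
      have h2 := ENNReal.Tendsto.const_mul (ENNReal.Tendsto.const_mul h1 (Or.inr hK't))
        (Or.inr hA't)
      simp only [mul_zero] at h2
      exact h2.mono_left nhdsWithin_le_nhds
    obtain ⟨ℓ₀, h3, h1, h2⟩ := ((ht.eventually_le_const (show (0 : ℝ≥0∞) < 2⁻¹ by simp)).and
      (Ioc_mem_nhdsGT one_pos)).exists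
    exact ⟨ℓ₀, h1, h2, h3⟩
  refine ⟨ℓ₀, hℓ₀, 2 * (A' * 2 ^ p), by finiteness, fun ℓ hℓ hℓℓ₀ v hv hvs => ?_⟩
  have hvc : ∀ i, HasCompactSupport (v i) := fun i =>
    (isCompact_closedBall x₀ ℓ).of_isClosed_subset (isClosed_tsupport _) (hvs i)
  have hws : ∀ β i y, md β (v i) y ≠ 0 → dist y x₀ ≤ ℓ := fun β i y hy =>
    hvs i (tsupport_md_subset β _ (subset_tsupport _ hy))
  have hwc : ∀ β i, Continuous (md β (v i)) := fun β i => ((hv i).md_smooth β).continuous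
  set X := ∑ β ∈ idxEq N m, ∑ i, ∫⁻ x, locMax φ ℓ (md β (v i)) x ^ p with hX
  set g : Fin n₂ → RN N → ℂ := fun j y => frozenOp m c v j y +
    ∑ α ∈ idxEq N m, ∑ i, b α j i y * md α (v i) y with hg
  have hgc : ∀ j, Continuous (g j) := fun j => (contDiff_frozenOp hv j).continuous.add
    (continuous_finsetSum _ fun α hα => continuous_finsetSum _ fun i _ =>
      (hb α hα j i).continuous.mul (hwc α i))
  have hXt : X ≠ ⊤ := ENNReal.sum_ne_top.2 fun β _ => ENNReal.sum_ne_top.2 fun i _ =>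
    (lintegral_locMax_rpow_lt_top hφ hp0 (hwc β i) (hws β i)).ne
  have hF : ∀ j, ∫⁻ x, locMax φ ℓ (frozenOp m c v j) x ^ p ≤
      2 ^ p * (∫⁻ x, locMax φ ℓ (g j) x ^ p) +
        2 ^ p * ((S.card : ℝ≥0∞) ^ p * ∑ k ∈ S, K k.1 j k.2) * ENNReal.ofReal ℓ ^ p * X := by
    intro j
    have hWc : ∀ k ∈ S, Continuous fun y => -b k.1 j k.2 y * md k.1 (v k.2) y := fun k hk =>
      (hb k.1 (Finset.mem_product.1 hk).1 j k.2).continuous.neg.mul (hwc _ _)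
    have e : frozenOp m c v j =
        fun y => g j y + ∑ k ∈ S, -b k.1 j k.2 y * md k.1 (v k.2) y := by
      ext y
      simp only [hg, hS, Finset.sum_product, neg_mul, Finset.sum_neg_distrib]
      ring
    rw [e]
    refine (lintegral_locMax_add_le hφ hp0 ℓ (hgc j) (continuous_finsetSum _ hWc)).trans ?_
    rw [mul_add, mul_assoc, mul_assoc, mul_assoc]
    gcongr 2 ^ p * _ + 2 ^ p * ?_
    refine (lintegral_locMax_sum_le hφ hp0 ℓ S hWc).trans ?_
    gcongr
    rw [Finset.sum_mul]
    refine Finset.sum_le_sum fun k hk => ?_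
    have hk1 := (Finset.mem_product.1 hk).1
    refine (hK k.1 j k.2 hk1 ℓ (hℓℓ₀.trans hℓ₁) _ (hwc _ _)
      ((hvc _).md_compact _) (hws _ _)).trans ?_
    rw [mul_assoc]
    gcongr
    rw [hX]
    exact (Finset.single_le_sum (f := fun i => ∫⁻ x, locMax φ ℓ (md k.1 (v i)) x ^ p)
      (fun _ _ => zero_le) (Finset.mem_univ k.2)).trans
      (Finset.single_le_sum (f := fun β => ∑ i, ∫⁻ x, locMax φ ℓ (md β (v i)) x ^ p)
        (fun _ _ => zero_le) hk1)
  set Y := ∑ j, ∫⁻ x, locMax φ ℓ (g j) x ^ p with hY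
  have hmain : X ≤ A' * 2 ^ p * Y + 2⁻¹ * X := by
    calc X ≤ ∑ β ∈ idxEq N m, ∑ i, A β i * ∑ j, ∫⁻ x, locMax φ ℓ (frozenOp m c v j) x ^ p :=
          Finset.sum_le_sum fun β hβ => Finset.sum_le_sum fun i _ => hA β i hβ x₀ ℓ hℓ v hv hvs
      _ = A' * ∑ j, ∫⁻ x, locMax φ ℓ (frozenOp m c v j) x ^ p := by
          simp only [hA', Finset.sum_mul]
      _ ≤ A' * ∑ j, (2 ^ p * (∫⁻ x, locMax φ ℓ (g j) x ^ p) +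
          2 ^ p * ((S.card : ℝ≥0∞) ^ p * ∑ k ∈ S, K k.1 j k.2) * ENNReal.ofReal ℓ ^ p * X) := by
          gcongr with j
          exact hF j
      _ = A' * 2 ^ p * Y + A' * (K' * ENNReal.ofReal ℓ ^ p) * X := by
          rw [Finset.sum_add_distrib, ← Finset.mul_sum, ← Finset.sum_mul, ← Finset.sum_mul]
          ring
      _ ≤ _ := by
          gcongr
          refine le_trans ?_ hsmall
          gcongr
  have hhalf : X = 2⁻¹ * X + 2⁻¹ * X := by
    rw [← add_mul, ENNReal.inv_two_add_inv_two, one_mul]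
  have h3 : 2⁻¹ * X ≤ A' * 2 ^ p * Y := by
    refine (ENNReal.add_le_add_iff_right (a := 2⁻¹ * X) (ENNReal.mul_ne_top (by simp) hXt)).1 ?_
    rwa [← hhalf]
  calc X = 2 * (2⁻¹ * X) := by
        rw [← mul_assoc, ENNReal.mul_inv_cancel (by simp) (by simp), one_mul]
    _ ≤ 2 * (A' * 2 ^ p * Y) := by gcongr
    _ = _ := by ring

theorem smallMax_eq_locMax (φ : RN N → ℝ) (u : RN N → ℂ) : smallMax φ u = locMax φ 1 u := by
  ext x
  simp only [smallMax, locMax, ofReal_norm]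

theorem locMax_mono_scale (φ : RN N → ℝ) {ℓ ℓ' : ℝ} (h : ℓ ≤ ℓ') (u : RN N → ℂ) (x : RN N) :
    locMax φ ℓ u x ≤ locMax φ ℓ' u x :=
  iSup₂_le fun _ ht => enorm_convAt_le_locMax ⟨ht.1, ht.2.trans_le h⟩ u x

end local_estimate

/-- Proposition 5.1: local `h^p` a priori estimate for the principal part of an
elliptic operator. -/
theorem statement10 {N m n₁ n₂ : ℕ} (hN : 2 ≤ N) (hm : 1 ≤ m) (hn₁ : 1 ≤ n₁) (hn : n₁ ≤ n₂)
    (p : ℝ) (hp0 : 0 < p) (hpN : p < N)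
    (Ω : Set (RN N)) (hΩ : IsOpen Ω)
    (a : (Fin N → ℕ) → RN N → Matrix (Fin n₂) (Fin n₁) ℂ)
    (ha : ∀ α : Fin N → ℕ, mOrder α ≤ m → ∀ i j,
      ContDiffOn ℝ (⊤ : ℕ∞) (fun x => a α x i j) Ω)
    (hell : Elliptic a m Ω)
    (φ₀ : RN N → ℝ) (hφ₀ : GoodPhi φ₀)
    (x₀ : RN N) (hx₀ : x₀ ∈ Ω) :
    ∃ ℓ : ℝ, 0 < ℓ ∧ ball x₀ ℓ ⊆ Ω ∧
      ∃ C : ℝ, 0 < C ∧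
        ∀ u : RN N → (Fin n₁ → ℂ), ContDiff ℝ (⊤ : ℕ∞) u → HasCompactSupport u →
          tsupport u ⊆ ball x₀ ℓ →
          ∑ β ∈ idxEq N m, hNormVec φ₀ p (md β u) ≤
            ENNReal.ofReal C * hNormVec φ₀ p (applyAP a m u) := by

  have hN0 : N ≠ 0 := by omega
  obtain ⟨ε, hε, hεΩ⟩ := Metric.isOpen_iff.1 hΩ x₀ hx₀
  have hρ : 0 < ε / 4 := by positivity
  have hsub : closedBall x₀ (2 * (ε / 4)) ⊆ Ω := (closedBall_subset_ball (by linarith)).trans hεΩ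
  have hb : ∀ α j i, ∃ b : RN N → ℂ, α ∈ idxEq N m → ContDiff ℝ (⊤ : ℕ∞) b ∧ HasCompactSupport b ∧
      b x₀ = 0 ∧ ∀ y ∈ ball x₀ (ε / 4), b y = a α y j i - a α x₀ j i := by
    intro α j i
    by_cases hα : α ∈ idxEq N m
    · obtain ⟨b, hb⟩ := exists_smooth_coeff hΩ hρ hsub (ha α (mOrder_of_mem_idxEq hα).le j i)
      exact ⟨b, fun _ => hb⟩
    · exact ⟨0, fun h => absurd h hα⟩
  choose b hb using hb
  obtain ⟨ℓ₀, hℓ₀, C, hCt, hC⟩ := exists_lintegral_locMax_md_le hN0 hφ₀ hp0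
    (c := fun α => a α x₀) (hell x₀ hx₀) (x₀ := x₀) (b := b) (fun α hα j i => (hb α j i hα).1)
    (fun α hα j i => (hb α j i hα).2.1) (fun α hα j i => (hb α j i hα).2.2.1)
  set ℓ := min ℓ₀ (min 1 (ε / 4)) with hℓ
  have hℓ0 : 0 < ℓ := lt_min hℓ₀ (lt_min one_pos hρ)
  have hℓ1 : ℓ ≤ 1 := (min_le_right _ _).trans (min_le_left _ _)
  have hℓρ : ℓ ≤ ε / 4 := (min_le_right _ _).trans (min_le_right _ _)
  obtain ⟨D, hDt, hD⟩ := hφ₀.exists_lintegral_locMax_one_le hN0 hp0 hℓ0 hℓ1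
  have hp' : 0 < 1 / p := by positivity
  set K : ℝ≥0∞ := (idxEq N m).card * (n₁ * ((D * C) ^ (1 / p) * (n₂ : ℝ≥0∞) ^ (1 / p))) with hK
  have hKt : K ≠ ⊤ := ENNReal.mul_ne_top (by simp) (ENNReal.mul_ne_top (by simp)
    (ENNReal.mul_ne_top (ENNReal.rpow_ne_top_of_nonneg hp'.le (ENNReal.mul_ne_top hDt hCt))
      (ENNReal.rpow_ne_top_of_nonneg hp'.le (by simp))))
  refine ⟨ℓ, hℓ0, (ball_subset_ball (by linarith)).trans hεΩ, K.toReal + 1, by positivity,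
    fun u hu _ hus => ?_⟩
  have hv : ∀ i, ContDiff ℝ (⊤ : ℕ∞) fun x => u x i := contDiff_pi.1 hu
  have hvs' : ∀ i, tsupport (fun x => u x i) ⊆ ball x₀ ℓ := fun i =>
    (closure_mono fun x (hx : u x i ≠ 0) (h : u x = 0) => hx (by simp [h])).trans hus
  have hvs : ∀ i, tsupport (fun x => u x i) ⊆ closedBall x₀ ℓ := fun i =>
    (hvs' i).trans ball_subset_closedBall
  have hg : ∀ j, (fun x => applyAP a m u x j) = fun y =>
      frozenOp m (fun α => a α x₀) (fun i x => u x i) j y +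
        ∑ α ∈ idxEq N m, ∑ i, b α j i y * md α (fun x => u x i) y := by
    intro j
    ext y
    simp only [applyAP, Finset.sum_apply, Matrix.mulVec, dotProduct, frozenOp,
      ← Finset.sum_add_distrib]
    refine Finset.sum_congr rfl fun α hα => Finset.sum_congr rfl fun i _ => ?_
    rw [← congrFun (md_apply α hu i) y]
    by_cases hy : y ∈ ball x₀ (ε / 4)
    · rw [(hb α j i hα).2.2.2 y hy]
      ring
    · have : md α u y i = 0 := by
        rw [congrFun (md_apply α hu i) y]
        exact image_eq_zero_of_notMem_tsupport fun h =>
          hy (ball_subset_ball hℓρ (hvs' i (tsupport_md_subset α _ h)))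
      rw [this]
      ring
  set Y := ∑ j, ∫⁻ x, smallMax φ₀ (fun x => applyAP a m u x j) x ^ p with hY
  have hX : ∀ β ∈ idxEq N m, ∀ i,
      ∫⁻ x, smallMax φ₀ (fun x => md β u x i) x ^ p ≤ D * C * Y := by
    intro β hβ i
    rw [md_apply β hu i, smallMax_eq_locMax, mul_assoc]
    refine (hD x₀ _ ((hv i).md_smooth β).continuous fun y hy =>
      hvs i (tsupport_md_subset β _ (subset_tsupport _ hy))).trans ?_
    gcongr
    refine le_trans ?_ ((hC ℓ hℓ0 (min_le_left _ _) (fun i x => u x i) hv hvs).trans ?_)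
    · exact (Finset.single_le_sum
          (f := fun i => ∫⁻ x, locMax φ₀ ℓ (md β fun x => u x i) x ^ p)
          (fun _ _ => zero_le) (Finset.mem_univ i)).trans (Finset.single_le_sum
          (f := fun β => ∑ i, ∫⁻ x, locMax φ₀ ℓ (md β fun x => u x i) x ^ p)
          (fun _ _ => zero_le) hβ)
    · simp only [← hg, hY, smallMax_eq_locMax]
      gcongr with j _ x
      exact locMax_mono_scale φ₀ hℓ1 _ x
  have hYp : Y ^ (1 / p) ≤ (n₂ : ℝ≥0∞) ^ (1 / p) * hNormVec φ₀ p (applyAP a m u) := by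
    have := sum_rpow_le Finset.univ
      (fun j => ∫⁻ x, smallMax φ₀ (fun x => applyAP a m u x j) x ^ p) hp'
    rw [Finset.card_univ, Fintype.card_fin] at this
    exact this
  have hterm : ∀ β ∈ idxEq N m, hNormVec φ₀ p (md β u) ≤
      n₁ * ((D * C) ^ (1 / p) * (n₂ : ℝ≥0∞) ^ (1 / p)) * hNormVec φ₀ p (applyAP a m u) := by
    intro β hβ
    calc hNormVec φ₀ p (md β u) ≤ ∑ _ : Fin n₁, (D * C) ^ (1 / p) *
          ((n₂ : ℝ≥0∞) ^ (1 / p) * hNormVec φ₀ p (applyAP a m u)) := by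
          refine Finset.sum_le_sum fun i _ => ?_
          refine (ENNReal.rpow_le_rpow (hX β hβ i) hp'.le).trans ?_
          rw [ENNReal.mul_rpow_of_nonneg _ _ hp'.le]
          gcongr
      _ = _ := by
          rw [Finset.sum_const, Finset.card_univ, Fintype.card_fin, nsmul_eq_mul]
          ring
  calc _ ≤ ∑ _ ∈ idxEq N m, n₁ * ((D * C) ^ (1 / p) * (n₂ : ℝ≥0∞) ^ (1 / p)) *
        hNormVec φ₀ p (applyAP a m u) := Finset.sum_le_sum hterm
    _ = K * hNormVec φ₀ p (applyAP a m u) := by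
        rw [Finset.sum_const, nsmul_eq_mul, hK]
        ring
    _ ≤ _ := by
        gcongr
        rw [← ENNReal.ofReal_toReal hKt]
        exact ENNReal.ofReal_le_ofReal (by rw [ENNReal.toReal_ofReal ENNReal.toReal_nonneg]; linarith)
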